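/- There exist universal constants 0 < c ≤ C < ∞ such that for every bounded set E ⊆ ℝ², the infimum ℓ(E) of the lengths of connected rectifiable curves containing E satisfies c·( diam(E) + Σ_Q β_E(3⊙Q)²·diam(Q) ) ≤ ℓ(E) ≤ C·( diam(E) + Σ_Q β_E(3⊙Q)²·diam(Q) ), where the sum is over all dyadic squares Q in the plane (in particular, ℓ(E) is finite if and only if the sum is finite). -/

import Mathlib

open Set MeasureTheory Metric
open scoped ENNReal NNReal

noncomputable section

/-- A line in the plane. -/
def IsLine (L : Set ℂ) : Prop :=
  ∃ a b : ℂ, b ≠ 0 ∧ L = {z | ∃ t : ℝ, z = a + (t : ℂ) * b}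

/-- Jones's `β`-number `β_E(S) = diam(S)⁻¹ · inf_L sup_{z ∈ E ∩ S} dist(z, L)`, the infimum
over lines `L` meeting `S`. -/
def betaNum (E S : Set ℂ) : ℝ :=
  (Metric.diam S)⁻¹ *
    sInf {d | ∃ L : Set ℂ, IsLine L ∧ (L ∩ S).Nonempty ∧
      d = sSup {r | ∃ z ∈ E ∩ S, r = Metric.infDist z L}}

/-- The dyadic square `[j·2^{−k}, (j+1)·2^{−k}] × [i·2^{−k}, (i+1)·2^{−k}]`. -/
def dyadicSq (k i j : ℤ) : Set ℂ :=
  {z | z.re ∈ Set.Icc ((j : ℝ) * (2 : ℝ) ^ (-k)) (((j : ℝ) + 1) * (2 : ℝ) ^ (-k)) ∧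
       z.im ∈ Set.Icc ((i : ℝ) * (2 : ℝ) ^ (-k)) (((i : ℝ) + 1) * (2 : ℝ) ^ (-k))}

/-- `3⊙Q`: the concentric square of three times the side length (a 3×3 grid of congruent
squares with `Q` central). -/
def dyadicSq3 (k i j : ℤ) : Set ℂ :=
  {z | z.re ∈ Set.Icc (((j : ℝ) - 1) * (2 : ℝ) ^ (-k)) (((j : ℝ) + 2) * (2 : ℝ) ^ (-k)) ∧
       z.im ∈ Set.Icc (((i : ℝ) - 1) * (2 : ℝ) ^ (-k)) (((i : ℝ) + 2) * (2 : ℝ) ^ (-k))}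

/-- The Jones square-sum `Σ_Q β_E(3⊙Q)²·diam Q` over all dyadic squares of the plane. -/
def jonesSum (E : Set ℂ) : ℝ≥0∞ :=
  ∑' p : ℤ × ℤ × ℤ,
    ENNReal.ofReal (betaNum E (dyadicSq3 p.1 p.2.1 p.2.2) ^ 2 *
      Metric.diam (dyadicSq p.1 p.2.1 p.2.2))

/-- The length `ℓ(E)` of the shortest connected (rectifiable) curve containing `E`: the
infimum of the 1-dimensional Hausdorff measures of compact connected sets containing `E`. -/
def shortestLength (E : Set ℂ) : ℝ≥0∞ :=
  ⨅ (Γ : Set ℂ) (_ : IsCompact Γ ∧ IsConnected Γ ∧ E ⊆ Γ), μH[1] Γ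

noncomputable section

lemma sd_pos (k : ℤ) : 0 < (2:ℝ) ^ (-k) := by positivity

lemma abs_re_le_dist (z w : ℂ) : |z.re - w.re| ≤ dist z w := by
  rw [dist_eq_norm, ← Complex.sub_re]; exact Complex.abs_re_le_norm _

lemma abs_im_le_dist (z w : ℂ) : |z.im - w.im| ≤ dist z w := by
  rw [dist_eq_norm, ← Complex.sub_im]; exact Complex.abs_im_le_norm _

lemma dist_le_re_im (z w : ℂ) : dist z w ≤ |z.re - w.re| + |z.im - w.im| := by
  rw [dist_eq_norm, ← Complex.sub_im, ← Complex.sub_re]; exact Complex.norm_le_abs_re_add_abs_im _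

lemma dist_lt_of_re_im {z w : ℂ} {r : ℝ} (hr : 0 < r) (h1 : |z.re - w.re| ≤ r / 2)
    (h2 : |z.im - w.im| ≤ r / 2) : dist z w < r := by
  rw [Complex.dist_eq_re_im]
  rw [Real.sqrt_lt' hr]
  have := sq_le_sq' (abs_le.1 h1).1 (abs_le.1 h1).2
  have := sq_le_sq' (abs_le.1 h2).1 (abs_le.1 h2).2
  nlinarith

lemma sq3_bdd (k i j : ℤ) : Bornology.IsBounded (dyadicSq3 k i j) := by
  rw [Metric.isBounded_iff]
  refine ⟨3 * (2:ℝ)^(-k) + 3 * (2:ℝ)^(-k), fun z hz w hw => (dist_le_re_im z w).trans ?_⟩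
  obtain ⟨⟨h1, h2⟩, h3, h4⟩ := hz
  obtain ⟨⟨h5, h6⟩, h7, h8⟩ := hw
  have : |z.re - w.re| ≤ 3 * (2:ℝ)^(-k) := abs_le.2 ⟨by linarith, by linarith⟩
  have : |z.im - w.im| ≤ 3 * (2:ℝ)^(-k) := abs_le.2 ⟨by linarith, by linarith⟩
  linarith

lemma sq_bdd (k i j : ℤ) : Bornology.IsBounded (dyadicSq k i j) := by
  rw [Metric.isBounded_iff]
  refine ⟨(2:ℝ)^(-k) + (2:ℝ)^(-k), fun z hz w hw => (dist_le_re_im z w).trans ?_⟩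
  obtain ⟨⟨h1, h2⟩, h3, h4⟩ := hz
  obtain ⟨⟨h5, h6⟩, h7, h8⟩ := hw
  have : |z.re - w.re| ≤ (2:ℝ)^(-k) := abs_le.2 ⟨by linarith, by linarith⟩
  have : |z.im - w.im| ≤ (2:ℝ)^(-k) := abs_le.2 ⟨by linarith, by linarith⟩
  linarith

lemma sq3_diam_le (k i j : ℤ) : Metric.diam (dyadicSq3 k i j) ≤ 6 * (2:ℝ)^(-k) := by
  have := sd_pos k
  refine Metric.diam_le_of_forall_dist_le (by positivity) fun z hz w hw => (dist_le_re_im z w).trans ?_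
  obtain ⟨⟨h1, h2⟩, h3, h4⟩ := hz
  obtain ⟨⟨h5, h6⟩, h7, h8⟩ := hw
  have : |z.re - w.re| ≤ 3 * (2:ℝ)^(-k) := abs_le.2 ⟨by linarith, by linarith⟩
  have : |z.im - w.im| ≤ 3 * (2:ℝ)^(-k) := abs_le.2 ⟨by linarith, by linarith⟩
  linarith

lemma sq_diam_le (k i j : ℤ) : Metric.diam (dyadicSq k i j) ≤ 2 * (2:ℝ)^(-k) := by
  have := sd_pos k
  refine Metric.diam_le_of_forall_dist_le (by positivity) fun z hz w hw => (dist_le_re_im z w).trans ?_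
  obtain ⟨⟨h1, h2⟩, h3, h4⟩ := hz
  obtain ⟨⟨h5, h6⟩, h7, h8⟩ := hw
  have : |z.re - w.re| ≤ (2:ℝ)^(-k) := abs_le.2 ⟨by linarith, by linarith⟩
  have : |z.im - w.im| ≤ (2:ℝ)^(-k) := abs_le.2 ⟨by linarith, by linarith⟩
  linarith

lemma sq_diam_ge (k i j : ℤ) : (2:ℝ)^(-k) ≤ Metric.diam (dyadicSq k i j) := by
  have := sd_pos k
  have h := Metric.dist_le_diam_of_mem (sq_bdd k i j)
    (x := ⟨(j:ℝ) * (2:ℝ)^(-k), (i:ℝ) * (2:ℝ)^(-k)⟩)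
    (y := ⟨((j:ℝ)+1) * (2:ℝ)^(-k), (i:ℝ) * (2:ℝ)^(-k)⟩)
    ⟨⟨le_refl _, by nlinarith⟩, le_refl _, by nlinarith⟩
    ⟨⟨by nlinarith, le_refl _⟩, le_refl _, by nlinarith⟩
  refine le_trans ?_ ((abs_re_le_dist _ _).trans h)
  refine le_trans (le_of_eq ?_) (neg_le_abs _)
  simp only; ring

lemma sq3_diam_ge (k i j : ℤ) : 3 * (2:ℝ)^(-k) ≤ Metric.diam (dyadicSq3 k i j) := by
  have := sd_pos k
  have h := Metric.dist_le_diam_of_mem (sq3_bdd k i j)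
    (x := ⟨((j:ℝ) - 1) * (2:ℝ)^(-k), (i:ℝ) * (2:ℝ)^(-k)⟩)
    (y := ⟨((j:ℝ)+2) * (2:ℝ)^(-k), (i:ℝ) * (2:ℝ)^(-k)⟩)
    ⟨⟨le_refl _, by nlinarith⟩, by nlinarith, by nlinarith⟩
    ⟨⟨by nlinarith, le_refl _⟩, by nlinarith, by nlinarith⟩
  refine le_trans ?_ ((abs_re_le_dist _ _).trans h)
  refine le_trans (le_of_eq ?_) (neg_le_abs _)
  simp only; ring

lemma sq3_nonempty (k i j : ℤ) : (dyadicSq3 k i j).Nonempty := by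
  have := sd_pos k
  exact ⟨⟨(j:ℝ) * (2:ℝ)^(-k), (i:ℝ) * (2:ℝ)^(-k)⟩,
    ⟨by nlinarith, by nlinarith⟩, by nlinarith, by nlinarith⟩

/-- lines -/
lemma line_through (a b : ℂ) (hb : b ≠ 0) : IsLine {z | ∃ t : ℝ, z = a + (t : ℂ) * b} :=
  ⟨a, b, hb, rfl⟩

lemma unit_conj {e : ℂ} (he : ‖e‖ = 1) : e * (starRingEnd ℂ) e = 1 := by
  rw [Complex.mul_conj, Complex.normSq_eq_norm_sq, he]; norm_num

lemma infDist_line (a e z : ℂ) (he : ‖e‖ = 1) :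
    infDist z {z | ∃ t : ℝ, z = a + (t : ℂ) * e} = |((z - a) * (starRingEnd ℂ) e).im| := by
  have hne : ({z | ∃ t : ℝ, z = a + (t : ℂ) * e} : Set ℂ).Nonempty := ⟨a, 0, by simp⟩
  have key := unit_conj he
  apply le_antisymm
  · have hmem : a + ((((z - a) * (starRingEnd ℂ) e).re : ℝ) : ℂ) * e ∈
        ({z | ∃ t : ℝ, z = a + (t : ℂ) * e} : Set ℂ) := ⟨_, rfl⟩
    refine (infDist_le_dist_of_mem hmem).trans (le_of_eq ?_)
    rw [dist_eq_norm]
    have : ‖(z - (a + ((((z - a) * (starRingEnd ℂ) e).re : ℝ) : ℂ) * e))‖ =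
        ‖(z - (a + ((((z - a) * (starRingEnd ℂ) e).re : ℝ) : ℂ) * e)) * (starRingEnd ℂ) e‖ := by
      rw [norm_mul, RCLike.norm_conj, he, mul_one]
    rw [this]
    have h2 : (z - (a + ((((z - a) * (starRingEnd ℂ) e).re : ℝ) : ℂ) * e)) * (starRingEnd ℂ) e
        = ((((z - a) * (starRingEnd ℂ) e).im : ℝ) : ℂ) * Complex.I := by
      have h3 := Complex.re_add_im ((z - a) * (starRingEnd ℂ) e)
      linear_combination (-((((z - a) * (starRingEnd ℂ) e).re : ℝ) : ℂ)) * key - h3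
    rw [h2, norm_mul, Complex.norm_I, mul_one, Complex.norm_real, Real.norm_eq_abs]
  · rw [le_infDist hne]
    rintro _ ⟨t, rfl⟩
    have : ((z - a) * (starRingEnd ℂ) e).im = ((z - (a + t * e)) * (starRingEnd ℂ) e).im := by
      have : (z - (a + t * e)) * (starRingEnd ℂ) e = (z - a) * (starRingEnd ℂ) e - (t:ℂ) := by
        linear_combination (-(t:ℂ)) * key
      rw [this]; simp
    rw [this, dist_eq_norm]
    refine (Complex.abs_im_le_norm _).trans ?_
    rw [norm_mul, RCLike.norm_conj, he, mul_one]

lemma line_unit {L : Set ℂ} (hL : IsLine L) : ∃ a e : ℂ, ‖e‖ = 1 ∧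
    L = {z | ∃ t : ℝ, z = a + (t : ℂ) * e} := by
  obtain ⟨a, b, hb, rfl⟩ := hL
  have hb' : ‖b‖ ≠ 0 := norm_ne_zero_iff.2 hb
  refine ⟨a, ((‖b‖⁻¹ : ℝ) : ℂ) * b, ?_, ?_⟩
  · rw [norm_mul, Complex.norm_real, norm_inv, norm_norm, inv_mul_cancel₀ hb']
  · ext z
    constructor
    · rintro ⟨t, rfl⟩
      refine ⟨t * ‖b‖, ?_⟩
      have : (‖b‖ : ℂ) ≠ 0 := by exact_mod_cast hb'
      push_cast; field_simp
    · rintro ⟨t, rfl⟩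
      exact ⟨t * ‖b‖⁻¹, by push_cast; ring⟩

lemma sSup_dist_bdd (E S L : Set ℂ) (hS : Bornology.IsBounded S) :
    BddAbove {r | ∃ z ∈ E ∩ S, r = infDist z L} := by
  rcases L.eq_empty_or_nonempty with rfl | ⟨l, hl⟩
  · exact ⟨0, by rintro _ ⟨z, -, rfl⟩; simp⟩
  · obtain ⟨R, hR⟩ := hS.subset_closedBall l
    exact ⟨R, by
      rintro _ ⟨z, hz, rfl⟩
      exact (infDist_le_dist_of_mem hl).trans (mem_closedBall.1 (hR hz.2))⟩

lemma sSup_dist_nonneg (E S L : Set ℂ) : 0 ≤ sSup {r | ∃ z ∈ E ∩ S, r = infDist z L} := by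
  apply Real.sSup_nonneg
  rintro _ ⟨z, -, rfl⟩; exact infDist_nonneg

lemma beta_set_bdd (E S : Set ℂ) : BddBelow {d | ∃ L : Set ℂ, IsLine L ∧ (L ∩ S).Nonempty ∧
      d = sSup {r | ∃ z ∈ E ∩ S, r = Metric.infDist z L}} :=
  ⟨0, by rintro _ ⟨L, -, -, rfl⟩; exact sSup_dist_nonneg _ _ _⟩

lemma beta_nonneg (E S : Set ℂ) : 0 ≤ betaNum E S := by
  unfold betaNum
  refine mul_nonneg (inv_nonneg.2 diam_nonneg) (Real.sInf_nonneg ?_)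
  rintro _ ⟨L, -, -, rfl⟩; exact sSup_dist_nonneg _ _ _

lemma beta_set_ne (E S : Set ℂ) (hS : S.Nonempty) : {d | ∃ L : Set ℂ, IsLine L ∧ (L ∩ S).Nonempty ∧
      d = sSup {r | ∃ z ∈ E ∩ S, r = Metric.infDist z L}}.Nonempty := by
  obtain ⟨s, hs⟩ := hS
  exact ⟨_, _, line_through s 1 one_ne_zero, ⟨s, ⟨0, by simp⟩, hs⟩, rfl⟩

lemma beta_mono {E F S : Set ℂ} (hEF : E ⊆ F) (hS : S.Nonempty) (hb : Bornology.IsBounded S) :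
    betaNum E S ≤ betaNum F S := by
  unfold betaNum
  refine mul_le_mul_of_nonneg_left ?_ (inv_nonneg.2 diam_nonneg)
  refine le_csInf (beta_set_ne F S hS) ?_
  rintro _ ⟨L, hL, hLS, rfl⟩
  refine (csInf_le (beta_set_bdd E S) ⟨L, hL, hLS, rfl⟩).trans ?_
  rcases ({r | ∃ z ∈ E ∩ S, r = infDist z L}).eq_empty_or_nonempty with h | h
  · rw [h, Real.sSup_empty]; exact sSup_dist_nonneg _ _ _
  · refine csSup_le_csSup (sSup_dist_bdd F S L hb) h ?_
    rintro _ ⟨z, hz, rfl⟩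
    exact ⟨z, ⟨hEF hz.1, hz.2⟩, rfl⟩

lemma beta_le {E S L : Set ℂ} {d : ℝ} (hd : 0 ≤ d) (hL : IsLine L) (hLS : (L ∩ S).Nonempty)
    (h : ∀ z ∈ E ∩ S, infDist z L ≤ d) : betaNum E S * diam S ≤ d := by
  unfold betaNum
  have h1 : sInf {d | ∃ L : Set ℂ, IsLine L ∧ (L ∩ S).Nonempty ∧
      d = sSup {r | ∃ z ∈ E ∩ S, r = Metric.infDist z L}} ≤ d := by
    refine (csInf_le (beta_set_bdd E S) ⟨L, hL, hLS, rfl⟩).trans ?_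
    apply Real.sSup_le _ hd
    rintro _ ⟨z, hz, rfl⟩; exact h z hz
  rcases eq_or_lt_of_le (diam_nonneg (s := S)) with h0 | h0
  · rw [← h0]; simpa using hd
  · rw [mul_comm (diam S)⁻¹, mul_assoc, inv_mul_cancel₀ h0.ne', mul_one]; exact h1

lemma beta_line {E S : Set ℂ} {d : ℝ} (hS : S.Nonempty) (hb : Bornology.IsBounded S)
    (h0 : 0 < diam S) (h : betaNum E S * diam S < d) :
    ∃ L, IsLine L ∧ ∀ z ∈ E ∩ S, infDist z L ≤ d := by
  unfold betaNum at h
  rw [mul_comm (diam S)⁻¹, mul_assoc, inv_mul_cancel₀ h0.ne', mul_one] at h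
  obtain ⟨_, ⟨L, hL, -, rfl⟩, h2⟩ := exists_lt_of_csInf_lt (beta_set_ne E S hS) h
  refine ⟨L, hL, fun z hz => le_trans ?_ h2.le⟩
  exact le_csSup (sSup_dist_bdd E S L hb) ⟨z, hz, rfl⟩

lemma jonesSum_mono {E F : Set ℂ} (hEF : E ⊆ F) : jonesSum E ≤ jonesSum F := by
  unfold jonesSum
  refine ENNReal.tsum_le_tsum fun p => ENNReal.ofReal_le_ofReal ?_
  refine mul_le_mul_of_nonneg_right ?_ diam_nonneg
  exact pow_le_pow_left₀ (beta_nonneg _ _) (beta_mono hEF (sq3_nonempty _ _ _) (sq3_bdd _ _ _)) 2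

end

noncomputable section

/-- connectedness of a finite graph -/
def Conn (V : Finset ℂ) (S : Finset (ℂ × ℂ)) : Prop :=
  ∀ f : ℂ → Prop, (∀ e ∈ S, f e.1 ↔ f e.2) → ∀ x ∈ V, ∀ y ∈ V, (f x ↔ f y)

lemma conn_growth {V : Finset ℂ} {S : Finset (ℂ × ℂ)} (h : Conn V S)
    (hS : ∀ e ∈ S, e.1 ∈ V ∧ e.2 ∈ V) {x0 : ℂ} (hx0 : x0 ∈ V) (P : Finset ℂ → Prop) (h0 : P {x0})
    (hstep : ∀ U ⊆ V, P U → ∀ s ∈ U, ∀ t ∈ V, t ∉ U → ((s, t) ∈ S ∨ (t, s) ∈ S) → P (insert t U)) :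
    P V := by
  classical
  have hne : (V.powerset.filter (fun U => P U ∧ x0 ∈ U)).Nonempty :=
    ⟨{x0}, by simp [hx0, h0]⟩
  obtain ⟨U, hU, hmax⟩ := Finset.exists_max_image _ Finset.card hne
  simp only [Finset.mem_filter, Finset.mem_powerset] at hU hmax
  obtain ⟨hUV, hPU, hxU⟩ := hU
  by_cases hall : ∀ e ∈ S, (e.1 ∈ U ↔ e.2 ∈ U)
  · have : V ⊆ U := fun y hy => (h (· ∈ U) hall x0 hx0 y hy).1 hxU
    rwa [Finset.Subset.antisymm hUV this] at hPU
  · exfalso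
    push Not at hall
    obtain ⟨e, he, hne⟩ := hall
    have key : ∀ s ∈ U, ∀ t ∈ V, t ∉ U → ((s, t) ∈ S ∨ (t, s) ∈ S) → False := by
      intro s hs t ht htU hst
      have h1 := hmax (insert t U) ⟨Finset.insert_subset ht hUV, hstep U hUV hPU s hs t ht htU hst,
        Finset.mem_insert_of_mem hxU⟩
      rw [Finset.card_insert_of_notMem htU] at h1
      omega
    rcases hne with ⟨h1, h2⟩ | ⟨h1, h2⟩
    · exact key _ h1 _ (hS e he).2 h2 (Or.inl he)
    · exact key _ h2 _ (hS e he).1 h1 (Or.inr he)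

lemma conn_card {V : Finset ℂ} {S : Finset (ℂ × ℂ)} (h : Conn V S)
    (hS : ∀ e ∈ S, e.1 ∈ V ∧ e.2 ∈ V) : V.card ≤ S.card + 1 := by
  classical
  rcases V.eq_empty_or_nonempty with rfl | ⟨x0, hx0⟩
  · simp
  have := conn_growth h hS hx0
    (fun U => U.card ≤ (S.filter (fun e => e.1 ∈ U ∧ e.2 ∈ U)).card + 1) (by simp) ?_
  · exact this.trans (by gcongr; apply Finset.filter_subset)
  intro U hU hP s hs t ht htU hst
  rw [Finset.card_insert_of_notMem htU]
  have : (S.filter (fun e => e.1 ∈ U ∧ e.2 ∈ U)).card <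
      (S.filter (fun e => e.1 ∈ insert t U ∧ e.2 ∈ insert t U)).card := by
    apply Finset.card_lt_card
    rw [Finset.ssubset_iff_of_subset]
    · rcases hst with hst | hst
      · exact ⟨(s, t), by simp [hst, hs], by simp [htU]⟩
      · exact ⟨(t, s), by simp [hst, hs], by simp [htU]⟩
    · intro e he
      simp only [Finset.mem_filter, Finset.mem_insert] at he ⊢
      exact ⟨he.1, Or.inr he.2.1, Or.inr he.2.2⟩
  omega

/-- polygonal length -/
def plen : List ℂ → ℝ
  | [] => 0
  | [_] => 0
  | x :: y :: l => dist x y + plen (y :: l)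

lemma plen_nonneg : ∀ l : List ℂ, 0 ≤ plen l
  | [] => le_refl _
  | [_] => le_refl _
  | x :: y :: l => add_nonneg dist_nonneg (plen_nonneg (y :: l))

lemma plen_insert (s t : ℂ) (l2 : List ℂ) : ∀ l1 : List ℂ,
    plen (l1 ++ s :: t :: s :: l2) = plen (l1 ++ s :: l2) + 2 * dist s t
  | [] => by simp [plen, dist_comm t s]; ring
  | [x] => by simp [plen, dist_comm t s]; ring
  | x :: y :: l => by
    have := plen_insert s t l2 (y :: l)
    simp only [List.cons_append, plen] at this ⊢
    rw [this]; ring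

lemma chain_insert {R : ℂ → ℂ → Prop} (s t : ℂ) (l2 : List ℂ) (h1 : R s t) (h2 : R t s) :
    ∀ l1 : List ℂ, List.IsChain R (l1 ++ s :: l2) → List.IsChain R (l1 ++ s :: t :: s :: l2)
  | [] => by simp [h1, h2]
  | [x] => by simp [h1, h2]
  | x :: y :: l => by
    have := chain_insert s t l2 h1 h2 (y :: l)
    simp only [List.cons_append, List.isChain_cons_cons] at this ⊢
    tauto

lemma conn_tour {V : Finset ℂ} {S : Finset (ℂ × ℂ)} (h : Conn V S)
    (hS : ∀ e ∈ S, e.1 ∈ V ∧ e.2 ∈ V) (hV : V.Nonempty) :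
    ∃ l : List ℂ, (∀ x, x ∈ l ↔ x ∈ V) ∧ plen l ≤ 2 * ∑ e ∈ S, dist e.1 e.2 ∧
      List.IsChain (fun a b => (a, b) ∈ S ∨ (b, a) ∈ S) l ∧ l.length + 1 ≤ 2 * V.card := by
  classical
  obtain ⟨x0, hx0⟩ := hV
  have := conn_growth h hS hx0
    (fun U => ∃ l : List ℂ, (∀ x, x ∈ l ↔ x ∈ U) ∧
      plen l ≤ 2 * ∑ e ∈ S.filter (fun e => e.1 ∈ U ∧ e.2 ∈ U), dist e.1 e.2 ∧
      List.IsChain (fun a b => (a, b) ∈ S ∨ (b, a) ∈ S) l ∧ l.length + 1 ≤ 2 * U.card) ?_ ?_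
  · obtain ⟨l, h1, h2, h3⟩ := this
    refine ⟨l, h1, h2.trans ?_, h3⟩
    gcongr
    · apply Finset.filter_subset
  · refine ⟨[x0], by simp, ?_, by simp, by simp⟩
    simp only [plen]
    exact mul_nonneg (by norm_num) (Finset.sum_nonneg fun _ _ => dist_nonneg)
  intro U hU hP s hs t ht htU hst
  obtain ⟨l, h1, h2, h3, h4⟩ := hP
  obtain ⟨l1, l2, rfl⟩ := List.append_of_mem ((h1 s).2 hs)
  refine ⟨l1 ++ s :: t :: s :: l2, ?_, ?_, ?_, ?_⟩
  · intro x
    have := h1 x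
    simp only [List.mem_append, List.mem_cons, Finset.mem_insert] at this ⊢
    rw [← this]; tauto
  · rw [plen_insert]
    obtain ⟨e, he, hed, hmem⟩ : ∃ e ∈ S, dist e.1 e.2 = dist s t ∧
        (e.1 ∈ insert t U ∧ e.2 ∈ insert t U) ∧ ¬ (e.1 ∈ U ∧ e.2 ∈ U) := by
      rcases hst with hst | hst
      · exact ⟨_, hst, rfl, by simp [hs], by simp [htU]⟩
      · exact ⟨_, hst, dist_comm _ _, by simp [hs], by simp [htU]⟩
    have h5 : insert e (S.filter (fun e => e.1 ∈ U ∧ e.2 ∈ U)) ⊆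
        S.filter (fun e => e.1 ∈ insert t U ∧ e.2 ∈ insert t U) := by
      intro e' he'
      rcases Finset.mem_insert.1 he' with rfl | he'
      · exact Finset.mem_filter.2 ⟨he, hmem.1⟩
      · simp only [Finset.mem_filter] at he' ⊢
        exact ⟨he'.1, Finset.mem_insert_of_mem he'.2.1, Finset.mem_insert_of_mem he'.2.2⟩
    have h6 := Finset.sum_le_sum_of_subset_of_nonneg (f := fun e : ℂ × ℂ => dist e.1 e.2) h5
      (fun _ _ _ => dist_nonneg)
    rw [Finset.sum_insert (by simp only [Finset.mem_filter]; tauto), hed] at h6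
    linarith
  · exact chain_insert s t l2 hst hst.symm l1 h3
  · rw [Finset.card_insert_of_notMem htU]
    simp only [List.length_append, List.length_cons] at h4 ⊢
    omega

lemma plen_param : ∀ l : List ℂ, ∃ t : ℂ → ℝ, (∀ x ∈ l.head?, t x = 0) ∧
    (∀ x ∈ l, 0 ≤ t x ∧ t x ≤ plen l) ∧ ∀ x ∈ l, ∀ y ∈ l, dist x y ≤ |t x - t y|
  | [] => ⟨fun _ => 0, by simp, by simp, by simp⟩
  | [x] => ⟨fun _ => 0, by simp, by simp [plen], by simp⟩
  | x :: y :: l => by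
    classical
    obtain ⟨t, h1, h2, h3⟩ := plen_param (y :: l)
    have hy : t y = 0 := h1 y (by simp)
    refine ⟨fun z => if z = x then 0 else t z + dist x y, by simp, ?_, ?_⟩
    · intro z hz
      have h0 := plen_nonneg (y :: l)
      simp only [plen]
      split_ifs with hzx
      · exact ⟨le_refl _, by positivity⟩
      · have := h2 z (by simpa [hzx] using hz)
        exact ⟨add_nonneg this.1 dist_nonneg, by linarith⟩
    · have key : ∀ z ∈ y :: l, dist x z ≤ |t z + dist x y| := by
        intro z hz
        have a1 := h3 y (by simp) z hz
        have a2 := h2 z hz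
        rw [hy, zero_sub, abs_neg, abs_of_nonneg a2.1] at a1
        rw [abs_of_nonneg (add_nonneg a2.1 dist_nonneg)]
        linarith [dist_triangle x y z]
      intro z hz w hw
      by_cases hzx : z = x
      · by_cases hwx : w = x
        · simp [hzx, hwx]
        · simp only [hzx, hwx, if_true, if_false, zero_sub, abs_neg]
          exact key w (by simpa [hwx] using hw)
      · by_cases hwx : w = x
        · simp only [hzx, hwx, if_true, if_false, sub_zero]
          rw [dist_comm]
          exact key z (by simpa [hzx] using hz)
        · simp only [hzx, hwx, if_false, add_sub_add_right_eq_sub]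
          exact h3 z (by simpa [hzx] using hz) w (by simpa [hwx] using hw)

end

noncomputable section

lemma param_compact (E : Set ℂ) (L : ℝ) (hL : 0 ≤ L)
    (h : ∀ F : Finset ℂ, ↑F ⊆ E → ∃ t : ℂ → ℝ, (∀ x ∈ F, 0 ≤ t x ∧ t x ≤ L) ∧
      ∀ x ∈ F, ∀ y ∈ F, dist x y ≤ |t x - t y|) :
    ∃ t : ℂ → ℝ, (∀ x, 0 ≤ t x ∧ t x ≤ L) ∧ ∀ x ∈ E, ∀ y ∈ E, dist x y ≤ |t x - t y| := by
  classical
  have hc : IsCompact (Set.pi univ (fun _ : ℂ => Icc (0:ℝ) L)) := isCompact_univ_pi fun _ => isCompact_Icc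
  have := hc.inter_iInter_nonempty (ι := E × E)
    (fun p => {t : ℂ → ℝ | dist (p.1 : ℂ) p.2 ≤ |t p.1 - t p.2|}) ?_ ?_
  · obtain ⟨t, h1, h2⟩ := this
    refine ⟨t, fun x => h1 x (mem_univ _), fun x hx y hy => ?_⟩
    exact mem_iInter.1 h2 (⟨x, hx⟩, ⟨y, hy⟩)
  · intro p
    exact isClosed_le continuous_const (by fun_prop)
  · intro u
    obtain ⟨t, h1, h2⟩ := h (u.image (fun p => (p.1 : ℂ)) ∪ u.image (fun p => (p.2 : ℂ))) (by
      intro x hx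
      simp only [Finset.coe_union, Finset.coe_image, Set.mem_union, Set.mem_image] at hx
      rcases hx with ⟨p, -, rfl⟩ | ⟨p, -, rfl⟩
      · exact p.1.2
      · exact p.2.2)
    set F := (u.image (fun p => (p.1 : ℂ)) ∪ u.image (fun p => (p.2 : ℂ)))
    refine ⟨fun x => if x ∈ F then t x else 0, ?_, ?_⟩
    · intro x _
      simp only
      split_ifs with hx
      · exact h1 x hx
      · exact ⟨le_refl _, hL⟩
    · rw [mem_iInter₂]
      intro p hp
      have hp1 : (p.1 : ℂ) ∈ F := Finset.mem_union_left _ (Finset.mem_image_of_mem _ hp)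
      have hp2 : (p.2 : ℂ) ∈ F := Finset.mem_union_right _ (Finset.mem_image_of_mem (fun p => (p.2 : ℂ)) hp)
      simp only [mem_setOf_eq, hp1, hp2, if_true]
      exact h2 _ hp1 _ hp2

lemma curve_of_param (E : Set ℂ) (L : ℝ) (hL : 0 ≤ L) (t : ℂ → ℝ)
    (h1 : ∀ x, 0 ≤ t x ∧ t x ≤ L) (h2 : ∀ x ∈ E, ∀ y ∈ E, dist x y ≤ |t x - t y|) :
    shortestLength E ≤ ENNReal.ofReal (2 * L) := by
  have hinj : InjOn t E := by
    intro x hx y hy hxy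
    have := h2 x hx y hy
    rw [hxy, sub_self, abs_zero] at this
    exact dist_le_zero.1 this
  set g := Function.invFunOn t E
  have hg : ∀ x ∈ E, g (t x) = x := fun x hx => hinj.leftInvOn_invFunOn hx
  have hl : ∀ s ∈ t '' E, ∀ s' ∈ t '' E, dist (g s) (g s') ≤ dist s s' := by
    rintro _ ⟨x, hx, rfl⟩ _ ⟨y, hy, rfl⟩
    rw [hg x hx, hg y hy, Real.dist_eq]; exact h2 x hx y hy
  have hre : LipschitzOnWith 1 (fun s => (g s).re) (t '' E) :=
    LipschitzOnWith.of_dist_le_mul fun s hs s' hs' => by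
      rw [NNReal.coe_one, one_mul, Real.dist_eq]
      exact (abs_re_le_dist _ _).trans (hl s hs s' hs')
  have him : LipschitzOnWith 1 (fun s => (g s).im) (t '' E) :=
    LipschitzOnWith.of_dist_le_mul fun s hs s' hs' => by
      rw [NNReal.coe_one, one_mul, Real.dist_eq]
      exact (abs_im_le_dist _ _).trans (hl s hs s' hs')
  obtain ⟨a, ha, hae⟩ := hre.extend_real
  obtain ⟨b, hb, hbe⟩ := him.extend_real
  have hG : LipschitzWith 2 (fun s => (⟨a s, b s⟩ : ℂ)) :=
    LipschitzWith.of_dist_le_mul fun s s' => by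
      refine (dist_le_re_im _ _).trans ?_
      have e1 := ha.dist_le_mul s s'
      have e2 := hb.dist_le_mul s s'
      rw [Real.dist_eq] at e1 e2
      simp only [NNReal.coe_one, one_mul] at e1 e2
      push_cast
      linarith
  have hcond : IsCompact ((fun s => (⟨a s, b s⟩ : ℂ)) '' Icc 0 L) ∧
      IsConnected ((fun s => (⟨a s, b s⟩ : ℂ)) '' Icc 0 L) ∧
      E ⊆ ((fun s => (⟨a s, b s⟩ : ℂ)) '' Icc 0 L) := by
    refine ⟨?_, ?_, ?_⟩
    · exact isCompact_Icc.image hG.continuous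
    · exact (isConnected_Icc hL).image _ hG.continuous.continuousOn
    · intro x hx
      refine ⟨t x, h1 x, ?_⟩
      have e1 := hae (mem_image_of_mem t hx)
      have e2 := hbe (mem_image_of_mem t hx)
      simp only [hg x hx] at e1 e2
      apply Complex.ext
      · exact e1.symm
      · exact e2.symm
  refine (iInf₂_le ((fun s => (⟨a s, b s⟩ : ℂ)) '' Icc 0 L) hcond).trans ?_
  · refine ((hG.lipschitzOnWith (s := Icc 0 L)).hausdorffMeasure_image_le zero_le_one).trans ?_
    rw [hausdorffMeasure_real, Real.volume_Icc, ENNReal.rpow_one, sub_zero, ENNReal.ofReal_mul (by norm_num)]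
    simp

lemma curve_of_graphs (E : Set ℂ) (L : ℝ) (hL : 0 ≤ L)
    (h : ∀ F : Finset ℂ, ↑F ⊆ E → F.Nonempty → ∃ S : Finset (ℂ × ℂ), Conn F S ∧
      (∀ e ∈ S, e.1 ∈ F ∧ e.2 ∈ F) ∧ ∑ e ∈ S, dist e.1 e.2 ≤ L) :
    shortestLength E ≤ ENNReal.ofReal (4 * L) := by
  obtain ⟨t, h1, h2⟩ := param_compact E (2 * L) (by positivity) (by
    intro F hF
    rcases F.eq_empty_or_nonempty with rfl | hne
    · exact ⟨fun _ => 0, by simp, by simp⟩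
    obtain ⟨S, hS, hSF, hs⟩ := h F hF hne
    obtain ⟨l, l1, l2, -, -⟩ := conn_tour hS hSF hne
    obtain ⟨t, -, t1, t2⟩ := plen_param l
    refine ⟨t, fun x hx => ?_, fun x hx y hy => t2 x ((l1 x).2 hx) y ((l1 y).2 hy)⟩
    have := t1 x ((l1 x).2 hx)
    exact ⟨this.1, by linarith⟩)
  have := curve_of_param E (2 * L) (by positivity) t h1 h2
  convert this using 2
  ring

end

noncomputable section

lemma packing {T : Finset ℂ} {x : ℂ} {r : ℝ} (hr : 0 < r) (m : ℕ)
    (h1 : ∀ z ∈ T, dist z x ≤ m * (r / 2)) (h2 : ∀ z ∈ T, ∀ w ∈ T, z ≠ w → r ≤ dist z w) :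
    T.card ≤ (2 * m + 1) ^ 2 := by
  classical
  have key : ∀ u : ℝ, |u| ≤ m * (r / 2) → ⌊u / (r / 2)⌋ ∈ Finset.Icc (-(m : ℤ)) m := by
    intro u hu
    have := abs_le.1 hu
    rw [Finset.mem_Icc]
    constructor
    · rw [Int.le_floor, le_div_iff₀ (by positivity)]; push_cast; linarith
    · rw [← Int.lt_add_one_iff, Int.floor_lt, div_lt_iff₀ (by positivity)]; push_cast; nlinarith
  have hc := Finset.card_le_card_of_injOn (s := T)
    (t := Finset.Icc (-(m : ℤ)) m ×ˢ Finset.Icc (-(m : ℤ)) m)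
    (fun z => (⌊(z.re - x.re) / (r / 2)⌋, ⌊(z.im - x.im) / (r / 2)⌋)) ?_ ?_
  · rw [Finset.card_product, Int.card_Icc] at hc
    have : ((m : ℤ) + 1 - -(m : ℤ)).toNat = 2 * m + 1 := by omega
    rw [this] at hc
    nlinarith
  · intro z hz
    have hz' := h1 z hz
    exact Finset.mem_product.2 ⟨key _ ((abs_re_le_dist _ _).trans hz'),
      key _ ((abs_im_le_dist _ _).trans hz')⟩
  · intro z hz w hw hzw
    by_contra hne
    have h3 := h2 z hz w hw hne
    simp only [Prod.mk.injEq] at hzw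
    have aux : ∀ u u' : ℝ, ⌊u / (r / 2)⌋ = ⌊u' / (r / 2)⌋ → |u - u'| ≤ r / 2 := by
      intro u u' huu
      have := Int.abs_sub_lt_one_of_floor_eq_floor huu
      rw [← sub_div, abs_div, abs_of_pos (show 0 < r / 2 by positivity),
        div_lt_one (by positivity)] at this
      exact this.le
    have e1 := aux _ _ hzw.1
    have e2 := aux _ _ hzw.2
    rw [sub_sub_sub_cancel_right] at e1 e2
    linarith [dist_lt_of_re_im hr e1 e2]

def ca (e v z : ℂ) : ℝ := ((z - v) * (starRingEnd ℂ) e).re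
def cb (e v z : ℂ) : ℝ := ((z - v) * (starRingEnd ℂ) e).im

lemma ca_self (e v : ℂ) : ca e v v = 0 := by simp [ca]
lemma cb_self (e v : ℂ) : cb e v v = 0 := by simp [cb]
lemma ca_neg (e v z : ℂ) : ca (-e) v z = - ca e v z := by simp [ca]
lemma cb_neg (e v z : ℂ) : cb (-e) v z = - cb e v z := by simp [cb]

lemma dist_sq_coord {e : ℂ} (he : ‖e‖ = 1) (v z w : ℂ) :
    dist z w ^ 2 = (ca e v z - ca e v w) ^ 2 + (cb e v z - cb e v w) ^ 2 := by
  have h1 : dist z w = ‖(z - w) * (starRingEnd ℂ) e‖ := by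
    rw [norm_mul, RCLike.norm_conj, he, mul_one, dist_eq_norm]
  rw [h1, ← Complex.normSq_eq_norm_sq, Complex.normSq_apply]
  have h2 : (z - w) * (starRingEnd ℂ) e = (z - v) * (starRingEnd ℂ) e - (w - v) * (starRingEnd ℂ) e := by
    ring
  rw [h2, Complex.sub_re, Complex.sub_im]
  simp only [ca, cb]; ring

lemma dist_sq_coord' {e : ℂ} (he : ‖e‖ = 1) (v z : ℂ) :
    dist z v ^ 2 = (ca e v z) ^ 2 + (cb e v z) ^ 2 := by
  rw [dist_sq_coord he v z v, ca_self, cb_self]; ring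

lemma ca_le_dist {e : ℂ} (he : ‖e‖ = 1) (v z w : ℂ) : ca e v z - ca e v w ≤ dist z w := by
  have := dist_sq_coord he v z w
  refine (le_abs_self _).trans (abs_le_of_sq_le_sq ?_ dist_nonneg)
  rw [this]
  exact le_add_of_nonneg_right (sq_nonneg _)

lemma dist_le_coord {e : ℂ} (he : ‖e‖ = 1) (v z w : ℂ) {A B : ℝ} (hA : 0 < A)
    (ha : ca e v z - ca e v w = A) (hb : |cb e v z - cb e v w| ≤ B) :
    dist z w ≤ A + B ^ 2 / (2 * A) := by
  have := dist_sq_coord he v z w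
  rw [ha] at this
  have hB : 0 ≤ B := (abs_nonneg _).trans hb
  have h1 : (cb e v z - cb e v w) ^ 2 ≤ B ^ 2 := sq_le_sq' (abs_le.1 hb).1 (abs_le.1 hb).2
  refine (le_abs_self _).trans (abs_le_of_sq_le_sq ?_ (by positivity))
  have : (A + B ^ 2 / (2 * A)) ^ 2 = A ^ 2 + B ^ 2 + (B ^ 2 / (2 * A)) ^ 2 := by
    field_simp; ring
  rw [this]
  nlinarith [sq_nonneg (B ^ 2 / (2 * A))]

lemma ins_lemma {e v s y : ℂ} {η ρ : ℝ} (he : ‖e‖ = 1) (hη : η < 1 / 10) (hρ : 0 < ρ)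
    (hs : |cb e v s| ≤ η * ρ) (hy : |cb e v y| ≤ η * ρ) (hsv : 2 / 3 * ρ ≤ dist s v)
    (hsv2 : dist s v < ρ) (hyv : 2 / 3 * ρ ≤ dist y v) (hys : 2 / 3 * ρ ≤ dist y s)
    (has : 0 < ca e v s) (hay : -(1 / 100) * ρ ≤ ca e v y) :
    dist v s + dist s y ≤ dist v y + 5 * η ^ 2 * ρ := by
  have h1 := dist_sq_coord' he v s
  have h2 := dist_sq_coord' he v y
  have h3 := dist_sq_coord he v y s
  have hη0 : 0 ≤ η := by
    refine le_of_mul_le_mul_right ?_ hρ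
    rw [zero_mul]; exact (abs_nonneg _).trans hs
  have f1 : dist v s ≤ ca e v s + (η * ρ) ^ 2 / (2 * ca e v s) := by
    rw [dist_comm]
    exact dist_le_coord he v s v has (by rw [ca_self, sub_zero]) (by rw [cb_self, sub_zero]; exact hs)
  have f2 : 0 < ca e v y - ca e v s → dist s y ≤ (ca e v y - ca e v s) +
      (2 * η * ρ) ^ 2 / (2 * (ca e v y - ca e v s)) := by
    intro h
    rw [dist_comm]
    refine dist_le_coord he v y s h rfl ?_
    have hs' := abs_le.1 hs
    have hy' := abs_le.1 hy
    exact abs_le.2 ⟨by linarith, by linarith⟩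
  have f3 : ca e v y ≤ dist v y := by
    have := ca_le_dist he v y v
    rw [ca_self, sub_zero, dist_comm] at this; exact this
  generalize ca e v s = a at *
  generalize cb e v s = b at *
  generalize ca e v y = c at *
  generalize cb e v y = d at *
  have hs' := abs_le.1 hs
  have hy' := abs_le.1 hy
  have hηρ : η * ρ ≤ 1 / 10 * ρ := mul_le_mul_of_nonneg_right hη.le hρ.le
  have hb2 : b ^ 2 ≤ (1 / 10 * ρ) ^ 2 := sq_le_sq' (by linarith) (by linarith)
  have hd2 : d ^ 2 ≤ (1 / 10 * ρ) ^ 2 := sq_le_sq' (by linarith) (by linarith)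
  have hbd : (d - b) ^ 2 ≤ (2 / 10 * ρ) ^ 2 := sq_le_sq' (by linarith) (by linarith)
  have hρ3 : 0 ≤ 2 / 3 * ρ := by positivity
  have e1 : (2 / 3 * ρ) ^ 2 ≤ dist s v ^ 2 := pow_le_pow_left₀ hρ3 hsv 2
  have e2 : (2 / 3 * ρ) ^ 2 ≤ dist y v ^ 2 := pow_le_pow_left₀ hρ3 hyv 2
  have e3 : (2 / 3 * ρ) ^ 2 ≤ dist y s ^ 2 := pow_le_pow_left₀ hρ3 hys 2
  have e4 : dist s v ^ 2 ≤ ρ ^ 2 := pow_le_pow_left₀ dist_nonneg hsv2.le 2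
  have hρ2 : 0 < ρ ^ 2 := by positivity
  rw [mul_pow] at hb2 hd2 hbd e1 e2 e3
  have a1 : 65 / 100 * ρ ≤ a := by
    by_contra hc; push Not at hc
    have := sq_le_sq' (show -(65 / 100 * ρ) ≤ a by linarith) hc.le
    linarith [mul_pow (65 / 100) ρ 2]
  have a2 : a ≤ ρ := (le_abs_self a).trans (abs_le_of_sq_le_sq (by linarith [sq_nonneg b]) hρ.le)
  have c1 : 65 / 100 * ρ ≤ c := by
    by_contra hc; push Not at hc
    have := sq_le_sq' (show -(65 / 100 * ρ) ≤ c by linarith) hc.le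
    linarith [mul_pow (65 / 100) ρ 2]
  have ac : 6 / 10 * ρ ≤ c - a := by
    by_contra hc; push Not at hc
    have := sq_le_sq' (show -(6 / 10 * ρ) ≤ c - a by linarith) hc.le
    linarith [mul_pow (6 / 10) ρ 2]
  replace f2 := f2 (by linarith)
  have g1 : (η * ρ) ^ 2 / (2 * a) ≤ η ^ 2 * ρ := by
    rw [div_le_iff₀ (by linarith)]
    have : 0 ≤ η ^ 2 * ρ := by positivity
    linarith [mul_le_mul_of_nonneg_left a1 this, mul_nonneg this hρ.le, show (η * ρ) ^ 2 = η ^ 2 * ρ * ρ by ring]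
  have g2 : (2 * η * ρ) ^ 2 / (2 * (c - a)) ≤ 4 * η ^ 2 * ρ := by
    rw [div_le_iff₀ (by linarith)]
    have : 0 ≤ η ^ 2 * ρ := by positivity
    linarith [mul_le_mul_of_nonneg_left ac this, mul_nonneg this hρ.le, show (2 * η * ρ) ^ 2 = 4 * (η ^ 2 * ρ * ρ) by ring]
  linarith

end

noncomputable section

lemma good_ca {e v z : ℂ} {η ρ : ℝ} (he : ‖e‖ = 1) (hη : η < 1 / 10) (hρ : 0 < ρ)
    (hz : |cb e v z| ≤ η * ρ) {κ c : ℝ} (hκ : 0 ≤ κ) (hc : 0 ≤ c) (h : κ * ρ ≤ dist z v)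
    (hcκ : c ^ 2 + 1 / 100 ≤ κ ^ 2) : c * ρ ≤ |ca e v z| := by
  have h1 := dist_sq_coord' he v z
  have hηρ : η * ρ ≤ 1 / 10 * ρ := mul_le_mul_of_nonneg_right hη.le hρ.le
  have hb2 : cb e v z ^ 2 ≤ (1 / 10 * ρ) ^ 2 :=
    sq_le_sq' (by linarith [(abs_le.1 hz).1]) (by linarith [(abs_le.1 hz).2])
  have e1 : (κ * ρ) ^ 2 ≤ dist z v ^ 2 := pow_le_pow_left₀ (by positivity) h 2
  have e2 : (c ^ 2 + 1 / 100) * ρ ^ 2 ≤ κ ^ 2 * ρ ^ 2 := mul_le_mul_of_nonneg_right hcκ (sq_nonneg _)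
  have : c * ρ = |c * ρ| := (abs_of_nonneg (by positivity)).symm
  rw [this, ← sq_le_sq]
  rw [mul_pow] at *
  linarith

/-- the set-up at a fixed scale -/
structure Flat (V V' : Finset ℂ) (ρ : ℝ) (e : ℂ → ℂ) (η : ℂ → ℝ) : Prop where
  hρ : 0 < ρ
  sub : V ⊆ V'
  sepV : ∀ x ∈ V, ∀ y ∈ V, x ≠ y → ρ ≤ dist x y
  sepV' : ∀ x ∈ V', ∀ y ∈ V', x ≠ y → 2 / 3 * ρ ≤ dist x y
  he : ∀ v ∈ V, ‖e v‖ = 1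
  hη : ∀ v ∈ V, 0 ≤ η v
  flat : ∀ v ∈ V, ∀ z ∈ V', dist z v ≤ 14 * ρ → |cb (e v) v z| ≤ η v * ρ

lemma sign_wlog {e v s v' : ℂ} (he : ‖e‖ = 1) (h : 0 < ca e v s * ca e v v') :
    ∃ e' : ℂ, ‖e'‖ = 1 ∧ 0 < ca e' v s ∧ 0 < ca e' v v' ∧ ∀ z, |cb e' v z| = |cb e v z| := by
  rcases pos_and_pos_or_neg_and_neg_of_mul_pos h with h | h
  · exact ⟨e, he, h.1, h.2, fun _ => rfl⟩
  · exact ⟨-e, by rwa [norm_neg], by rw [ca_neg]; linarith, by rw [ca_neg]; linarith,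
      fun z => by rw [cb_neg, abs_neg]⟩

/-- `s` can be inserted after `v` on the way to `v'` -/
def InsAt (V' : Finset ℂ) (ρ : ℝ) (e : ℂ → ℂ) (η : ℂ → ℝ) (v v' s : ℂ) : Prop :=
  s ∈ V' ∧ s ≠ v ∧ s ≠ v' ∧ dist s v < ρ ∧ η v < 1 / 10 ∧ 0 < ca (e v) v s * ca (e v) v v'

lemma Flat.one_ins {V V' : Finset ℂ} {ρ : ℝ} {e : ℂ → ℂ} {η : ℂ → ℝ} (H : Flat V V' ρ e η)
    {v v' s y : ℂ} (hv : v ∈ V) (hv' : v' ∈ V) (hne : v ≠ v') (hd : dist v v' ≤ 12 * ρ)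
    (hs : InsAt V' ρ e η v v' s) (hy : y ∈ V') (hyv : y ≠ v) (hys : y ≠ s) (hyv' : dist y v' < ρ) :
    dist v s + dist s y ≤ dist v y + 5 * η v ^ 2 * ρ := by
  obtain ⟨s1, s2, s3, s4, s5, s6⟩ := hs
  obtain ⟨e', he', p1, p2, p3⟩ := sign_wlog (H.he v hv) s6
  have hρ := H.hρ
  have hv2 : v ∈ V' := H.sub hv
  have hv2' : v' ∈ V' := H.sub hv'
  have fv' := H.flat v hv v' hv2' (by rw [dist_comm]; linarith)
  have fs := H.flat v hv s s1 (by linarith)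
  have fy := H.flat v hv y hy (by linarith [dist_triangle y v' v, dist_comm v v'])
  rw [← p3] at fv' fs fy
  refine ins_lemma he' s5 hρ fs fy (H.sepV' s s1 v hv2 s2) s4 (H.sepV' y hy v hv2 hyv)
    (H.sepV' y hy s s1 hys) p1 ?_
  have h1 := good_ca he' s5 hρ fv' (κ := 1) (c := 99 / 100) (by norm_num) (by norm_num)
    (by rw [one_mul]; exact H.sepV v' hv' v hv hne.symm) (by norm_num)
  rw [abs_of_pos p2] at h1
  have h2 := ca_le_dist he' v v' y
  rw [dist_comm] at h2
  linarith

lemma Flat.edge_ins {V V' : Finset ℂ} {ρ : ℝ} {e : ℂ → ℂ} {η : ℂ → ℝ} (H : Flat V V' ρ e η)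
    {v v' s s' : ℂ} (hv : v ∈ V) (hv' : v' ∈ V) (hne : v ≠ v') (hd : dist v v' ≤ 12 * ρ)
    (hs : s = v ∨ InsAt V' ρ e η v v' s) (hs' : s' = v' ∨ InsAt V' ρ e η v' v s') (hss : s ≠ s') :
    dist v s + dist s s' + dist s' v' ≤ dist v v' + 5 * (η v ^ 2 + η v' ^ 2) * ρ := by
  have hρ := H.hρ
  have q1 : 0 ≤ 5 * η v ^ 2 * ρ := by positivity
  have q2 : 0 ≤ 5 * η v' ^ 2 * ρ := by positivity
  rcases hs with rfl | hs
  · rcases hs' with rfl | hs'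
    · simp only [dist_self]; linarith
    · have := H.one_ins hv' hv hne.symm (by rwa [dist_comm]) hs' (H.sub hv) hne hss
        (by rw [dist_self]; exact hρ)
      rw [dist_self, dist_comm s s', dist_comm s' v', dist_comm s v']
      linarith
  · rcases hs' with rfl | hs'
    · have := H.one_ins hv hv' hne hd hs (H.sub hv') hne.symm hss.symm (by rw [dist_self]; exact hρ)
      rw [dist_self]; linarith
    · have a1 := H.one_ins hv' hv hne.symm (by rwa [dist_comm]) hs' (H.sub hv) hne hs'.2.2.1.symm
        (by rw [dist_self]; exact hρ)
      have a2 := H.one_ins hv hv' hne hd hs hs'.1 hs'.2.2.1 hss.symm hs'.2.2.2.1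
      rw [dist_comm s' v, dist_comm v' v, dist_comm v' s'] at a1
      linarith

/-- two points on the same side of a good vertex: if both close, they coincide -/
lemma Flat.same_side {V V' : Finset ℂ} {ρ : ℝ} {e : ℂ → ℂ} {η : ℂ → ℝ} (H : Flat V V' ρ e η)
    {v w w' : ℂ} (hv : v ∈ V) (hη : η v < 1 / 10) (hw : w ∈ V') (hw' : w' ∈ V') (hwv : w ≠ v)
    (hwv' : w' ≠ v) (hd : dist w v < ρ) (hd' : dist w' v < ρ)
    (h : 0 < ca (e v) v w * ca (e v) v w') : w = w' := by
  by_contra hne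
  obtain ⟨e', he', p1, p2, p3⟩ := sign_wlog (H.he v hv) h
  have hρ := H.hρ
  have hv2 : v ∈ V' := H.sub hv
  have fw := H.flat v hv w hw (by linarith)
  have fw' := H.flat v hv w' hw' (by linarith)
  rw [← p3] at fw fw'
  have h1 := good_ca he' hη hρ fw (κ := 2 / 3) (c := 65 / 100) (by norm_num) (by norm_num)
    (H.sepV' w hw v hv2 hwv) (by norm_num)
  have h2 := good_ca he' hη hρ fw' (κ := 2 / 3) (c := 65 / 100) (by norm_num) (by norm_num)
    (H.sepV' w' hw' v hv2 hwv') (by norm_num)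
  rw [abs_of_pos p1] at h1
  rw [abs_of_pos p2] at h2
  have h3 := ca_le_dist he' v w v
  have h4 := ca_le_dist he' v w' v
  rw [ca_self, sub_zero] at h3 h4
  have h5 := dist_sq_coord he' v w w'
  have hηρ : η v * ρ ≤ 1 / 10 * ρ := mul_le_mul_of_nonneg_right hη.le hρ.le
  have h6 : (ca e' v w - ca e' v w') ^ 2 ≤ (35 / 100 * ρ) ^ 2 := sq_le_sq' (by linarith) (by linarith)
  have h7 : (cb e' v w - cb e' v w') ^ 2 ≤ (2 / 10 * ρ) ^ 2 := by
    have := abs_le.1 fw; have := abs_le.1 fw'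
    exact sq_le_sq' (by linarith) (by linarith)
  have h8 : (2 / 3 * ρ) ^ 2 ≤ dist w w' ^ 2 :=
    pow_le_pow_left₀ (by positivity) (H.sepV' w hw w' hw' hne) 2
  have : 0 < ρ ^ 2 := by positivity
  rw [mul_pow] at h6 h7 h8
  linarith

lemma Flat.nbr_closer {V V' : Finset ℂ} {ρ : ℝ} {e : ℂ → ℂ} {η : ℂ → ℝ} (H : Flat V V' ρ e η)
    {v w w' : ℂ} (hv : v ∈ V) (hη : η v < 1 / 10) (hw : w ∈ V) (hw' : w' ∈ V) (hwv : w ≠ v)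
    (hwv' : w' ≠ v) (hd : dist w v ≤ 12 * ρ) (hd' : dist w' v ≤ 12 * ρ)
    (h : 0 < ca (e v) v w * ca (e v) v w') : dist w w' < dist v w ∨ dist w w' < dist v w' := by
  obtain ⟨e', he', p1, p2, p3⟩ := sign_wlog (H.he v hv) h
  have hρ := H.hρ
  have fw := H.flat v hv w (H.sub hw) (by linarith)
  have fw' := H.flat v hv w' (H.sub hw') (by linarith)
  rw [← p3] at fw fw'
  have h1 := good_ca he' hη hρ fw (κ := 1) (c := 99 / 100) (by norm_num) (by norm_num)
    (by rw [one_mul]; exact H.sepV w hw v hv hwv) (by norm_num)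
  have h2 := good_ca he' hη hρ fw' (κ := 1) (c := 99 / 100) (by norm_num) (by norm_num)
    (by rw [one_mul]; exact H.sepV w' hw' v hv hwv') (by norm_num)
  rw [abs_of_pos p1] at h1
  rw [abs_of_pos p2] at h2
  have h5 := dist_sq_coord he' v w w'
  have h3 := dist_sq_coord' he' v w
  have h4 := dist_sq_coord' he' v w'
  rw [dist_comm] at h3 h4
  have hηρ : η v * ρ ≤ 1 / 10 * ρ := mul_le_mul_of_nonneg_right hη.le hρ.le
  have h7 : (cb e' v w - cb e' v w') ^ 2 ≤ (2 / 10 * ρ) ^ 2 := by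
    have := abs_le.1 fw; have := abs_le.1 fw'
    exact sq_le_sq' (by linarith) (by linarith)
  generalize ca e' v w = a at *
  generalize ca e' v w' = b at *
  have hab : (99 / 100 * ρ) * (99 / 100 * ρ) ≤ a * b := mul_le_mul h1 h2 (by positivity) (by linarith)
  have hr2 : 0 < ρ ^ 2 := by positivity
  rcases le_total a b with hle | hle
  · right
    refine lt_of_pow_lt_pow_left₀ 2 dist_nonneg ?_
    have : 0 ≤ a * (b - a) := mul_nonneg (by linarith) (by linarith)
    have := sq_nonneg (cb e' v w')
    rw [h5, h4]; nlinarith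
  · left
    refine lt_of_pow_lt_pow_left₀ 2 dist_nonneg ?_
    have : 0 ≤ b * (a - b) := mul_nonneg (by linarith) (by linarith)
    have := sq_nonneg (cb e' v w)
    rw [h5, h3]; nlinarith

end

noncomputable section

lemma sum_union_le' {α : Type*} [DecidableEq α] (s t : Finset α) {f : α → ℝ} (hf : ∀ x, 0 ≤ f x) :
    ∑ x ∈ s ∪ t, f x ≤ ∑ x ∈ s, f x + ∑ x ∈ t, f x := by
  rw [← Finset.sum_union_inter]
  linarith [Finset.sum_nonneg (s := s ∩ t) fun x _ => hf x]

/-- edge weight -/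
def uu (r l : ℝ) : ℝ := min l ((l + r) / 2)

lemma uu_lt {r l l' : ℝ} (h : l < l') : uu r l < uu r l' := by
  unfold uu; apply min_lt_min h; linarith
lemma uu_le_self (r l : ℝ) : uu r l ≤ l := min_le_left _ _
lemma uu_zero {r : ℝ} (hr : 0 ≤ r) : uu r 0 = 0 := by
  unfold uu; apply min_eq_left; linarith
lemma uu_nonneg {r l : ℝ} (hr : 0 ≤ r) (hl : 0 ≤ l) : 0 ≤ uu r l := by
  unfold uu; apply le_min hl; linarith
lemma uu_short {r l : ℝ} (h : l ≤ r) : uu r l = l := by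
  unfold uu; apply min_eq_left; linarith
lemma uu_long {r l : ℝ} (h : r ≤ l) : uu r l = (l + r) / 2 := by
  unfold uu; apply min_eq_right; linarith
lemma uu_half {r l : ℝ} (hr : 0 ≤ r) (hl : 0 ≤ l) : l ≤ 2 * uu r l := by
  unfold uu; rcases min_cases l ((l + r) / 2) with h | h <;> rw [h.1] <;> linarith

/-- total weight of a graph -/
def wt (r : ℝ) (S : Finset (ℂ × ℂ)) : ℝ := ∑ e ∈ S, uu r (dist e.1 e.2)

/-- graph on a vertex set without loops -/
def OnV (V : Finset ℂ) (S : Finset (ℂ × ℂ)) : Prop := ∀ e ∈ S, e.1 ∈ V ∧ e.2 ∈ V ∧ e.1 ≠ e.2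

/-- minimal connected graph -/
structure MinG (V : Finset ℂ) (S : Finset (ℂ × ℂ)) (r : ℝ) : Prop where
  mem : OnV V S
  conn : Conn V S
  min : ∀ S2, OnV V S2 → Conn V S2 → wt r S ≤ wt r S2

def adj (S : Finset (ℂ × ℂ)) (a b : ℂ) : Prop := (a, b) ∈ S ∨ (b, a) ∈ S

lemma adj_edge {S : Finset (ℂ × ℂ)} {a b : ℂ} (h : adj S a b) :
    ∃ E ∈ S, dist E.1 E.2 = dist a b ∧ (E = (a, b) ∨ E = (b, a)) := by
  rcases h with h | h
  · exact ⟨_, h, rfl, Or.inl rfl⟩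
  · exact ⟨_, h, dist_comm _ _, Or.inr rfl⟩

lemma adj_iff {S : Finset (ℂ × ℂ)} {f : ℂ → Prop} (hf : ∀ e ∈ S, f e.1 ↔ f e.2) {a b : ℂ}
    (h : adj S a b) : f a ↔ f b := by
  rcases h with h | h
  · exact hf _ h
  · exact (hf _ h).symm

lemma MinG.adj_mem {V : Finset ℂ} {S : Finset (ℂ × ℂ)} {r : ℝ} (M : MinG V S r) {a b : ℂ}
    (h : adj S a b) : a ∈ V ∧ b ∈ V ∧ a ≠ b := by
  rcases h with h | h
  · exact M.mem _ h
  · have := M.mem _ h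
    exact ⟨this.2.1, this.1, this.2.2.symm⟩

lemma MinG.no_double {V : Finset ℂ} {S : Finset (ℂ × ℂ)} {r : ℝ} (M : MinG V S r) (hr : 0 ≤ r)
    {a b : ℂ} (h : (a, b) ∈ S) : (b, a) ∉ S := by
  classical
  intro h2
  have hne := (M.mem _ h).2.2
  have h3 := M.min (S.erase (b, a)) (fun e he => M.mem e (Finset.mem_of_mem_erase he)) (by
    intro f hf
    apply M.conn f
    intro e he
    by_cases hee : e = (b, a)
    · rw [hee]
      have := hf (a, b) (Finset.mem_erase.2 ⟨by simp [hne], h⟩)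
      exact this.symm
    · exact hf e (Finset.mem_erase.2 ⟨hee, he⟩))
  unfold wt at h3
  rw [← Finset.add_sum_erase S _ h2] at h3
  have : 0 < uu r (dist b a) := by
    rw [← uu_zero hr]; exact uu_lt (dist_pos.2 hne.symm)
  simp only at h3
  linarith

lemma MinG.no_tri {V : Finset ℂ} {S : Finset (ℂ × ℂ)} {r : ℝ} (M : MinG V S r) (hr : 0 ≤ r)
    {v a b : ℂ} (ha : adj S v a) (hb : adj S v b) (hab : a ≠ b) (hd : dist a b < dist v b) : False := by
  classical
  obtain ⟨E, hE, hEd, hE2⟩ := adj_edge hb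
  have hm := M.adj_mem ha
  have hm2 := M.adj_mem hb
  have h3 := M.min (insert (a, b) (S.erase E)) (by
    intro e he
    rcases Finset.mem_insert.1 he with rfl | he
    · exact ⟨hm.2.1, hm2.2.1, hab⟩
    · exact M.mem e (Finset.mem_of_mem_erase he)) (by
    intro f hf
    apply M.conn f
    have f1 : f a ↔ f b := hf _ (Finset.mem_insert_self _ _)
    have f0 : ∀ e ∈ S, e ≠ E → (f e.1 ↔ f e.2) := fun e he hne =>
      hf e (Finset.mem_insert_of_mem (Finset.mem_erase.2 ⟨hne, he⟩))
    have f2 : f v ↔ f a := by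
      rcases ha with ha | ha
      · refine f0 _ ha ?_
        rintro rfl
        rcases hE2 with hE2 | hE2
        · exact hab (Prod.ext_iff.1 hE2).2
        · exact hm.2.2 (Prod.ext_iff.1 hE2).2.symm
      · refine (f0 _ ha ?_).symm
        rintro rfl
        rcases hE2 with hE2 | hE2
        · exact hm.2.2 (Prod.ext_iff.1 hE2).1.symm
        · exact hab (Prod.ext_iff.1 hE2).1
    intro e he
    by_cases hee : e = E
    · rw [hee]
      rcases hE2 with hE2 | hE2
      · rw [hE2]; exact f2.trans f1
      · rw [hE2]; exact (f2.trans f1).symm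
    · exact f0 e he hee)
  unfold wt at h3
  rw [← Finset.add_sum_erase S _ hE] at h3
  have h4 : ∑ e ∈ insert (a, b) (S.erase E), uu r (dist e.1 e.2) ≤
      uu r (dist a b) + ∑ e ∈ S.erase E, uu r (dist e.1 e.2) := by
    by_cases hin : (a, b) ∈ S.erase E
    · rw [Finset.insert_eq_of_mem hin]
      linarith [uu_nonneg hr (dist_nonneg (x := a) (y := b))]
    · rw [Finset.sum_insert hin]
  have := uu_lt (r := r) hd
  rw [hEd] at h3
  linarith

end

noncomputable section
open Classical

lemma Flat.ca_ne {V V' : Finset ℂ} {ρ : ℝ} {e : ℂ → ℂ} {η : ℂ → ℝ} (H : Flat V V' ρ e η)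
    {v z : ℂ} (hv : v ∈ V) (hη : η v < 1 / 10) (hz : z ∈ V') (hzv : z ≠ v) (hd : dist z v ≤ 14 * ρ) :
    ca (e v) v z ≠ 0 := by
  have hρ := H.hρ
  have h1 := good_ca (H.he v hv) hη H.hρ (H.flat v hv z hz hd) (κ := 2 / 3) (c := 65 / 100)
    (by norm_num) (by norm_num) (H.sepV' z hz v (H.sub hv) hzv) (by norm_num)
  have : 0 < |ca (e v) v z| := by linarith
  exact abs_pos.1 this

lemma same_sign {a b : ℝ} (ha : a ≠ 0) (hb : b ≠ 0) (h : decide (0 < a) = decide (0 < b)) :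
    0 < a * b := by
  rcases lt_or_gt_of_ne ha with h1 | h1
  · rcases lt_or_gt_of_ne hb with h2 | h2
    · exact mul_pos_of_neg_of_neg h1 h2
    · simp [h2, h1.le] at h; linarith
  · have : 0 < b := by simpa [h1] using h
    positivity

lemma Flat.pack {V V' : Finset ℂ} {ρ : ℝ} {e : ℂ → ℂ} {η : ℂ → ℝ} (H : Flat V V' ρ e η)
    {v : ℂ} (T : Finset ℂ) (hT : ∀ z ∈ T, z ∈ V' ∧ dist z v ≤ 12 * ρ) : T.card ≤ 5329 := by
  have hρ := H.hρ
  have := packing (T := T) (x := v) (r := 2 / 3 * ρ) (by positivity) 36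
    (fun z hz => by have := (hT z hz).2; norm_num; linarith)
    (fun z hz w hw hne => H.sepV' z (hT z hz).1 w (hT w hw).1 hne)
  norm_num at this; exact this

lemma Flat.count_ends {V V' : Finset ℂ} {ρ : ℝ} {e : ℂ → ℂ} {η : ℂ → ℝ} (H : Flat V V' ρ e η)
    {S : Finset (ℂ × ℂ)} (M : MinG V S (12 * ρ)) (W : Finset ℂ) (hW : ∀ w ∈ W, w ∈ V' ∧ w ∉ V)
    (π : ℂ → ℂ) (hπ : ∀ w ∈ W, π w ∈ V ∧ dist w (π w) < ρ) :
    (W.filter (fun w => η (π w) < 1 / 10 ∧ ¬ ∃ v', adj S (π w) v' ∧ dist (π w) v' ≤ 12 * ρ ∧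
      0 < ca (e (π w)) (π w) w * ca (e (π w)) (π w) v')).card ≤
    2 + 2 * (S.filter (fun E => ¬ dist E.1 E.2 ≤ 12 * ρ)).card +
      5329 * (V.filter (fun v => ¬ η v < 1 / 10)).card := by
  have hρ := H.hρ
  set Wend := W.filter (fun w => η (π w) < 1 / 10 ∧ ¬ ∃ v', adj S (π w) v' ∧ dist (π w) v' ≤ 12 * ρ ∧
      0 < ca (e (π w)) (π w) w * ca (e (π w)) (π w) v') with hWend
  set A := (V ×ˢ V).filter (fun p => adj S p.1 p.2 ∧ dist p.1 p.2 ≤ 12 * ρ) with hA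
  set Sh := S.filter (fun E => dist E.1 E.2 ≤ 12 * ρ) with hSh
  set G := V.filter (fun v => η v < 1 / 10) with hG
  have hwne : ∀ w ∈ W, w ≠ π w := fun w hw h => (hW w hw).2 (h ▸ (hπ w hw).1)
  -- A is large
  have h1 : 2 * Sh.card ≤ A.card := by
    have hdisj : Disjoint Sh (Sh.image Prod.swap) := by
      rw [Finset.disjoint_left]
      rintro ⟨a, b⟩ hab hab'
      obtain ⟨⟨c, d⟩, hcd, hcd2⟩ := Finset.mem_image.1 hab'
      simp only [Prod.swap_prod_mk, Prod.mk.injEq] at hcd2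
      obtain ⟨rfl, rfl⟩ := hcd2
      exact M.no_double (by positivity) (Finset.mem_filter.1 hab).1 (Finset.mem_filter.1 hcd).1
    have hsub : Sh ∪ Sh.image Prod.swap ⊆ A := by
      rintro ⟨a, b⟩ hab
      have : adj S a b ∧ dist a b ≤ 12 * ρ := by
        rcases Finset.mem_union.1 hab with hab | hab
        · have := Finset.mem_filter.1 hab
          exact ⟨Or.inl this.1, this.2⟩
        · obtain ⟨⟨c, d⟩, hcd, hcd2⟩ := Finset.mem_image.1 hab
          simp only [Prod.swap_prod_mk, Prod.mk.injEq] at hcd2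
          obtain ⟨rfl, rfl⟩ := hcd2
          have := Finset.mem_filter.1 hcd
          exact ⟨Or.inr this.1, by rw [dist_comm]; exact this.2⟩
      have hm := M.adj_mem this.1
      exact Finset.mem_filter.2 ⟨Finset.mem_product.2 ⟨hm.1, hm.2.1⟩, this⟩
    have := Finset.card_le_card hsub
    rw [Finset.card_union_of_disjoint hdisj, Finset.card_image_of_injective _ Prod.swap_injective] at this
    omega
  -- oriented edges from bad vertices
  have h2 : (A.filter (fun p => ¬ η p.1 < 1 / 10)).card ≤
      5329 * (V.filter (fun v => ¬ η v < 1 / 10)).card := by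
    apply Finset.card_le_mul_card_image_of_maps_to (f := Prod.fst)
    · intro p hp
      simp only [hA, Finset.mem_filter, Finset.mem_product] at hp ⊢
      exact ⟨hp.1.1.1, hp.2⟩
    · intro b hb
      rw [← Finset.card_image_of_injOn (f := Prod.snd)]
      · apply H.pack (v := b)
        intro z hz
        obtain ⟨p, hp, rfl⟩ := Finset.mem_image.1 hz
        simp only [hA, Finset.mem_filter, Finset.mem_product] at hp
        refine ⟨H.sub hp.1.1.1.2, ?_⟩
        rw [← hp.2, dist_comm]; exact hp.1.1.2.2
      · intro p hp q hq hpq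
        simp only [Finset.coe_filter, mem_setOf_eq] at hp hq
        exact Prod.ext (hp.2.trans hq.2.symm) hpq
  have h3 := Finset.card_filter_add_card_filter_not (s := A) (fun p => η p.1 < 1 / 10)
  have h4 : Sh.card + (S.filter (fun E => ¬ dist E.1 E.2 ≤ 12 * ρ)).card = S.card :=
    Finset.card_filter_add_card_filter_not _
  have h5 := conn_card M.conn (fun e he => ⟨(M.mem e he).1, (M.mem e he).2.1⟩)
  -- the injection
  have h6 : Wend.card + (A.filter (fun p => η p.1 < 1 / 10)).card ≤ 2 * G.card := by
    have i1 : InjOn (fun w => (π w, decide (0 < ca (e (π w)) (π w) w))) (Wend : Set ℂ) := by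
      intro w hw w' hw' heq
      have hw := Finset.mem_filter.1 (Finset.mem_coe.1 hw)
      have hw' := Finset.mem_filter.1 (Finset.mem_coe.1 hw')
      simp only [Prod.mk.injEq] at heq
      obtain ⟨p1, p2⟩ := heq
      rw [← p1] at p2
      have hv := hπ w hw.1
      have hv' := hπ w' hw'.1
      have hn := hwne w hw.1
      have hn' := hwne w' hw'.1
      rw [← p1] at hv' hn'
      refine H.same_side hv.1 hw.2.1 (hW w hw.1).1 (hW w' hw'.1).1 hn hn' hv.2 hv'.2 ?_
      exact same_sign (H.ca_ne hv.1 hw.2.1 (hW w hw.1).1 hn (by linarith))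
        (H.ca_ne hv.1 hw.2.1 (hW w' hw'.1).1 hn' (by linarith)) p2
    have i2 : InjOn (fun p : ℂ × ℂ => (p.1, decide (0 < ca (e p.1) p.1 p.2)))
        (A.filter (fun p => η p.1 < 1 / 10) : Set (ℂ × ℂ)) := by
      rintro ⟨v, a⟩ hp ⟨v2, b⟩ hq heq
      simp only [hA, Finset.coe_filter, Finset.mem_filter, mem_setOf_eq, Finset.mem_product] at hp hq
      simp only [Prod.mk.injEq] at heq
      obtain ⟨rfl, p2⟩ := heq
      have ma := M.adj_mem hp.1.2.1
      have mb := M.adj_mem hq.1.2.1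
      have da : dist a v ≤ 12 * ρ := by rw [dist_comm]; exact hp.1.2.2
      have db : dist b v ≤ 12 * ρ := by rw [dist_comm]; exact hq.1.2.2
      have hs := same_sign (H.ca_ne ma.1 hp.2 (H.sub ma.2.1) ma.2.2.symm (by linarith))
        (H.ca_ne ma.1 hp.2 (H.sub mb.2.1) mb.2.2.symm (by linarith)) p2
      by_contra hne
      have hab : a ≠ b := fun h => hne (by rw [h])
      rcases H.nbr_closer ma.1 hp.2 ma.2.1 mb.2.1 ma.2.2.symm mb.2.2.symm da db hs with h | h
      · rw [dist_comm] at h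
        exact M.no_tri (by positivity) hq.1.2.1 hp.1.2.1 hab.symm h
      · exact M.no_tri (by positivity) hp.1.2.1 hq.1.2.1 hab h
    rw [← Finset.card_image_of_injOn i1, ← Finset.card_image_of_injOn i2, ← Finset.card_union_of_disjoint]
    · have : (2 : ℕ) * G.card = (G ×ˢ (Finset.univ : Finset Bool)).card := by
        rw [Finset.card_product]; simp [mul_comm]
      rw [this]
      apply Finset.card_le_card
      intro x hx
      rw [Finset.mem_product]
      refine ⟨?_, Finset.mem_univ _⟩
      rcases Finset.mem_union.1 hx with hx | hx
      · obtain ⟨w, hw, rfl⟩ := Finset.mem_image.1 hx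
        have hw := Finset.mem_filter.1 hw
        exact Finset.mem_filter.2 ⟨(hπ w hw.1).1, hw.2.1⟩
      · obtain ⟨p, hp, rfl⟩ := Finset.mem_image.1 hx
        simp only [hA, Finset.mem_filter, Finset.mem_product] at hp
        exact Finset.mem_filter.2 ⟨hp.1.1.1, hp.2⟩
    · rw [Finset.disjoint_left]
      intro x hx hx'
      obtain ⟨w, hw, rfl⟩ := Finset.mem_image.1 hx
      obtain ⟨⟨v, a⟩, hp, heq⟩ := Finset.mem_image.1 hx'
      have hw := Finset.mem_filter.1 hw
      simp only [hA, Finset.mem_filter, Finset.mem_product] at hp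
      simp only [Prod.mk.injEq] at heq
      obtain ⟨p1, p2⟩ := heq
      rw [p1] at p2 hp
      have ma := M.adj_mem hp.1.2.1
      apply hw.2.2
      refine ⟨a, hp.1.2.1, hp.1.2.2, ?_⟩
      have da : dist a (π w) ≤ 12 * ρ := by rw [dist_comm]; exact hp.1.2.2
      refine same_sign (H.ca_ne ma.1 hp.2 (hW w hw.1).1 (hwne w hw.1) (by linarith [(hπ w hw.1).2]))
        (H.ca_ne ma.1 hp.2 (H.sub ma.2.1) ma.2.2.symm (by linarith)) p2.symm
  have h7 : G.card ≤ V.card := Finset.card_filter_le _ _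
  omega

end

noncomputable section
open Classical

lemma Flat.sum_short {V V' : Finset ℂ} {ρ : ℝ} {e : ℂ → ℂ} {η : ℂ → ℝ} (H : Flat V V' ρ e η)
    (T : Finset (ℂ × ℂ)) (hT : ∀ p ∈ T, p.1 ∈ V ∧ p.2 ∈ V ∧ dist p.1 p.2 ≤ 12 * ρ)
    (h : ℂ → ℝ) (hh : ∀ x, 0 ≤ h x) : ∑ p ∈ T, h p.1 ≤ 5329 * ∑ v ∈ V, h v := by
  rw [← Finset.sum_fiberwise_of_maps_to' (t := V) (g := Prod.fst) (fun p hp => (hT p hp).1), Finset.mul_sum]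
  refine Finset.sum_le_sum fun v _ => ?_
  rw [Finset.sum_const, nsmul_eq_mul]
  refine mul_le_mul_of_nonneg_right ?_ (hh v)
  have : (T.filter (fun p => p.1 = v)).card ≤ 5329 := by
    rw [← Finset.card_image_of_injOn (f := Prod.snd)]
    · apply H.pack (v := v)
      intro z hz
      obtain ⟨p, hp, rfl⟩ := Finset.mem_image.1 hz
      have hp := Finset.mem_filter.1 hp
      refine ⟨H.sub (hT p hp.1).2.1, ?_⟩
      rw [← hp.2, dist_comm]; exact (hT p hp.1).2.2
    · intro p hp q hq hpq
      simp only [Finset.coe_filter, mem_setOf_eq] at hp hq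
      exact Prod.ext (hp.2.trans hq.2.symm) hpq
  exact_mod_cast this

lemma Flat.step {V V' : Finset ℂ} {ρ : ℝ} {e : ℂ → ℂ} {η : ℂ → ℝ} (H : Flat V V' ρ e η)
    {S : Finset (ℂ × ℂ)} (M : MinG V S (12 * ρ)) (net : ∀ w ∈ V', ∃ v ∈ V, dist w v < ρ) :
    ∃ S', OnV V' S' ∧ Conn V' S' ∧
      wt (8 * ρ) S' ≤ wt (12 * ρ) S + 2 * ρ + 1119090 * (∑ v ∈ V, η v ^ 2) * ρ := by
  have hρ := H.hρ
  have net' : ∀ w, ∃ v, w ∈ V' → v ∈ V ∧ dist w v < ρ := by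
    intro w
    by_cases hw : w ∈ V'
    · obtain ⟨v, h1, h2⟩ := net w hw
      exact ⟨v, fun _ => ⟨h1, h2⟩⟩
    · exact ⟨0, fun h => absurd h hw⟩
  choose π hπ using net'
  set W := V' \ V with hWdef
  have hW : ∀ w ∈ W, w ∈ V' ∧ w ∉ V := fun w hw => Finset.mem_sdiff.1 hw
  have hπW : ∀ w ∈ W, π w ∈ V ∧ dist w (π w) < ρ := fun w hw => hπ w (hW w hw).1
  have hwne : ∀ w ∈ W, w ≠ π w := fun w hw h => (hW w hw).2 (h ▸ (hπW w hw).1)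
  set P : ℂ → ℂ → ℂ → Prop := fun v v' w => dist v v' ≤ 12 * ρ ∧ η v < 1 / 10 ∧ w ∈ W ∧ π w = v ∧
    0 < ca (e v) v w * ca (e v) v v' with hP
  set ins : ℂ → ℂ → ℂ := fun v v' => if h : ∃ w, P v v' w then h.choose else v with hins
  have ins1 : ∀ v v', ins v v' = v ∨ P v v' (ins v v') := by
    intro v v'
    simp only [hins]
    split_ifs with h
    · exact Or.inr h.choose_spec
    · exact Or.inl rfl
  have ins2 : ∀ v v' w, P v v' w → ins v v' = w := by
    intro v v' w hw
    have h : ∃ w, P v v' w := ⟨w, hw⟩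
    have hi : P v v' (ins v v') := by
      simp only [hins, dif_pos h]; exact h.choose_spec
    generalize ins v v' = w' at hi
    obtain ⟨-, a1, a2, a3, a4⟩ := hw
    obtain ⟨-, b1, b2, b3, b4⟩ := hi
    have ha := hπW w a2
    have hb := hπW w' b2
    have na := hwne w a2
    have nb := hwne w' b2
    rw [a3] at ha na
    rw [b3] at hb nb
    refine H.same_side ha.1 a1 (hW w' b2).1 (hW w a2).1 nb na hb.2 ha.2 ?_
    have := mul_pos a4 b4
    have h2 : 0 < (ca (e v) v w' * ca (e v) v w) * (ca (e v) v v') ^ 2 := by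
      calc _ < _ := this
        _ = _ := by ring
    exact pos_of_mul_pos_left h2 (sq_nonneg _)
  set Wend := W.filter (fun w => η (π w) < 1 / 10 ∧ ¬ ∃ v', adj S (π w) v' ∧ dist (π w) v' ≤ 12 * ρ ∧
      0 < ca (e (π w)) (π w) w * ca (e (π w)) (π w) v') with hWend
  set Wbad := W.filter (fun w => ¬ η (π w) < 1 / 10) with hWbad
  set B := V.filter (fun v => ¬ η v < 1 / 10) with hB
  set Lg := S.filter (fun E => ¬ dist E.1 E.2 ≤ 12 * ρ) with hLg
  set Sh := S.filter (fun E => dist E.1 E.2 ≤ 12 * ρ) with hSh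
  have cEnd : Wend.card ≤ 2 + 2 * Lg.card + 5329 * B.card := H.count_ends M W hW π hπW
  have cBad : Wbad.card ≤ 5329 * B.card := by
    apply Finset.card_le_mul_card_image_of_maps_to (f := π)
    · intro w hw
      have hw := Finset.mem_filter.1 hw
      exact Finset.mem_filter.2 ⟨(hπW w hw.1).1, hw.2⟩
    · intro b hb
      apply H.pack (v := b)
      intro z hz
      have hz := Finset.mem_filter.1 hz
      have hz1 := Finset.mem_filter.1 hz.1
      refine ⟨(hW z hz1.1).1, ?_⟩
      rw [← hz.2]; linarith [(hπW z hz1.1).2]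
  -- new graph
  set T := ((S.image (fun E => (E.1, ins E.1 E.2)) ∪ S.image (fun E => (ins E.1 E.2, ins E.2 E.1))) ∪
    S.image (fun E => (ins E.2 E.1, E.2))) ∪ (Wend ∪ Wbad).image (fun w => (w, π w)) with hT
  have insV : ∀ v v', v ∈ V → ins v v' ∈ V' := by
    intro v v' hv
    rcases ins1 v v' with h | h
    · rw [h]; exact H.sub hv
    · exact (hW _ h.2.2.1).1
  have uun : ∀ p : ℂ × ℂ, 0 ≤ uu (8 * ρ) (dist p.1 p.2) := fun p => uu_nonneg (by positivity) dist_nonneg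
  refine ⟨T.filter (fun p => p.1 ≠ p.2), ?_, ?_, ?_⟩
  · intro p hp
    have hp := Finset.mem_filter.1 hp
    suffices p.1 ∈ V' ∧ p.2 ∈ V' from ⟨this.1, this.2, hp.2⟩
    simp only [hT, Finset.mem_union, Finset.mem_image] at hp
    rcases hp.1 with ((⟨E, hE, rfl⟩ | ⟨E, hE, rfl⟩) | ⟨E, hE, rfl⟩) | ⟨w, hw, rfl⟩
    · exact ⟨H.sub (M.mem E hE).1, insV _ _ (M.mem E hE).1⟩
    · exact ⟨insV _ _ (M.mem E hE).1, insV _ _ (M.mem E hE).2.1⟩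
    · exact ⟨insV _ _ (M.mem E hE).2.1, H.sub (M.mem E hE).2.1⟩
    · have hw : w ∈ W := by
        rcases hw with hw | hw
        · exact (Finset.mem_filter.1 hw).1
        · exact (Finset.mem_filter.1 hw).1
      exact ⟨(hW w hw).1, H.sub (hπW w hw).1⟩
  · intro f hf
    have hf : ∀ p ∈ T, f p.1 ↔ f p.2 := by
      intro p hp
      by_cases hpp : p.1 = p.2
      · rw [hpp]
      · exact hf p (Finset.mem_filter.2 ⟨hp, hpp⟩)
    have t1 : ∀ E ∈ S, (f E.1 ↔ f (ins E.1 E.2)) := fun E hE => hf (E.1, ins E.1 E.2)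
      (Finset.mem_union_left _ (Finset.mem_union_left _ (Finset.mem_union_left _
        (Finset.mem_image_of_mem (fun E : ℂ × ℂ => (E.1, ins E.1 E.2)) hE))))
    have t2 : ∀ E ∈ S, (f (ins E.1 E.2) ↔ f (ins E.2 E.1)) := fun E hE => hf (ins E.1 E.2, ins E.2 E.1)
      (Finset.mem_union_left _ (Finset.mem_union_left _ (Finset.mem_union_right _
        (Finset.mem_image_of_mem (fun E : ℂ × ℂ => (ins E.1 E.2, ins E.2 E.1)) hE))))
    have t3 : ∀ E ∈ S, (f (ins E.2 E.1) ↔ f E.2) := fun E hE => hf (ins E.2 E.1, E.2)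
      (Finset.mem_union_left _ (Finset.mem_union_right _
        (Finset.mem_image_of_mem (fun E : ℂ × ℂ => (ins E.2 E.1, E.2)) hE)))
    have t4 : ∀ w ∈ Wend ∪ Wbad, (f w ↔ f (π w)) := fun w hw => hf (w, π w)
      (Finset.mem_union_right _ (Finset.mem_image_of_mem (fun w => (w, π w)) hw))
    have hV := M.conn f (fun E hE => (t1 E hE).trans ((t2 E hE).trans (t3 E hE)))
    have hall : ∀ x ∈ V', ∃ v ∈ V, (f x ↔ f v) := by
      intro x hx
      by_cases hxV : x ∈ V
      · exact ⟨x, hxV, Iff.rfl⟩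
      have hxW : x ∈ W := Finset.mem_sdiff.2 ⟨hx, hxV⟩
      refine ⟨π x, (hπ x hx).1, ?_⟩
      by_cases hg : η (π x) < 1 / 10
      · by_cases hex : ∃ v', adj S (π x) v' ∧ dist (π x) v' ≤ 12 * ρ ∧
          0 < ca (e (π x)) (π x) x * ca (e (π x)) (π x) v'
        · obtain ⟨v', h1, h2, h3⟩ := hex
          have hi : ins (π x) v' = x := ins2 _ _ _ ⟨h2, hg, hxW, rfl, h3⟩
          rcases h1 with h1 | h1
          · have := t1 _ h1
            simp only [hi] at this
            exact this.symm
          · have := t3 _ h1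
            simp only [hi] at this
            exact this
        · exact t4 x (Finset.mem_union_left _ (Finset.mem_filter.2 ⟨hxW, hg, hex⟩))
      · exact t4 x (Finset.mem_union_right _ (Finset.mem_filter.2 ⟨hxW, hg⟩))
    intro x hx y hy
    obtain ⟨a, ha, hxa⟩ := hall x hx
    obtain ⟨b, hb, hyb⟩ := hall y hy
    exact hxa.trans ((hV a ha b hb).trans hyb.symm)
  · have w1 : wt (8 * ρ) (T.filter (fun p => p.1 ≠ p.2)) ≤ wt (8 * ρ) T :=
      Finset.sum_le_sum_of_subset_of_nonneg (Finset.filter_subset _ _) fun p _ _ => uun p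
    have img : ∀ g : ℂ × ℂ → ℂ × ℂ, ∑ p ∈ S.image g, uu (8 * ρ) (dist p.1 p.2) ≤
        ∑ E ∈ S, uu (8 * ρ) (dist (g E).1 (g E).2) := fun g =>
      Finset.sum_image_le_of_nonneg (f := fun p : ℂ × ℂ => uu (8 * ρ) (dist p.1 p.2)) fun p _ => uun p
    have w2 : wt (8 * ρ) T ≤ ((∑ E ∈ S, uu (8 * ρ) (dist E.1 (ins E.1 E.2)) +
        ∑ E ∈ S, uu (8 * ρ) (dist (ins E.1 E.2) (ins E.2 E.1))) +
        ∑ E ∈ S, uu (8 * ρ) (dist (ins E.2 E.1) E.2)) +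
        ∑ w ∈ Wend ∪ Wbad, uu (8 * ρ) (dist w (π w)) := by
      unfold wt
      refine (sum_union_le' _ _ uun).trans (add_le_add ?_ ?_)
      · refine (sum_union_le' _ _ uun).trans (add_le_add ?_ ?_)
        · refine (sum_union_le' _ _ uun).trans (add_le_add ?_ ?_)
          · exact img (fun E => (E.1, ins E.1 E.2))
          · exact img (fun E => (ins E.1 E.2, ins E.2 E.1))
        · exact img (fun E => (ins E.2 E.1, E.2))
      · exact Finset.sum_image_le_of_nonneg (f := fun p : ℂ × ℂ => uu (8 * ρ) (dist p.1 p.2)) fun p _ => uun p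
    have w3 : ∑ w ∈ Wend ∪ Wbad, uu (8 * ρ) (dist w (π w)) ≤ ((Wend.card : ℝ) + Wbad.card) * ρ := by
      have : ∑ w ∈ Wend ∪ Wbad, uu (8 * ρ) (dist w (π w)) ≤ ∑ w ∈ Wend ∪ Wbad, ρ := by
        refine Finset.sum_le_sum fun w hw => ?_
        have hw : w ∈ W := by
          rcases Finset.mem_union.1 hw with hw | hw
          · exact (Finset.mem_filter.1 hw).1
          · exact (Finset.mem_filter.1 hw).1
        exact (uu_le_self _ _).trans (hπW w hw).2.le
      refine this.trans ?_
      rw [Finset.sum_const, nsmul_eq_mul]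
      refine mul_le_mul_of_nonneg_right ?_ hρ.le
      exact_mod_cast Finset.card_union_le _ _
    have w4 : ((∑ E ∈ S, uu (8 * ρ) (dist E.1 (ins E.1 E.2)) +
        ∑ E ∈ S, uu (8 * ρ) (dist (ins E.1 E.2) (ins E.2 E.1))) +
        ∑ E ∈ S, uu (8 * ρ) (dist (ins E.2 E.1) E.2)) ≤ wt (12 * ρ) S +
        ∑ E ∈ S, (if dist E.1 E.2 ≤ 12 * ρ then 5 * (η E.1 ^ 2 + η E.2 ^ 2) * ρ else -(2 * ρ)) := by
      unfold wt
      rw [← Finset.sum_add_distrib, ← Finset.sum_add_distrib, ← Finset.sum_add_distrib]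
      refine Finset.sum_le_sum fun E hE => ?_
      obtain ⟨m1, m2, m3⟩ := M.mem E hE
      split_ifs with hd
      · rw [uu_short hd]
        have hins : ∀ v v', v ∈ V → v' ∈ V → ins v v' = v ∨ InsAt V' ρ e η v v' (ins v v') := by
          intro v v' hv hv'
          rcases ins1 v v' with h | h
          · exact Or.inl h
          · right
            obtain ⟨-, a1, a2, a3, a4⟩ := h
            refine ⟨(hW _ a2).1, fun h => (hW _ a2).2 (by rw [h]; exact hv),
              fun h => (hW _ a2).2 (by rw [h]; exact hv'), ?_, a1, a4⟩
            have := (hπW _ a2).2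
            rwa [a3] at this
        have hss : ins E.1 E.2 ≠ ins E.2 E.1 := by
          rcases ins1 E.1 E.2 with h | h
          · rcases ins1 E.2 E.1 with h' | h'
            · rw [h, h']; exact m3
            · intro hh; rw [← hh, h] at h'
              exact (hW _ h'.2.2.1).2 m1
          · rcases ins1 E.2 E.1 with h' | h'
            · intro hh; rw [hh, h'] at h
              exact (hW _ h.2.2.1).2 m2
            · intro hh; rw [← hh] at h'
              exact m3 (h.2.2.2.1.symm.trans h'.2.2.2.1)
        have := H.edge_ins m1 m2 m3 hd (hins _ _ m1 m2) (hins _ _ m2 m1) hss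
        linarith [uu_le_self (8 * ρ) (dist E.1 (ins E.1 E.2)),
          uu_le_self (8 * ρ) (dist (ins E.1 E.2) (ins E.2 E.1)),
          uu_le_self (8 * ρ) (dist (ins E.2 E.1) E.2)]
      · have a1 : ins E.1 E.2 = E.1 := (ins1 E.1 E.2).resolve_right fun h => hd h.1
        have a2 : ins E.2 E.1 = E.2 := (ins1 E.2 E.1).resolve_right fun h => hd (by
          rw [dist_comm]; exact h.1)
        rw [a1, a2, dist_self, dist_self, uu_zero (by positivity), uu_long (not_le.1 hd).le,
          uu_long (by linarith [not_le.1 hd])]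
        linarith
    have w5 : ∑ E ∈ S, (if dist E.1 E.2 ≤ 12 * ρ then 5 * (η E.1 ^ 2 + η E.2 ^ 2) * ρ else -(2 * ρ)) ≤
        53290 * (∑ v ∈ V, η v ^ 2) * ρ - 2 * ρ * Lg.card := by
      rw [Finset.sum_ite, Finset.sum_const, nsmul_eq_mul]
      have s1 := H.sum_short Sh (fun p hp => by
        have hp := Finset.mem_filter.1 hp
        exact ⟨(M.mem p hp.1).1, (M.mem p hp.1).2.1, hp.2⟩) (fun v => η v ^ 2) (fun v => sq_nonneg _)
      have s2 := H.sum_short (Sh.image Prod.swap) (fun p hp => by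
        obtain ⟨q, hq, rfl⟩ := Finset.mem_image.1 hp
        have hq := Finset.mem_filter.1 hq
        exact ⟨(M.mem q hq.1).2.1, (M.mem q hq.1).1, by rw [dist_comm]; exact hq.2⟩)
        (fun v => η v ^ 2) (fun v => sq_nonneg _)
      rw [Finset.sum_image Prod.swap_injective.injOn] at s2
      have s3 : ∑ E ∈ Sh, 5 * (η E.1 ^ 2 + η E.2 ^ 2) * ρ =
          5 * ρ * (∑ E ∈ Sh, η E.1 ^ 2 + ∑ E ∈ Sh, η E.2 ^ 2) := by
        rw [← Finset.sum_add_distrib, Finset.mul_sum]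
        exact Finset.sum_congr rfl fun E _ => by ring
      have s4 := mul_le_mul_of_nonneg_left (add_le_add s1 s2) (show 0 ≤ 5 * ρ by positivity)
      simp only [Prod.fst_swap] at s4
      have s5 : ∑ E ∈ S with dist E.1 E.2 ≤ 12 * ρ, 5 * (η E.1 ^ 2 + η E.2 ^ 2) * ρ =
          ∑ E ∈ Sh, 5 * (η E.1 ^ 2 + η E.2 ^ 2) * ρ := rfl
      rw [s5, s3]
      have s6 : (S.filter (fun E => ¬ dist E.1 E.2 ≤ 12 * ρ)).card = Lg.card := rfl
      rw [s6]
      linarith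
    have w6 : (B.card : ℝ) ≤ 100 * ∑ v ∈ V, η v ^ 2 := by
      rw [Finset.card_eq_sum_ones, Nat.cast_sum, Finset.mul_sum]
      refine le_trans ?_ (Finset.sum_le_sum_of_subset_of_nonneg (Finset.filter_subset (fun v => ¬ η v < 1 / 10) V)
        fun v _ _ => by positivity)
      refine Finset.sum_le_sum fun v hv => ?_
      have := not_lt.1 (Finset.mem_filter.1 hv).2
      push_cast
      nlinarith
    have cEnd' : (Wend.card : ℝ) ≤ 2 + 2 * Lg.card + 5329 * B.card := by exact_mod_cast cEnd
    have cBad' : (Wbad.card : ℝ) ≤ 5329 * B.card := by exact_mod_cast cBad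
    have w7 : ((Wend.card : ℝ) + Wbad.card) * ρ ≤ (2 + 2 * Lg.card + 10658 * (100 * ∑ v ∈ V, η v ^ 2)) * ρ :=
      mul_le_mul_of_nonneg_right (by linarith) hρ.le
    linarith

end

noncomputable section
open Classical

def SepF (r : ℝ) (V : Finset ℂ) : Prop := ∀ x ∈ V, ∀ y ∈ V, x ≠ y → r ≤ dist x y

lemma net_extend (F V : Finset ℂ) (r : ℝ) (hr : 0 < r) (hV : V ⊆ F) (hs : SepF r V) :
    ∃ V', V ⊆ V' ∧ V' ⊆ F ∧ SepF r V' ∧ ∀ x ∈ F, ∃ v ∈ V', dist x v < r := by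
  have hne : (F.powerset.filter (fun U => V ⊆ U ∧ SepF r U)).Nonempty :=
    ⟨V, by simp [hV, hs]⟩
  obtain ⟨U, hU, hmax⟩ := Finset.exists_max_image _ Finset.card hne
  simp only [Finset.mem_filter, Finset.mem_powerset] at hU hmax
  refine ⟨U, hU.2.1, hU.1, hU.2.2, fun x hx => ?_⟩
  by_contra hcon
  push Not at hcon
  have hxU : x ∉ U := fun h => by have := hcon x h; rw [dist_self] at this; linarith
  have := hmax (insert x U) ⟨Finset.insert_subset hx hU.1, hU.2.1.trans (Finset.subset_insert _ _), by
    intro a ha b hb hab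
    rcases Finset.mem_insert.1 ha with rfl | ha2
    · rcases Finset.mem_insert.1 hb with rfl | hb2
      · exact absurd rfl hab
      · exact hcon b hb2
    · rcases Finset.mem_insert.1 hb with rfl | hb2
      · rw [dist_comm]; exact hcon a ha2
      · exact hU.2.2 a ha2 b hb2 hab⟩
  rw [Finset.card_insert_of_notMem hxU] at this
  omega

lemma exists_minG (V : Finset ℂ) (r : ℝ) : ∃ S, MinG V S r := by
  have hne : (V.offDiag.powerset.filter (fun S => Conn V S)).Nonempty := by
    refine ⟨V.offDiag, ?_⟩
    simp only [Finset.mem_filter, Finset.mem_powerset, subset_refl, true_and]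
    intro f hf x hx y hy
    by_cases hxy : x = y
    · rw [hxy]
    · exact hf (x, y) (Finset.mem_offDiag.2 ⟨hx, hy, hxy⟩)
  obtain ⟨S, hS, hmin⟩ := Finset.exists_min_image _ (wt r) hne
  simp only [Finset.mem_filter, Finset.mem_powerset] at hS hmin
  refine ⟨S, fun e he => Finset.mem_offDiag.1 (hS.1 he), hS.2, fun S2 h1 h2 => hmin S2 ⟨?_, h2⟩⟩
  exact fun e he => Finset.mem_offDiag.2 (h1 e he)

/-- dyadic square at a scale containing a point, with flatness -/
lemma flat_of_beta (F : Finset ℂ) (v : ℂ) (hv : v ∈ F) (ρ κ : ℝ) (hρ : 0 < ρ) (hκ : 0 < κ) :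
    ∃ (p : ℤ × ℤ × ℤ) (e : ℂ), ‖e‖ = 1 ∧ v ∈ dyadicSq p.1 p.2.1 p.2.2 ∧
      14 * ρ < (2:ℝ) ^ (-p.1) ∧ (2:ℝ) ^ (-p.1) ≤ 28 * ρ ∧
      ∀ z ∈ F, dist z v ≤ 14 * ρ →
        |cb e v z| ≤ (336 * betaNum F (dyadicSq3 p.1 p.2.1 p.2.2) + 2 * κ) * ρ := by
  obtain ⟨m, hm1, hm2⟩ := exists_mem_Ico_zpow (show 0 < 28 * ρ by positivity) (one_lt_two (α := ℝ))
  set l : ℝ := (2:ℝ) ^ m with hl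
  have hl0 : 0 < l := by positivity
  have hm3 : 14 * ρ < l := by rw [zpow_add_one₀ two_ne_zero] at hm2; linarith
  have hlk : (2:ℝ) ^ (-(-m)) = l := by rw [neg_neg]
  have fl : ∀ x : ℝ, (⌊x / l⌋ : ℝ) * l ≤ x ∧ x ≤ ((⌊x / l⌋ : ℝ) + 1) * l := by
    intro x
    constructor
    · rw [← le_div_iff₀ hl0]; exact Int.floor_le _
    · rw [← div_le_iff₀ hl0]; exact (Int.lt_floor_add_one _).le
  set Q3 := dyadicSq3 (-m) ⌊v.im / l⌋ ⌊v.re / l⌋ with hQ3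
  have hd3 := sq3_diam_ge (-m) ⌊v.im / l⌋ ⌊v.re / l⌋
  have hd6 := sq3_diam_le (-m) ⌊v.im / l⌋ ⌊v.re / l⌋
  rw [hlk, ← hQ3] at hd3 hd6
  have hmem : ∀ z, dist z v ≤ 14 * ρ → z ∈ Q3 := by
    intro z hz
    have h1 := abs_le.1 ((abs_re_le_dist z v).trans hz)
    have h2 := abs_le.1 ((abs_im_le_dist z v).trans hz)
    have h3 := fl v.re
    have h4 := fl v.im
    simp only [hQ3, dyadicSq3, hlk, mem_setOf_eq, mem_Icc]
    refine ⟨⟨?_, ?_⟩, ?_, ?_⟩ <;> linarith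
  obtain ⟨L, hL, hLd⟩ := beta_line (E := (F : Set ℂ)) (S := Q3) (d := betaNum F Q3 * diam Q3 + κ * ρ)
    (sq3_nonempty _ _ _) (sq3_bdd _ _ _) (by linarith) (by linarith [mul_pos hκ hρ])
  obtain ⟨a, e, he, rfl⟩ := line_unit hL
  refine ⟨(-m, ⌊v.im / l⌋, ⌊v.re / l⌋), e, he, ?_, by simpa only [hlk] using hm3, by simpa only [hlk] using hm1, ?_⟩
  · simp only [dyadicSq, hlk, mem_setOf_eq, mem_Icc]
    exact ⟨fl _, fl _⟩
  · intro z hz hzv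
    have h1 := hLd z ⟨hz, hmem z hzv⟩
    have h2 := hLd v ⟨hv, hmem v (by rw [dist_self]; positivity)⟩
    rw [infDist_line a e _ he] at h1 h2
    have h3 : cb e v z = ((z - a) * (starRingEnd ℂ) e).im - ((v - a) * (starRingEnd ℂ) e).im := by
      unfold cb; rw [← Complex.sub_im]; congr 1; ring
    have hb : betaNum F Q3 * diam Q3 ≤ betaNum F Q3 * (168 * ρ) :=
      mul_le_mul_of_nonneg_left (by linarith) (beta_nonneg _ _)
    rw [h3]
    refine (abs_sub _ _).trans ?_
    simp only
    linarith

end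

noncomputable section
open Classical

lemma nets_exist (F : Finset ℂ) (x0 : ℂ) (hx0 : x0 ∈ F) (ρ : ℕ → ℝ) (hρ : ∀ n, 0 < ρ n)
    (hanti : ∀ n, ρ (n + 1) ≤ ρ n) (h0 : ∀ x ∈ F, dist x x0 < ρ 0) :
    ∃ Vs : ℕ → Finset ℂ, Vs 0 = {x0} ∧ ∀ n, Vs n ⊆ Vs (n + 1) ∧ Vs n ⊆ F ∧ SepF (ρ n) (Vs n) ∧
      ∀ x ∈ F, ∃ v ∈ Vs n, dist x v < ρ n := by
  have hext : ∀ (r : ℝ) (V : Finset ℂ), ∃ V' : Finset ℂ, 0 < r → V ⊆ F → SepF r V →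
      V ⊆ V' ∧ V' ⊆ F ∧ SepF r V' ∧ ∀ x ∈ F, ∃ v ∈ V', dist x v < r := by
    intro r V
    by_cases h : 0 < r ∧ V ⊆ F ∧ SepF r V
    · obtain ⟨V', h'⟩ := net_extend F V r h.1 h.2.1 h.2.2
      exact ⟨V', fun _ _ _ => h'⟩
    · exact ⟨∅, fun a b c => absurd ⟨a, b, c⟩ h⟩
  choose ext hext using hext
  let Vs : ℕ → Finset ℂ := fun n => Nat.rec {x0} (fun n V => ext (ρ (n + 1)) V) n
  have key : ∀ n, Vs n ⊆ F ∧ SepF (ρ n) (Vs n) ∧ ∀ x ∈ F, ∃ v ∈ Vs n, dist x v < ρ n := by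
    intro n
    induction n with
    | zero =>
      refine ⟨by simpa [Vs] using hx0, ?_, fun x hx => ⟨x0, by simp [Vs], h0 x hx⟩⟩
      intro a ha b hb hab
      have ha : a = x0 := Finset.mem_singleton.1 ha
      have hb : b = x0 := Finset.mem_singleton.1 hb
      exact absurd (ha.trans hb.symm) hab
    | succ n ih =>
      have := hext (ρ (n + 1)) (Vs n) (hρ _) ih.1
        (fun a ha b hb hab => (hanti n).trans (ih.2.1 a ha b hb hab))
      exact this.2
  refine ⟨Vs, rfl, fun n => ⟨?_, key n⟩⟩
  exact (hext (ρ (n + 1)) (Vs n) (hρ _) (key n).1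
        (fun a ha b hb hab => (hanti n).trans ((key n).2.1 a ha b hb hab))).1

lemma fiber_card (D : ℝ) (hD : 0 < D) (ρ : ℕ → ℝ) (hρ : ∀ n, ρ n = 2 * D * (2 / 3) ^ n)
    (p : ℤ × ℤ × ℤ) (T : Finset (Σ _ : ℕ, ℂ))
    (h1 : ∀ x ∈ T, x.2 ∈ dyadicSq p.1 p.2.1 p.2.2 ∧ 14 * ρ x.1 < (2:ℝ) ^ (-p.1) ∧
      (2:ℝ) ^ (-p.1) ≤ 28 * ρ x.1)
    (h2 : ∀ x ∈ T, ∀ y ∈ T, x.1 = y.1 → x ≠ y → ρ x.1 ≤ dist x.2 y.2) :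
    T.card ≤ 101250 := by
  have hpos : ∀ n, 0 < ρ n := fun n => by rw [hρ]; positivity
  rcases T.eq_empty_or_nonempty with rfl | hne
  · simp
  obtain ⟨x0, hx0, hmin⟩ := Finset.exists_min_image T (fun x => x.1) hne
  have himg : T.image (fun x => x.1) ⊆ {x0.1, x0.1 + 1} := by
    intro n hn
    obtain ⟨x, hx, rfl⟩ := Finset.mem_image.1 hn
    have h3 := hmin x hx
    have a := (h1 x hx).2.2
    have b := (h1 x0 hx0).2.1
    have : x.1 < x0.1 + 2 := by
      by_contra hcon
      push Not at hcon
      have : ρ x.1 ≤ 4 / 9 * ρ x0.1 := by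
        rw [hρ, hρ]
        have : ((2:ℝ) / 3) ^ x.1 ≤ (2 / 3) ^ (x0.1 + 2) :=
          pow_le_pow_of_le_one (by norm_num) (by norm_num) hcon
        rw [pow_add] at this
        nlinarith
      linarith [hpos x0.1]
    simp only [Finset.mem_insert, Finset.mem_singleton]
    omega
  have hc := Finset.card_le_mul_card_image (f := fun x : (Σ _ : ℕ, ℂ) => x.1) T 50625 (by
    intro n hn
    obtain ⟨y, hy, hyn⟩ := Finset.mem_image.1 hn
    have hinj : Set.InjOn (fun x : (Σ _ : ℕ, ℂ) => x.2) (T.filter (fun x => x.1 = n) : Finset _) := by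
      rintro ⟨a, b⟩ hx ⟨a', b'⟩ hx' h
      simp only [Finset.coe_filter, mem_setOf_eq] at hx hx'
      obtain ⟨-, rfl⟩ := hx
      obtain ⟨-, rfl⟩ := hx'
      simp only at h
      rw [h]
    rw [← Finset.card_image_of_injOn hinj]
    refine (packing (x := y.2) (hpos n) 112 ?_ ?_).trans (by norm_num)
    · intro z hz
      simp only [Finset.mem_image, Finset.mem_filter] at hz
      obtain ⟨x, ⟨hx, rfl⟩, rfl⟩ := hz
      have := dist_le_diam_of_mem (sq_bdd _ _ _) (h1 x hx).1 (h1 y hy).1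
      have h4 := sq_diam_le p.1 p.2.1 p.2.2
      have h5 := (h1 x hx).2.2
      push_cast
      linarith
    · intro z hz w hw hzw
      simp only [Finset.mem_image, Finset.mem_filter] at hz hw
      obtain ⟨x, ⟨hx, rfl⟩, rfl⟩ := hz
      obtain ⟨x', ⟨hx', h'⟩, rfl⟩ := hw
      exact h2 x hx x' hx' h'.symm (fun h => hzw (by rw [h])))
  have := (Finset.card_le_card himg).trans Finset.card_le_two
  omega

lemma upper_graph (F : Finset ℂ) (hne : F.Nonempty) (D J : ℝ) (hD0 : 0 ≤ D)
    (hD : ∀ x ∈ F, ∀ y ∈ F, dist x y ≤ D)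
    (hJ : ∀ T : Finset (ℤ × ℤ × ℤ), ∑ p ∈ T, betaNum F (dyadicSq3 p.1 p.2.1 p.2.2) ^ 2 *
      diam (dyadicSq p.1 p.2.1 p.2.2) ≤ J) :
    ∃ S : Finset (ℂ × ℂ), Conn F S ∧ (∀ e ∈ S, e.1 ∈ F ∧ e.2 ∈ F) ∧
      ∑ e ∈ S, dist e.1 e.2 ≤ 6 * 10 ^ 16 * (D + J) := by
  have hJ0 : 0 ≤ J := by simpa using hJ ∅
  obtain ⟨x0, hx0⟩ := hne
  rcases hD0.eq_or_lt with rfl | hDp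
  · refine ⟨∅, ?_, by simp, by simpa using hJ0⟩
    intro f hf x hx y hy
    rw [dist_le_zero.1 (hD x hx y hy)]
  set ρ : ℕ → ℝ := fun n => 2 * D * (2 / 3) ^ n with hρ
  have hpos : ∀ n, 0 < ρ n := fun n => by simp only [hρ]; positivity
  have hsucc : ∀ n, ρ (n + 1) = 2 / 3 * ρ n := fun n => by simp only [hρ]; ring
  obtain ⟨Vs, hV0, hV⟩ := nets_exist F x0 hx0 ρ hpos (fun n => by rw [hsucc]; linarith [hpos n])
    (fun x hx => by simp only [hρ]; linarith [hD x hx x0 hx0])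
  -- large N
  obtain ⟨N, hN⟩ : ∃ N, Vs N = F := by
    have : ∃ m : ℝ, 0 < m ∧ ∀ x ∈ F, ∀ y ∈ F, x ≠ y → m ≤ dist x y := by
      rcases F.offDiag.eq_empty_or_nonempty with h | h
      · refine ⟨1, one_pos, fun x hx y hy hxy => ?_⟩
        have : (x, y) ∈ F.offDiag := Finset.mem_offDiag.2 ⟨hx, hy, hxy⟩
        rw [h] at this; simp at this
      · obtain ⟨e, he, hmin⟩ := Finset.exists_min_image _ (fun e : ℂ × ℂ => dist e.1 e.2) h
        refine ⟨dist e.1 e.2, dist_pos.2 (Finset.mem_offDiag.1 he).2.2, fun x hx y hy hxy => ?_⟩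
        exact hmin (x, y) (Finset.mem_offDiag.2 ⟨hx, hy, hxy⟩)
    obtain ⟨m, hm, hsep⟩ := this
    obtain ⟨N, hN⟩ := exists_pow_lt_of_lt_one (show 0 < m / (2 * D) by positivity)
      (show (2 / 3 : ℝ) < 1 by norm_num)
    rw [lt_div_iff₀ (by positivity)] at hN
    refine ⟨N, Finset.Subset.antisymm (hV N).2.1 fun x hx => ?_⟩
    obtain ⟨v, hv, hxv⟩ := (hV N).2.2.2 x hx
    by_cases h : x = v
    · rwa [h]
    · have := hsep x hx v ((hV N).2.1 hv) h
      simp only [hρ] at hxv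
      linarith
  set M : ℝ := N * F.card with hM
  have hM0 : 0 ≤ M := by positivity
  set κ : ℝ := 1 / (4 * (M + 1)) with hκ
  have hκ0 : 0 < κ := by positivity
  have hflat : ∀ (n : ℕ) (v : ℂ), ∃ (p : ℤ × ℤ × ℤ) (e : ℂ), v ∈ F → ‖e‖ = 1 ∧ v ∈ dyadicSq p.1 p.2.1 p.2.2 ∧
      14 * ρ n < (2:ℝ) ^ (-p.1) ∧ (2:ℝ) ^ (-p.1) ≤ 28 * ρ n ∧
      ∀ z ∈ F, dist z v ≤ 14 * ρ n →
        |cb e v z| ≤ (336 * betaNum F (dyadicSq3 p.1 p.2.1 p.2.2) + 2 * κ) * ρ n := by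
    intro n v
    by_cases hv : v ∈ F
    · obtain ⟨p, e, h⟩ := flat_of_beta F v hv (ρ n) κ (hpos n) hκ0
      exact ⟨p, e, fun _ => h⟩
    · exact ⟨0, 0, fun h => absurd h hv⟩
  choose P e hP using hflat
  set B : ℕ → ℂ → ℝ := fun n v => betaNum F (dyadicSq3 (P n v).1 (P n v).2.1 (P n v).2.2) with hB
  have hB0 : ∀ n v, 0 ≤ B n v := fun n v => beta_nonneg _ _
  choose S hS using fun n => exists_minG (Vs n) (12 * ρ n)
  have step : ∀ n, wt (12 * ρ (n + 1)) (S (n + 1)) ≤ wt (12 * ρ n) (S n) +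
      (2 * ρ n + 1119090 * (∑ v ∈ Vs n, (336 * B n v + 2 * κ) ^ 2) * ρ n) := by
    intro n
    have HF : Flat (Vs n) (Vs (n + 1)) (ρ n) (e n) (fun v => 336 * B n v + 2 * κ) :=
      { hρ := hpos n
        sub := (hV n).1
        sepV := (hV n).2.2.1
        sepV' := fun x hx y hy hxy => by
          have := (hV (n + 1)).2.2.1 x hx y hy hxy
          rwa [hsucc] at this
        he := fun v hv => (hP n v ((hV n).2.1 hv)).1
        hη := fun v hv => by have := hB0 n v; positivity
        flat := fun v hv z hz hd => (hP n v ((hV n).2.1 hv)).2.2.2.2 z ((hV (n + 1)).2.1 hz) hd }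
    obtain ⟨S', h1, h2, h3⟩ := HF.step (hS n) (fun w hw => (hV n).2.2.2 w ((hV (n + 1)).2.1 hw))
    have h4 := (hS (n + 1)).min S' h1 h2
    have h5 : 12 * ρ (n + 1) = 8 * ρ n := by rw [hsucc]; ring
    rw [h5] at h4 ⊢
    linarith
  have tot : ∀ n, wt (12 * ρ n) (S n) ≤ ∑ k ∈ Finset.range n,
      (2 * ρ k + 1119090 * (∑ v ∈ Vs k, (336 * B k v + 2 * κ) ^ 2) * ρ k) := by
    intro n
    induction n with
    | zero =>
      have : S 0 = ∅ := by
        apply Finset.eq_empty_of_forall_notMem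
        intro E hE
        have := (hS 0).mem E hE
        rw [hV0] at this
        simp only [Finset.mem_singleton] at this
        exact this.2.2 (this.1.trans this.2.1.symm)
      rw [this]; simp [wt]
    | succ n ih => rw [Finset.sum_range_succ]; linarith [step n]
  have geo : ∀ n, ∑ k ∈ Finset.range n, ρ k + 3 * ρ n = 6 * D := by
    intro n
    induction n with
    | zero => simp [hρ]; ring
    | succ n ih => rw [Finset.sum_range_succ, hsucc]; linarith
  set I := (Finset.range N).sigma Vs with hI
  set f : ℤ × ℤ × ℤ → ℝ := fun p => betaNum F (dyadicSq3 p.1 p.2.1 p.2.2) ^ 2 *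
      diam (dyadicSq p.1 p.2.1 p.2.2) with hf
  have hf0 : ∀ p, 0 ≤ f p := fun p => mul_nonneg (sq_nonneg _) diam_nonneg
  have hbsum : ∑ x ∈ I, B x.1 x.2 ^ 2 * ρ x.1 ≤ 101250 * J := by
    calc ∑ x ∈ I, B x.1 x.2 ^ 2 * ρ x.1 ≤ ∑ x ∈ I, f (P x.1 x.2) := by
          refine Finset.sum_le_sum fun x hx => ?_
          simp only [hf, hB]
          refine mul_le_mul_of_nonneg_left ?_ (sq_nonneg _)
          have hx2 := (hV x.1).2.1 (Finset.mem_sigma.1 hx).2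
          have h3 := (hP x.1 x.2 hx2).2.2.1
          have h4 := sq_diam_ge (P x.1 x.2).1 (P x.1 x.2).2.1 (P x.1 x.2).2.2
          linarith [hpos x.1]
      _ = ∑ p ∈ I.image (fun x => P x.1 x.2), (I.filter (fun x => P x.1 x.2 = p)).card • f p :=
          Finset.sum_comp f _
      _ ≤ ∑ p ∈ I.image (fun x => P x.1 x.2), 101250 * f p := by
          refine Finset.sum_le_sum fun p hp => ?_
          rw [nsmul_eq_mul]
          refine mul_le_mul_of_nonneg_right ?_ (hf0 p)
          have := fiber_card D hDp ρ (fun n => rfl) p (I.filter (fun x => P x.1 x.2 = p)) (by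
            intro x hx
            obtain ⟨hx9, rfl⟩ := Finset.mem_filter.1 hx
            have := hP x.1 x.2 ((hV x.1).2.1 (Finset.mem_sigma.1 hx9).2)
            exact ⟨this.2.1, this.2.2.1, this.2.2.2.1⟩) (by
            rintro ⟨n, v⟩ hx ⟨n', w⟩ hy h hne
            simp only at h
            subst h
            have hx := (Finset.mem_sigma.1 (Finset.mem_filter.1 hx).1).2
            have hy := (Finset.mem_sigma.1 (Finset.mem_filter.1 hy).1).2
            exact (hV n).2.2.1 v hx w hy (fun h => hne (by rw [h])))
          exact_mod_cast this
      _ = 101250 * ∑ p ∈ I.image (fun x => P x.1 x.2), f p := by rw [Finset.mul_sum]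
      _ ≤ 101250 * J := by linarith [hJ (I.image (fun x => P x.1 x.2))]
  have hksum : ∑ x ∈ I, κ ^ 2 * ρ x.1 ≤ D / 8 := by
    have hρD : ∀ n, ρ n ≤ 2 * D := fun n => by
      simp only [hρ]
      have : ((2:ℝ) / 3) ^ n ≤ 1 := pow_le_one₀ (by norm_num) (by norm_num)
      nlinarith
    calc ∑ x ∈ I, κ ^ 2 * ρ x.1 ≤ ∑ x ∈ I, κ ^ 2 * (2 * D) :=
          Finset.sum_le_sum fun x _ => mul_le_mul_of_nonneg_left (hρD _) (sq_nonneg _)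
      _ = I.card * (κ ^ 2 * (2 * D)) := by rw [Finset.sum_const, nsmul_eq_mul]
      _ ≤ M * (κ ^ 2 * (2 * D)) := by
          refine mul_le_mul_of_nonneg_right ?_ (by positivity)
          rw [hI, Finset.card_sigma, hM]
          push_cast
          calc ∑ n ∈ Finset.range N, ((Vs n).card : ℝ) ≤ ∑ n ∈ Finset.range N, (F.card : ℝ) :=
                Finset.sum_le_sum fun n _ => by exact_mod_cast Finset.card_le_card (hV n).2.1
            _ = _ := by simp
      _ ≤ D / 8 := by
          rw [hκ]
          rw [div_pow, one_pow]
          rw [show M * (1 / (4 * (M + 1)) ^ 2 * (2 * D)) = (M / (M + 1) ^ 2) * (D / 8) by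
            field_simp; ring]
          have : M / (M + 1) ^ 2 ≤ 1 := by
            rw [div_le_one (by positivity)]; nlinarith
          nlinarith
  have hfin : wt (12 * ρ N) (S N) ≤ 12 * D + 1119090 * (225792 * (101250 * J) + D) := by
    refine (tot N).trans ?_
    rw [Finset.sum_add_distrib, ← Finset.mul_sum]
    have h1 := geo N
    have h2 : ∑ k ∈ Finset.range N, 1119090 * (∑ v ∈ Vs k, (336 * B k v + 2 * κ) ^ 2) * ρ k
        = 1119090 * ∑ x ∈ I, (336 * B x.1 x.2 + 2 * κ) ^ 2 * ρ x.1 := by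
      rw [hI, Finset.sum_sigma, Finset.mul_sum]
      refine Finset.sum_congr rfl fun k _ => ?_
      rw [mul_assoc, Finset.sum_mul]
    have h3 : ∑ x ∈ I, (336 * B x.1 x.2 + 2 * κ) ^ 2 * ρ x.1 ≤
        225792 * ∑ x ∈ I, B x.1 x.2 ^ 2 * ρ x.1 + 8 * ∑ x ∈ I, κ ^ 2 * ρ x.1 := by
      rw [Finset.mul_sum, Finset.mul_sum, ← Finset.sum_add_distrib]
      refine Finset.sum_le_sum fun x _ => ?_
      have := mul_nonneg (sq_nonneg (336 * B x.1 x.2 - 2 * κ)) (hpos x.1).le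
      nlinarith
    rw [h2]
    linarith [hpos N]
  refine ⟨S N, hN ▸ (hS N).conn, fun E hE => ?_, ?_⟩
  · have := (hS N).mem E hE
    rw [hN] at this
    exact ⟨this.1, this.2.1⟩
  · calc ∑ E ∈ S N, dist E.1 E.2 ≤ ∑ E ∈ S N, 2 * uu (12 * ρ N) (dist E.1 E.2) :=
          Finset.sum_le_sum fun E _ => uu_half (by linarith [hpos N]) dist_nonneg
      _ = 2 * wt (12 * ρ N) (S N) := by rw [← Finset.mul_sum]; rfl
      _ ≤ _ := by linarith

lemma upper_bound (E : Set ℂ) (hE : Bornology.IsBounded E) :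
    shortestLength E ≤ ENNReal.ofReal (24 * 10 ^ 16) * (EMetric.diam E + jonesSum E) := by
  by_cases hJ : jonesSum E = ⊤
  · rw [hJ, add_top, ENNReal.mul_top (by simp)]; exact le_top
  have hdt : EMetric.diam E ≠ ⊤ := Metric.isBounded_iff_ediam_ne_top.1 hE
  have h := curve_of_graphs E (6 * 10 ^ 16 * ((EMetric.diam E).toReal + (jonesSum E).toReal))
    (by positivity) (by
    intro F hF hne
    refine upper_graph F hne _ _ ENNReal.toReal_nonneg ?_ ?_
    · intro x hx y hy
      exact dist_le_diam_of_mem hE (hF hx) (hF hy)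
    · intro T
      have h1 : ENNReal.ofReal (∑ p ∈ T, betaNum F (dyadicSq3 p.1 p.2.1 p.2.2) ^ 2 *
          diam (dyadicSq p.1 p.2.1 p.2.2)) ≤ jonesSum E := by
        rw [ENNReal.ofReal_sum_of_nonneg fun p _ => mul_nonneg (sq_nonneg _) diam_nonneg]
        exact (ENNReal.sum_le_tsum T).trans (jonesSum_mono hF)
      exact (ENNReal.ofReal_le_iff_le_toReal hJ).1 h1)
  refine h.trans (le_of_eq ?_)
  rw [← ENNReal.ofReal_toReal hdt, ← ENNReal.ofReal_toReal hJ,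
    ← ENNReal.ofReal_add (by positivity) (by positivity), ← ENNReal.ofReal_mul (by positivity)]
  simp only [ENNReal.toReal_ofReal ENNReal.toReal_nonneg]
  congr 1; ring

end

noncomputable section
open Classical

lemma two_sum_le (K : Finset ℤ) : ∀ M : ℤ, (∀ k ∈ K, k ≤ M) → ∑ k ∈ K, (2:ℝ) ^ k ≤ 2 * 2 ^ M := by
  induction K using Finset.induction_on_max with
  | empty => intro M _; simp; positivity
  | insert a K ha ih =>
    intro M hM
    rw [Finset.sum_insert (fun h => lt_irrefl _ (ha a h))]
    have h1 := ih (a - 1) (fun k hk => by have := ha k hk; omega)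
    have h2 : (2:ℝ) ^ a ≤ 2 ^ M := zpow_le_zpow_right₀ one_le_two (hM a (Finset.mem_insert_self _ _))
    have h3 : (2:ℝ) * 2 ^ (a - 1) = 2 ^ a := by rw [← zpow_one_add₀ two_ne_zero]; congr 1; ring
    linarith

/-- side length and centre -/
def qL (p : ℤ × ℤ × ℤ) : ℝ := (2:ℝ) ^ (-p.1)
def qX (p : ℤ × ℤ × ℤ) : ℝ := ((p.2.2 : ℝ) + 1 / 2) * qL p
def qY (p : ℤ × ℤ × ℤ) : ℝ := ((p.2.1 : ℝ) + 1 / 2) * qL p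

lemma qL_pos (p : ℤ × ℤ × ℤ) : 0 < qL p := by unfold qL; positivity

lemma int_window (u l : ℝ) (hl : 0 < l) (j : ℤ) (h : |u - ((j:ℝ) + 1 / 2) * l| ≤ 5 * l) :
    j ∈ Finset.Icc ⌈u / l - 11 / 2⌉ ⌊u / l + 9 / 2⌋ := by
  have := abs_le.1 h
  rw [Finset.mem_Icc, Int.ceil_le, Int.le_floor]
  have e : u / l * l = u := by field_simp
  constructor
  · by_contra hc; push Not at hc; nlinarith
  · by_contra hc; push Not at hc; nlinarith

lemma int_window_card (v : ℝ) : (Finset.Icc ⌈v - 11 / 2⌉ ⌊v + 9 / 2⌋).card ≤ 11 := by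
  rw [Int.card_Icc]
  have h1 := Int.floor_le (v + 9 / 2)
  have h2 := Int.le_ceil (v - 11 / 2)
  have : ((⌊v + 9 / 2⌋ : ℤ) : ℝ) ≤ ((⌈v - 11 / 2⌉ + 10 : ℤ) : ℝ) := by push_cast; linarith
  have := Int.cast_le.1 this
  omega

lemma sum_lemma (u v g : ℝ) (hg : 0 ≤ g) (T : Finset (ℤ × ℤ × ℤ))
    (h : ∀ p ∈ T, |u - qX p| ≤ 5 * qL p ∧ |v - qY p| ≤ 5 * qL p ∧ g ≤ 8 * qL p) :
    ∑ p ∈ T, g / qL p ≤ 1936 := by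
  rcases T.eq_empty_or_nonempty with rfl | hne
  · simp
  have e1 : ∀ p, g / qL p = g * (2:ℝ) ^ p.1 := fun p => by
    unfold qL; rw [zpow_neg, div_inv_eq_mul]
  have e2 : ∑ p ∈ T, g / qL p = ∑ p ∈ T, (fun k : ℤ => g * (2:ℝ) ^ k) p.1 :=
    Finset.sum_congr rfl fun p _ => e1 p
  rw [e2, Finset.sum_comp (fun k : ℤ => g * (2:ℝ) ^ k) (fun p : ℤ × ℤ × ℤ => p.1)]
  have hcard : ∀ k, (T.filter (fun p => p.1 = k)).card ≤ 121 := by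
    intro k
    set l : ℝ := (2:ℝ) ^ (-k) with hl
    have hl0 : 0 < l := by positivity
    set A := (Finset.Icc ⌈v / l - 11 / 2⌉ ⌊v / l + 9 / 2⌋) ×ˢ
        (Finset.Icc ⌈u / l - 11 / 2⌉ ⌊u / l + 9 / 2⌋) with hA
    have : A.card ≤ 121 := by
      rw [hA, Finset.card_product]
      exact Nat.mul_le_mul (int_window_card _) (int_window_card _)
    refine le_trans (Finset.card_le_card_of_injOn (fun p => p.2) ?_ ?_) this
    · intro p hp
      rw [Finset.mem_coe, Finset.mem_filter] at hp
      obtain ⟨hp, rfl⟩ := hp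
      have := h p hp
      rw [Finset.mem_coe, hA, Finset.mem_product]
      exact ⟨int_window v l hl0 _ this.2.1, int_window u l hl0 _ this.1⟩
    · intro p hp q hq hpq
      rw [Finset.mem_coe, Finset.mem_filter] at hp hq
      exact Prod.ext (hp.2.trans hq.2.symm) hpq
  obtain ⟨q, hq, hmax⟩ := Finset.exists_max_image T (fun p => p.1) hne
  calc ∑ k ∈ T.image (fun p => p.1), (T.filter (fun p => p.1 = k)).card • (g * (2:ℝ) ^ k)
      ≤ ∑ k ∈ T.image (fun p => p.1), 121 * g * (2:ℝ) ^ k := by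
        refine Finset.sum_le_sum fun k _ => ?_
        rw [nsmul_eq_mul, mul_assoc]
        refine mul_le_mul_of_nonneg_right ?_ (by positivity)
        exact_mod_cast hcard k
    _ = 121 * g * ∑ k ∈ T.image (fun p => p.1), (2:ℝ) ^ k := by rw [Finset.mul_sum]
    _ ≤ 121 * g * (2 * 2 ^ q.1) := by
        refine mul_le_mul_of_nonneg_left (two_sum_le _ _ ?_) (by positivity)
        intro k hk
        obtain ⟨p, hp, rfl⟩ := Finset.mem_image.1 hk
        exact hmax p hp
    _ ≤ 1936 := by
        have h1 := (h q hq).2.2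
        have h2 : g / qL q ≤ 8 := by rw [div_le_iff₀ (qL_pos q)]; exact h1
        rw [e1] at h2
        linarith

lemma gaps (X : Finset ℝ) : ∃ g : ℝ → ℝ, (∀ y, 0 ≤ g y) ∧
    (∀ y ∈ X, ∀ b ∈ X, y < b → g y ≤ b - y) ∧
    ∀ a ∈ X, ∀ b ∈ X, a ≤ b → b - a ≤ ∑ y ∈ X.filter (fun y => a ≤ y ∧ y < b), g y := by
  have hex : ∀ y, ∃ n : ℝ, y ≤ n ∧ (∀ b ∈ X, y < b → n ≤ b ∧ n ∈ X ∧ y < n) := by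
    intro y
    rcases (X.filter (fun b => y < b)).eq_empty_or_nonempty with h | h
    · refine ⟨y, le_rfl, fun b hb hyb => ?_⟩
      have : b ∈ X.filter (fun b => y < b) := Finset.mem_filter.2 ⟨hb, hyb⟩
      rw [h] at this; simp at this
    · obtain ⟨n, hn, hmin⟩ := Finset.exists_min_image _ id h
      have hn := Finset.mem_filter.1 hn
      exact ⟨n, hn.2.le, fun b hb hyb => ⟨hmin b (Finset.mem_filter.2 ⟨hb, hyb⟩), hn⟩⟩
  choose nx h1 h2 using hex
  have hg : ∀ y, 0 ≤ nx y - y := fun y => by linarith [h1 y]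
  refine ⟨fun y => nx y - y, hg, fun y hy b hb hyb => by linarith [(h2 y b hb hyb).1], ?_⟩
  have key : ∀ n : ℕ, ∀ a ∈ X, ∀ b ∈ X, a ≤ b → (X.filter (fun y => a ≤ y ∧ y < b)).card ≤ n →
      b - a ≤ ∑ y ∈ X.filter (fun y => a ≤ y ∧ y < b), (nx y - y) := by
    intro n
    induction n with
    | zero =>
      intro a ha b hb hab hc
      rcases hab.eq_or_lt with rfl | hab
      · rw [sub_self]; exact Finset.sum_nonneg fun y _ => hg y
      · have : a ∈ X.filter (fun y => a ≤ y ∧ y < b) := Finset.mem_filter.2 ⟨ha, le_rfl, hab⟩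
        rw [Finset.card_eq_zero.1 (Nat.le_zero.1 hc)] at this
        simp at this
    | succ n ih =>
      intro a ha b hb hab hc
      rcases hab.eq_or_lt with rfl | hab
      · rw [sub_self]; exact Finset.sum_nonneg fun y _ => hg y
      obtain ⟨i1, i2, i3⟩ := h2 a b hb hab
      have hnot : a ∉ X.filter (fun y => nx a ≤ y ∧ y < b) := by
        simp only [Finset.mem_filter, not_and]; intro _ h; linarith
      have hsub : insert a (X.filter (fun y => nx a ≤ y ∧ y < b)) ⊆ X.filter (fun y => a ≤ y ∧ y < b) := by
        refine Finset.insert_subset (Finset.mem_filter.2 ⟨ha, le_rfl, hab⟩) fun y hy => ?_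
        have hy := Finset.mem_filter.1 hy
        exact Finset.mem_filter.2 ⟨hy.1, by linarith [hy.2.1], hy.2.2⟩
      have hcc := Finset.card_le_card hsub
      rw [Finset.card_insert_of_notMem hnot] at hcc
      have := ih (nx a) i2 b hb i1 (by omega)
      have h4 := Finset.sum_le_sum_of_subset_of_nonneg hsub (f := fun y => nx y - y) (fun y _ _ => hg y)
      rw [Finset.sum_insert hnot] at h4
      linarith
  exact fun a ha b hb hab => key _ a ha b hb hab le_rfl

end

noncomputable section
open Classical

/-- the line of slope `s` and intercept `t` separates consecutive points -/
def sepI (x y : ℕ → ℝ) (s t : ℝ) (i : ℕ) : Prop :=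
  t ∈ Set.uIoc (y i - s * x i) (y (i + 1) - s * x (i + 1))

def HitQ (x y : ℕ → ℝ) (m : ℕ) (cx cy l s t : ℝ) : Prop :=
  ∃ i < m, ∃ j < m, sepI x y s t i ∧ sepI x y s t j ∧ |x i - cx| ≤ 4 * l ∧ |y i - cy| ≤ 4 * l ∧
    |x j - cx| ≤ 4 * l ∧ |y j - cy| ≤ 4 * l ∧ 4 / 5 * l ≤ x j - x i

lemma sep_close {x y : ℕ → ℝ} {s t h : ℝ} {i : ℕ} (hs : |s| ≤ 10) (h1 : |x (i + 1) - x i| ≤ h)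
    (h2 : |y (i + 1) - y i| ≤ h) (hsep : sepI x y s t i) : |y i - (s * x i + t)| ≤ 11 * h := by
  have h3 : |(y (i + 1) - s * x (i + 1)) - (y i - s * x i)| ≤ 11 * h := by
    have : (y (i + 1) - s * x (i + 1)) - (y i - s * x i) = (y (i + 1) - y i) - s * (x (i + 1) - x i) := by
      ring
    rw [this]
    refine (abs_sub _ _).trans ?_
    rw [abs_mul]
    have := mul_le_mul hs h1 (abs_nonneg _) (by norm_num)
    linarith
  have h3 := abs_le.1 h3
  unfold sepI at hsep
  rcases Set.mem_uIoc.1 hsep with h4 | h4 <;> rw [abs_le] <;> constructor <;> linarith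

lemma lin_between {s a b u : ℝ} (h1 : a ≤ u) (h2 : u ≤ b) {t c r : ℝ} (ha : |s * a + t - c| ≤ r)
    (hb : |s * b + t - c| ≤ r) : |s * u + t - c| ≤ r := by
  rw [abs_le] at *
  rcases le_total 0 s with hs | hs
  · constructor <;> nlinarith
  · constructor <;> nlinarith

lemma count_hits {x y : ℕ → ℝ} {m : ℕ} {s t h : ℝ} (hs : |s| ≤ 10)
    (hst : ∀ i < m, |x (i + 1) - x i| ≤ h ∧ |y (i + 1) - y i| ≤ h)
    (T : Finset (ℤ × ℤ × ℤ)) (hT : ∀ p ∈ T, 110 * h ≤ qL p) :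
    ((T.filter (fun p => HitQ x y m (qX p) (qY p) (qL p) s t)).card : ℝ) ≤
      2420 * (((Finset.range m).filter (fun i => sepI x y s t i)).card : ℝ) := by
  set A := (Finset.range m).filter (fun i => sepI x y s t i) with hA
  set X := A.image x with hX
  obtain ⟨g, g0, g1, g2⟩ := gaps X
  set win : (ℤ × ℤ × ℤ) → ℝ → Prop := fun p u =>
    |u - qX p| ≤ 5 * qL p ∧ |s * u + t - qY p| ≤ 5 * qL p ∧ g u ≤ 8 * qL p with hwin
  set H := T.filter (fun p => HitQ x y m (qX p) (qY p) (qL p) s t) with hH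
  have key : ∀ p ∈ H, 1 ≤ 5 / 4 * ∑ u ∈ X, if win p u then g u / qL p else 0 := by
    intro p hp
    obtain ⟨hpT, i, hi, j, hj, si, sj, xi, yi, xj, yj, hd⟩ := Finset.mem_filter.1 hp
    have hl := qL_pos p
    have ci := sep_close hs (hst i hi).1 (hst i hi).2 si
    have cj := sep_close hs (hst j hj).1 (hst j hj).2 sj
    have hh := hT p hpT
    have miX : x i ∈ X := Finset.mem_image_of_mem _ (Finset.mem_filter.2 ⟨Finset.mem_range.2 hi, si⟩)
    have mjX : x j ∈ X := Finset.mem_image_of_mem _ (Finset.mem_filter.2 ⟨Finset.mem_range.2 hj, sj⟩)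
    have h1 := g2 _ miX _ mjX (by linarith)
    have h2 : ∑ u ∈ X.filter (fun u => x i ≤ u ∧ u < x j), g u ≤
        ∑ u ∈ X, if win p u then g u else 0 := by
      rw [Finset.sum_filter]
      refine Finset.sum_le_sum fun u hu => ?_
      by_cases hu2 : x i ≤ u ∧ u < x j
      · rw [if_pos hu2, if_pos]
        rw [abs_le] at xi xj yi yj
        refine ⟨abs_le.2 ⟨by linarith, by linarith⟩, ?_, ?_⟩
        · refine lin_between hu2.1 hu2.2.le ?_ ?_
          · rw [abs_le] at ci ⊢; constructor <;> linarith
          · rw [abs_le] at cj ⊢; constructor <;> linarith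
        · have := g1 u hu _ mjX hu2.2
          linarith
      · rw [if_neg hu2]; split_ifs
        · exact g0 u
        · exact le_rfl
    have h3 : ∑ u ∈ X, (if win p u then g u / qL p else 0) =
        (∑ u ∈ X, if win p u then g u else 0) / qL p := by
      rw [Finset.sum_div]
      refine Finset.sum_congr rfl fun u _ => ?_
      split_ifs <;> simp
    rw [h3]
    have h4 : 4 / 5 ≤ (∑ u ∈ X, if win p u then g u else 0) / qL p := by
      rw [le_div_iff₀ hl]; linarith
    linarith
  calc (H.card : ℝ) = ∑ p ∈ H, (1:ℝ) := by simp
    _ ≤ ∑ p ∈ H, 5 / 4 * ∑ u ∈ X, (if win p u then g u / qL p else 0) := Finset.sum_le_sum key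
    _ = 5 / 4 * ∑ u ∈ X, ∑ p ∈ H, (if win p u then g u / qL p else 0) := by
        rw [← Finset.mul_sum, Finset.sum_comm]
    _ ≤ 5 / 4 * ∑ u ∈ X, (1936:ℝ) := by
        refine mul_le_mul_of_nonneg_left (Finset.sum_le_sum fun u _ => ?_) (by norm_num)
        rw [← Finset.sum_filter]
        refine sum_lemma u (s * u + t) (g u) (g0 u) _ fun p hp => ?_
        exact (Finset.mem_filter.1 hp).2
    _ = 2420 * (X.card : ℝ) := by rw [Finset.sum_const, nsmul_eq_mul]; ring
    _ ≤ 2420 * (A.card : ℝ) := by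
        have : (X.card : ℝ) ≤ A.card := by exact_mod_cast Finset.card_image_le
        linarith

/-- total measure of lines hitting a square -/
def WQ (x y : ℕ → ℝ) (m : ℕ) (cx cy l : ℝ) : ℝ≥0∞ :=
  ∫⁻ s in Icc (-10:ℝ) 10, ∫⁻ t, if HitQ x y m cx cy l s t then 1 else 0

lemma sum_lintegral_le {α ι : Type*} [MeasurableSpace α] (μ : Measure α) (T : Finset ι)
    (f : ι → α → ℝ≥0∞) : ∑ i ∈ T, ∫⁻ a, f i a ∂μ ≤ ∫⁻ a, ∑ i ∈ T, f i a ∂μ := by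
  induction T using Finset.induction_on with
  | empty => simp
  | insert a T ha ih =>
    simp only [Finset.sum_insert ha]
    exact (add_le_add_right ih _).trans (le_lintegral_add _ _)

lemma sum_WQ {x y : ℕ → ℝ} {m : ℕ} {h : ℝ}
    (hst : ∀ i < m, |x (i + 1) - x i| ≤ h ∧ |y (i + 1) - y i| ≤ h)
    (T : Finset (ℤ × ℤ × ℤ)) (hT : ∀ p ∈ T, 110 * h ≤ qL p) :
    ∑ p ∈ T, WQ x y m (qX p) (qY p) (qL p) ≤
      ENNReal.ofReal (2420 * 220 * ∑ i ∈ Finset.range m, (|x (i + 1) - x i| + |y (i + 1) - y i|)) := by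
  set d : ℕ → ℝ := fun i => |x (i + 1) - x i| + |y (i + 1) - y i| with hd
  have hd0 : ∀ i, 0 ≤ d i := fun i => by simp only [hd]; positivity
  have inner : ∀ s ∈ Icc (-10:ℝ) 10, ∑ p ∈ T, ∫⁻ t, (if HitQ x y m (qX p) (qY p) (qL p) s t then (1:ℝ≥0∞) else 0)
      ≤ ENNReal.ofReal (2420 * 11 * ∑ i ∈ Finset.range m, d i) := by
    intro s hs
    have hs : |s| ≤ 10 := abs_le.2 hs
    refine (sum_lintegral_le _ _ _).trans ?_
    calc ∫⁻ t, ∑ p ∈ T, (if HitQ x y m (qX p) (qY p) (qL p) s t then (1:ℝ≥0∞) else 0)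
        ≤ ∫⁻ t, 2420 * ∑ i ∈ Finset.range m,
            (Set.uIoc (y i - s * x i) (y (i + 1) - s * x (i + 1))).indicator (fun _ => (1:ℝ≥0∞)) t := by
          refine lintegral_mono fun t => ?_
          have h1 := count_hits (t := t) hs hst T hT
          have h2 : ((T.filter (fun p => HitQ x y m (qX p) (qY p) (qL p) s t)).card : ℝ≥0∞) ≤
              2420 * (((Finset.range m).filter (fun i => sepI x y s t i)).card : ℝ≥0∞) := by
            exact_mod_cast h1
          rw [Finset.card_filter, Finset.card_filter] at h2
          push_cast at h2
          refine h2.trans (le_of_eq ?_)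
          congr 1
      _ = 2420 * ∑ i ∈ Finset.range m,
            volume (Set.uIoc (y i - s * x i) (y (i + 1) - s * x (i + 1))) := by
          rw [lintegral_const_mul, lintegral_finset_sum]
          · congr 1
            refine Finset.sum_congr rfl fun i _ => ?_
            rw [lintegral_indicator measurableSet_uIoc]; simp
          · intro i _
            exact measurable_const.indicator measurableSet_uIoc
          · exact Finset.measurable_sum _ fun i _ => measurable_const.indicator measurableSet_uIoc
      _ ≤ 2420 * ∑ i ∈ Finset.range m, ENNReal.ofReal (11 * d i) := by
          gcongr with i hi
          rw [Real.volume_uIoc]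
          apply ENNReal.ofReal_le_ofReal
          have : (y (i + 1) - s * x (i + 1)) - (y i - s * x i) = (y (i + 1) - y i) - s * (x (i + 1) - x i) := by
            ring
          rw [this]
          refine (abs_sub _ _).trans ?_
          rw [abs_mul]
          have := mul_le_mul_of_nonneg_right hs (abs_nonneg (x (i + 1) - x i))
          simp only [hd]
          linarith [abs_nonneg (x (i + 1) - x i), abs_nonneg (y (i + 1) - y i)]
      _ = _ := by
          rw [← ENNReal.ofReal_sum_of_nonneg fun i _ => by have := hd0 i; positivity, ← Finset.mul_sum,
            mul_assoc, ENNReal.ofReal_mul (by norm_num)]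
          norm_num
  unfold WQ
  calc ∑ p ∈ T, ∫⁻ s in Icc (-10:ℝ) 10, ∫⁻ t, (if HitQ x y m (qX p) (qY p) (qL p) s t then (1:ℝ≥0∞) else 0)
      ≤ ∫⁻ s in Icc (-10:ℝ) 10, ∑ p ∈ T, ∫⁻ t, (if HitQ x y m (qX p) (qY p) (qL p) s t then (1:ℝ≥0∞) else 0) :=
        sum_lintegral_le _ _ _
    _ ≤ ∫⁻ s in Icc (-10:ℝ) 10, ENNReal.ofReal (2420 * 11 * ∑ i ∈ Finset.range m, d i) :=
        setLIntegral_mono' measurableSet_Icc inner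
    _ = _ := by
        rw [setLIntegral_const, Real.volume_Icc, ← ENNReal.ofReal_mul
          (by have := Finset.sum_nonneg (s := Finset.range m) (fun i _ => hd0 i); positivity)]
        congr 1; ring

end

noncomputable section
open Classical

lemma uioc_inter {p p' q q' κ : ℝ} (hκ : 0 ≤ κ) (h1 : κ ≤ |p' - p|) (h2 : κ ≤ |q - p|) (h3 : κ ≤ |q' - p|)
    (h4 : (q - p) * (q' - p) ≤ 0) :
    ENNReal.ofReal κ ≤ volume (Set.uIoc p p' ∩ Set.uIoc q q') := by
  rcases hκ.eq_or_lt with rfl | hκ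
  · simp
  have hq : (q ≤ p - κ ∧ p + κ ≤ q') ∨ (q' ≤ p - κ ∧ p + κ ≤ q) := by
    rcases le_abs.1 h2 with h2 | h2 <;> rcases le_abs.1 h3 with h3 | h3
    · nlinarith [mul_pos (hκ.trans_le h2) (hκ.trans_le h3)]
    · right; constructor <;> linarith
    · left; constructor <;> linarith
    · nlinarith [mul_pos (hκ.trans_le h2) (hκ.trans_le h3)]
  rcases le_abs.1 h1 with h1 | h1
  · have hsub : Ioc p (p + κ) ⊆ Set.uIoc p p' ∩ Set.uIoc q q' := by
      intro t ht
      refine ⟨Set.mem_uIoc.2 (Or.inl ⟨ht.1, by linarith [ht.2]⟩), Set.mem_uIoc.2 ?_⟩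
      rcases hq with hq | hq
      · exact Or.inl ⟨by linarith [ht.1], by linarith [ht.2]⟩
      · exact Or.inr ⟨by linarith [ht.1], by linarith [ht.2]⟩
    refine le_trans (le_of_eq ?_) (measure_mono hsub)
    rw [Real.volume_Ioc]; congr 1; ring
  · have hsub : Ioc (p - κ) p ⊆ Set.uIoc p p' ∩ Set.uIoc q q' := by
      intro t ht
      refine ⟨Set.mem_uIoc.2 (Or.inr ⟨by linarith [ht.1], ht.2⟩), Set.mem_uIoc.2 ?_⟩
      rcases hq with hq | hq
      · exact Or.inl ⟨by linarith [ht.1], by linarith [ht.2]⟩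
      · exact Or.inr ⟨by linarith [ht.1], by linarith [ht.2]⟩
    refine le_trans (le_of_eq ?_) (measure_mono hsub)
    rw [Real.volume_Ioc]; congr 1; ring

lemma cross_walk_aux (f : ℕ → ℝ) (t : ℝ) (a n : ℕ) (h : a ≤ n) (ht : t ∈ Set.uIoc (f a) (f n)) :
    ∃ i, a ≤ i ∧ i + 1 ≤ n ∧ t ∈ Set.uIoc (f i) (f (i + 1)) := by
  induction n, h using Nat.le_induction with
  | base => simp at ht
  | succ n hn ih =>
    by_cases h1 : t ∈ Set.uIoc (f a) (f n)
    · obtain ⟨i, h2, h3, h4⟩ := ih h1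
      exact ⟨i, h2, by omega, h4⟩
    · refine ⟨n, hn, le_rfl, ?_⟩
      rw [Set.mem_uIoc] at *
      push Not at h1
      rcases ht with ht | ht
      · exact Or.inl ⟨h1.1 ht.1, ht.2⟩
      · right
        refine ⟨ht.1, ?_⟩
        by_contra hc
        push Not at hc
        linarith [h1.2 hc, ht.2]

lemma cross_walk (f : ℕ → ℝ) (t : ℝ) (a b : ℕ) (ht : t ∈ Set.uIoc (f a) (f b)) :
    ∃ i, i ∈ Set.uIcc a b ∧ (i + 1 ≤ a ∨ i + 1 ≤ b) ∧ t ∈ Set.uIoc (f i) (f (i + 1)) := by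
  rcases le_total a b with h | h
  · obtain ⟨i, h1, h2, h3⟩ := cross_walk_aux f t a b h ht
    exact ⟨i, by rw [Set.uIcc_of_le h]; exact ⟨h1, by omega⟩, Or.inr h2, h3⟩
  · rw [Set.uIoc_comm] at ht
    obtain ⟨i, h1, h2, h3⟩ := cross_walk_aux f t b a h ht
    exact ⟨i, by rw [Set.uIcc_of_ge h]; exact ⟨h1, by omega⟩, Or.inl h2, h3⟩

lemma lin_big {dx dy lo σ l : ℝ} (hl : 0 < l) (hσ : 0 ≤ σ) (h1 : -10 ≤ lo) (h2 : lo + σ ≤ 10)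
    (h : l / 4 ≤ |dx| ∨ l / 4 ≤ |dy|) : ∃ u v, lo + σ / 4 ≤ u ∧ v ≤ lo + 3 * σ / 4 ∧ v - u = σ / 8 ∧
      ∀ s ∈ Icc u v, l * σ / 800 ≤ |dy - s * dx| := by
  by_cases hx : |dx| < l / 100
  · refine ⟨lo + σ / 4, lo + 3 * σ / 8, le_rfl, by linarith, by ring, fun s hs => ?_⟩
    have hy : l / 4 ≤ |dy| := by rcases h with h | h <;> linarith
    have hs10 : |s| ≤ 10 := abs_le.2 ⟨by linarith [hs.1], by linarith [hs.2]⟩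
    have h3 : |dy| - |s * dx| ≤ |dy - s * dx| := abs_sub_abs_le_abs_sub _ _
    rw [abs_mul] at h3
    have h4 := mul_le_mul hs10 hx.le (abs_nonneg _) (by norm_num)
    nlinarith
  · push Not at hx
    have hdx : dx ≠ 0 := by intro h0; rw [h0, abs_zero] at hx; linarith
    set c := dy / dx with hc
    have e : ∀ s, |dy - s * dx| = |c - s| * |dx| := fun s => by
      rw [← abs_mul]; congr 1; rw [hc]; field_simp
    have fin : ∀ s, σ / 8 ≤ |c - s| → l * σ / 800 ≤ |dy - s * dx| := fun s hs => by
      rw [e]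
      have := mul_le_mul hs hx (by positivity) (abs_nonneg _)
      linarith
    rcases le_total c (lo + σ / 2) with h3 | h3
    · refine ⟨lo + 5 * σ / 8, lo + 3 * σ / 4, by linarith, le_rfl, by ring, fun s hs => fin s ?_⟩
      rw [le_abs]; right; linarith [hs.1]
    · refine ⟨lo + σ / 4, lo + 3 * σ / 8, le_rfl, by linarith, by ring, fun s hs => fin s ?_⟩
      rw [le_abs]; left; linarith [hs.2]

set_option maxHeartbeats 1000000 in
lemma four_point {x y : ℕ → ℝ} {m : ℕ} {cx cy l : ℝ} {a a' z z' : ℕ} (hl : 0 < l)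
    (ha : a ≤ m) (ha' : a' ≤ m) (hz : z ≤ m) (hz' : z' ≤ m)
    (HA : ∀ i ∈ Set.uIcc a a', |x i - cx| ≤ 4 * l ∧ |y i - cy| ≤ 4 * l)
    (HZ : ∀ i ∈ Set.uIcc z z', |x i - cx| ≤ 4 * l ∧ |y i - cy| ≤ 4 * l)
    (Hd : ∀ i ∈ Set.uIcc a a', ∀ j ∈ Set.uIcc z z', 4 / 5 * l ≤ |x i - x j|)
    (Hs : 0 < (x a - x z) * (x a' - x z))
    (Hz : l / 4 ≤ |x z' - x z| ∨ l / 4 ≤ |y z' - y z|) :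
    ENNReal.ofReal (((x a - x z) * (y a' - y z) - (x a' - x z) * (y a - y z)) ^ 2 / (26214400 * l ^ 3))
      ≤ WQ x y m cx cy l := by
  have la := Set.left_mem_uIcc (a := a) (b := a')
  have ra := Set.right_mem_uIcc (a := a) (b := a')
  have lz := Set.left_mem_uIcc (a := z) (b := z')
  have A0 := HA _ la
  have A1 := HA _ ra
  have Z0 := HZ _ lz
  have D0 := Hd _ la _ lz
  have D1 := Hd _ ra _ lz
  set X0 := x a - x z with hX0
  set X1 := x a' - x z with hX1
  set Y0 := y a - y z with hY0
  set Y1 := y a' - y z with hY1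
  have bX0 : |X0| ≤ 8 * l := by have h1 := abs_le.1 A0.1; have h2 := abs_le.1 Z0.1; rw [abs_le]; constructor <;> linarith
  have bX1 : |X1| ≤ 8 * l := by have h1 := abs_le.1 A1.1; have h2 := abs_le.1 Z0.1; rw [abs_le]; constructor <;> linarith
  have bY0 : |Y0| ≤ 8 * l := by have h1 := abs_le.1 A0.2; have h2 := abs_le.1 Z0.2; rw [abs_le]; constructor <;> linarith
  have bY1 : |Y1| ≤ 8 * l := by have h1 := abs_le.1 A1.2; have h2 := abs_le.1 Z0.2; rw [abs_le]; constructor <;> linarith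
  have nX0 : X0 ≠ 0 := by intro h; rw [h, zero_mul] at Hs; exact lt_irrefl _ Hs
  have nX1 : X1 ≠ 0 := by intro h; rw [h, mul_zero] at Hs; exact lt_irrefl _ Hs
  set s0 := Y0 / X0 with hs0
  set s1 := Y1 / X1 with hs1
  have slope : ∀ X Y : ℝ, X ≠ 0 → 4 / 5 * l ≤ |X| → |Y| ≤ 8 * l → |Y / X| ≤ 10 := by
    intro X Y hX h1 h2
    rw [abs_div, div_le_iff₀ (abs_pos.2 hX)]; linarith
  have b0 := abs_le.1 (slope X0 Y0 nX0 D0 bY0)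
  have b1 := abs_le.1 (slope X1 Y1 nX1 D1 bY1)
  set lo := min s0 s1 with hlo
  set hi := max s0 s1 with hhi
  set σ := hi - lo with hσ
  have hσ0 : 0 ≤ σ := by rw [hσ]; exact sub_nonneg.2 min_le_max
  have hσabs : σ = |s0 - s1| := by rw [hσ, hhi, hlo, max_sub_min_eq_abs']
  obtain ⟨u, v, hu, hv, huv, hbig⟩ := lin_big (dx := x z' - x z) (dy := y z' - y z) (lo := lo) (σ := σ) hl hσ0
    (le_min b0.1 b1.1) (by rw [hσ]; linarith [max_le b0.2 b1.2]) Hz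
  have hlohi : ∀ s ∈ Icc u v, σ / 4 ≤ |s0 - s| ∧ σ / 4 ≤ |s1 - s| ∧ (s0 - s) * (s1 - s) ≤ 0 := by
    intro s hs
    have h1 : lo + σ / 4 ≤ s := hu.trans hs.1
    have h2 : s ≤ hi - σ / 4 := by linarith [hs.2]
    rcases le_total s0 s1 with h | h
    · have e1 : lo = s0 := min_eq_left h
      have e2 : hi = s1 := max_eq_right h
      rw [e1] at h1; rw [e2] at h2
      refine ⟨le_abs.2 (Or.inr (by linarith)), le_abs.2 (Or.inl (by linarith)), ?_⟩
      exact mul_nonpos_of_nonpos_of_nonneg (by linarith) (by linarith)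
    · have e1 : lo = s1 := min_eq_right h
      have e2 : hi = s0 := max_eq_left h
      rw [e1] at h1; rw [e2] at h2
      refine ⟨le_abs.2 (Or.inl (by linarith)), le_abs.2 (Or.inr (by linarith)), ?_⟩
      exact mul_nonpos_of_nonneg_of_nonpos (by linarith) (by linarith)
  have hsub : Icc u v ⊆ Icc (-10:ℝ) 10 := by
    intro s hs
    have : hi ≤ 10 := max_le b0.2 b1.2
    have : -10 ≤ lo := le_min b0.1 b1.1
    exact ⟨by linarith [hs.1], by linarith [hs.2]⟩
  have inner : ∀ s ∈ Icc u v, ENNReal.ofReal (l * σ / 800) ≤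
      ∫⁻ t, if HitQ x y m cx cy l s t then (1:ℝ≥0∞) else 0 := by
    intro s hs
    obtain ⟨k1, k2, k3⟩ := hlohi s hs
    set f : ℕ → ℝ := fun i => y i - s * x i with hf
    have e0 : f a - f z = X0 * (s0 - s) := by
      have : X0 * s0 = Y0 := by rw [hs0]; field_simp
      rw [mul_sub, this]; simp only [hf, hX0, hY0]; ring
    have e1 : f a' - f z = X1 * (s1 - s) := by
      have : X1 * s1 = Y1 := by rw [hs1]; field_simp
      rw [mul_sub, this]; simp only [hf, hX1, hY1]; ring
    have hk : 0 ≤ l * σ / 800 := by positivity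
    have big := uioc_inter (p := f z) (p' := f z') (q := f a) (q' := f a') hk (by
        have := hbig s hs
        rw [show f z' - f z = y z' - y z - s * (x z' - x z) by simp only [hf]; ring]
        exact this) (by
        rw [e0, abs_mul]
        have := mul_le_mul D0 k1 (by positivity) (abs_nonneg _)
        nlinarith) (by
        rw [e1, abs_mul]
        have := mul_le_mul D1 k2 (by positivity) (abs_nonneg _)
        nlinarith) (by
        rw [e0, e1]
        have := mul_nonpos_of_nonneg_of_nonpos Hs.le k3
        linarith)
    refine big.trans ?_
    have hmeas : MeasurableSet (Set.uIoc (f z) (f z') ∩ Set.uIoc (f a) (f a')) :=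
      measurableSet_uIoc.inter measurableSet_uIoc
    rw [← lintegral_indicator_one hmeas]
    refine lintegral_mono fun t => ?_
    by_cases ht : t ∈ Set.uIoc (f z) (f z') ∩ Set.uIoc (f a) (f a')
    · obtain ⟨j, j1, j2, j3⟩ := cross_walk f t z z' ht.1
      obtain ⟨i, i1, i2, i3⟩ := cross_walk f t a a' ht.2
      have hjm : j < m := by omega
      have him : i < m := by omega
      rw [Set.indicator_of_mem ht, if_pos]
      · rfl
      · rcases le_abs.1 (Hd i i1 j j1) with hd | hd
        · exact ⟨j, hjm, i, him, j3, i3, (HZ j j1).1, (HZ j j1).2, (HA i i1).1, (HA i i1).2, hd⟩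
        · exact ⟨i, him, j, hjm, i3, j3, (HA i i1).1, (HA i i1).2, (HZ j j1).1, (HZ j j1).2, by linarith⟩
    · rw [Set.indicator_of_notMem ht]; exact zero_le
  have hcross : (X0 * Y1 - X1 * Y0) ^ 2 = (X0 * X1) ^ 2 * σ ^ 2 := by
    rw [hσabs, sq_abs, hs0, hs1]; field_simp; ring
  have hXX : (X0 * X1) ^ 2 ≤ 4096 * l ^ 4 := by
    have : |X0 * X1| ≤ 64 * l ^ 2 := by
      rw [abs_mul]
      have := mul_le_mul bX0 bX1 (abs_nonneg _) (by positivity)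
      linarith
    have := pow_le_pow_left₀ (abs_nonneg _) this 2
    rw [sq_abs] at this
    linarith
  calc ENNReal.ofReal ((X0 * Y1 - X1 * Y0) ^ 2 / (26214400 * l ^ 3))
      ≤ ENNReal.ofReal (l * σ / 800 * (v - u)) := by
        apply ENNReal.ofReal_le_ofReal
        rw [huv, hcross, div_le_iff₀ (by positivity)]
        have := mul_le_mul_of_nonneg_right hXX (sq_nonneg σ)
        linarith
    _ = ∫⁻ s in Icc u v, ENNReal.ofReal (l * σ / 800) := by
        rw [setLIntegral_const, Real.volume_Icc, ENNReal.ofReal_mul (by positivity)]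
    _ ≤ ∫⁻ s in Icc u v, ∫⁻ t, (if HitQ x y m cx cy l s t then (1:ℝ≥0∞) else 0) :=
        setLIntegral_mono' measurableSet_Icc inner
    _ ≤ WQ x y m cx cy l := lintegral_mono_set hsub

end

noncomputable section
open Classical

lemma walk_fwd (G : ℕ → ℝ) (n : ℕ) (h c : ℝ) (hh : 0 ≤ h) (hs : ∀ k < n, |G (k + 1) - G k| ≤ h) (h0 : G 0 ≤ c)
    (h1 : c ≤ G n) : ∃ j ≤ n, c ≤ G j ∧ ∀ k ≤ j, G k ≤ c + h := by
  have hex : ∃ j, c ≤ G j := ⟨n, h1⟩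
  have hjn : Nat.find hex ≤ n := Nat.find_min' hex h1
  refine ⟨Nat.find hex, hjn, Nat.find_spec hex, fun k hk => ?_⟩
  rcases hk.eq_or_lt with rfl | hk
  · rcases Nat.eq_zero_or_pos (Nat.find hex) with h2 | h2
    · rw [h2]; linarith
    · obtain ⟨i, hi⟩ := Nat.exists_eq_succ_of_ne_zero h2.ne'
      have h3 := Nat.find_min hex (m := i) (by omega)
      push Not at h3
      have h4 := (abs_le.1 (hs i (by omega))).2
      rw [hi]
      simp only [Nat.succ_eq_add_one]
      linarith
  · have h3 := Nat.find_min hex hk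
    push Not at h3
    linarith

lemma walk_lemma (g : ℕ → ℝ) (m : ℕ) (h c : ℝ) (hh : 0 ≤ h) (hs : ∀ k < m, |g (k + 1) - g k| ≤ h)
    (i0 i1 : ℕ) (hi0 : i0 ≤ m) (hi1 : i1 ≤ m) (h0 : g i0 ≤ c) (h1 : c ≤ g i1) :
    ∃ j ≤ m, c ≤ g j ∧ ∀ k ∈ Set.uIcc i0 j, g k ≤ c + h := by
  rcases le_total i0 i1 with hle | hle
  · obtain ⟨j, hj, hcj, hk⟩ := walk_fwd (fun k => g (i0 + k)) (i1 - i0) h c hh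
      (fun k hk => hs (i0 + k) (by omega)) h0 (by simpa [Nat.add_sub_cancel' hle] using h1)
    refine ⟨i0 + j, by omega, hcj, fun k hkm => ?_⟩
    rw [Set.uIcc_of_le (by omega)] at hkm
    have := hk (k - i0) (by have := hkm.2; omega)
    simpa [Nat.add_sub_cancel' hkm.1] using this
  · obtain ⟨j, hj, hcj, hk⟩ := walk_fwd (fun k => g (i0 - k)) (i0 - i1) h c hh
      (fun k hk => by
        have := hs (i0 - (k + 1)) (by omega)
        rw [show i0 - (k + 1) + 1 = i0 - k by omega, abs_sub_comm] at this
        exact this) h0 (by simpa [Nat.sub_sub_self hle] using h1)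
    refine ⟨i0 - j, by omega, hcj, fun k hkm => ?_⟩
    rw [Set.uIcc_of_ge (by omega)] at hkm
    have h2 := hkm.1
    have h3 := hkm.2
    have := hk (i0 - k) (by omega)
    simpa [Nat.sub_sub_self h3] using this

/-- sup distance -/
def nm (a b u v : ℝ) : ℝ := max |a - u| |b - v|

lemma nm_le {a b u v r : ℝ} : nm a b u v ≤ r ↔ |a - u| ≤ r ∧ |b - v| ≤ r := by
  unfold nm; exact max_le_iff

lemma le_nm {a b u v r : ℝ} : r ≤ nm a b u v ↔ r ≤ |a - u| ∨ r ≤ |b - v| := by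
  unfold nm; exact le_max_iff

lemma nm_tri (a b u v a' b' : ℝ) : nm a b u v ≤ nm a b a' b' + nm a' b' u v := by
  have h1 := nm_le.1 (le_refl (nm a b a' b'))
  have h2 := nm_le.1 (le_refl (nm a' b' u v))
  rw [nm_le]
  exact ⟨(abs_sub_le _ a' _).trans (add_le_add h1.1 h2.1), (abs_sub_le _ b' _).trans (add_le_add h1.2 h2.2)⟩

lemma nm_comm (a b u v : ℝ) : nm a b u v = nm u v a b := by
  unfold nm; rw [abs_sub_comm, abs_sub_comm b]

lemma nm_self (a b : ℝ) : nm a b a b = 0 := by simp [nm]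

lemma nm_lip {x y : ℕ → ℝ} {m : ℕ} {h : ℝ}
    (hst : ∀ i < m, |x (i + 1) - x i| ≤ h ∧ |y (i + 1) - y i| ≤ h) (u v : ℝ) :
    ∀ k < m, |nm (x (k + 1)) (y (k + 1)) u v - nm (x k) (y k) u v| ≤ h := by
  intro k hk
  have h0 : nm (x (k + 1)) (y (k + 1)) (x k) (y k) ≤ h := nm_le.2 (hst k hk)
  have h1 := nm_tri (x (k + 1)) (y (k + 1)) u v (x k) (y k)
  have h2 := nm_tri (x k) (y k) u v (x (k + 1)) (y (k + 1))
  rw [nm_comm (x k) (y k) (x (k + 1))] at h2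
  rw [abs_le]; constructor <;> linarith

lemma walk_from {x y : ℕ → ℝ} {m : ℕ} {h c : ℝ} (hh : 0 ≤ h) (hc : 0 ≤ c)
    (hst : ∀ i < m, |x (i + 1) - x i| ≤ h ∧ |y (i + 1) - y i| ≤ h) (i0 i1 : ℕ) (hi0 : i0 ≤ m) (hi1 : i1 ≤ m)
    (hfar : c ≤ nm (x i1) (y i1) (x i0) (y i0)) :
    ∃ j ≤ m, c ≤ nm (x j) (y j) (x i0) (y i0) ∧
      ∀ k ∈ Set.uIcc i0 j, nm (x k) (y k) (x i0) (y i0) ≤ c + h :=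
  walk_lemma (fun k => nm (x k) (y k) (x i0) (y i0)) m h c hh (nm_lip hst _ _) i0 i1 hi0 hi1
    (by simpa only [nm_self] using hc) hfar

lemma core_x {x y : ℕ → ℝ} {m : ℕ} {h cx cy l : ℝ} (hh : 0 ≤ h) (hl : 0 < l) (hhl : 1000 * h ≤ l)
    (hst : ∀ i < m, |x (i + 1) - x i| ≤ h ∧ |y (i + 1) - y i| ≤ h)
    (a0 a1 : ℕ) (ha0 : a0 ≤ m) (ha1 : a1 ≤ m) (hA : nm (x a0) (y a0) cx cy ≤ 3 * l + h)
    (hAx : 3 * l ≤ |x a0 - cx|)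
    (hsub : ∀ k ∈ Set.uIcc a0 a1, nm (x k) (y k) (x a0) (y a0) ≤ l / 4 + h)
    (z : ℕ) (hz : z ≤ m) (hzc : nm (x z) (y z) cx cy ≤ 8 / 5 * l) :
    ENNReal.ofReal (((x a0 - x z) * (y a1 - y z) - (x a1 - x z) * (y a0 - y z)) ^ 2 / (26214400 * l ^ 3))
      ≤ WQ x y m cx cy l := by
  have hfar : l / 4 ≤ nm (x a0) (y a0) (x z) (y z) := by
    have h1 : 3 * l ≤ nm (x a0) (y a0) cx cy := le_nm.2 (Or.inl hAx)
    have h2 := nm_tri (x a0) (y a0) cx cy (x z) (y z)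
    linarith
  obtain ⟨z', hz', hz1, hz2⟩ := walk_from hh (by positivity) hst z a0 hz ha0 hfar
  have HA : ∀ i ∈ Set.uIcc a0 a1, nm (x i) (y i) cx cy ≤ 4 * l := fun i hi => by
    have := nm_tri (x i) (y i) cx cy (x a0) (y a0)
    linarith [hsub i hi]
  have HZ : ∀ i ∈ Set.uIcc z z', nm (x i) (y i) cx cy ≤ 19 / 10 * l := fun i hi => by
    have := nm_tri (x i) (y i) cx cy (x z) (y z)
    linarith [hz2 i hi]
  have hside : (∀ i ∈ Set.uIcc a0 a1, ∀ j ∈ Set.uIcc z z', 4 / 5 * l ≤ x i - x j) ∨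
      (∀ i ∈ Set.uIcc a0 a1, ∀ j ∈ Set.uIcc z z', 4 / 5 * l ≤ -(x i - x j)) := by
    rcases le_abs.1 hAx with hs | hs
    · left
      intro i hi j hj
      have h1 := abs_le.1 (nm_le.1 (hsub i hi)).1
      have h2 := abs_le.1 (nm_le.1 (HZ j hj)).1
      linarith
    · right
      intro i hi j hj
      have h1 := abs_le.1 (nm_le.1 (hsub i hi)).1
      have h2 := abs_le.1 (nm_le.1 (HZ j hj)).1
      linarith
  have la := Set.left_mem_uIcc (a := a0) (b := a1)
  have ra := Set.right_mem_uIcc (a := a0) (b := a1)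
  have lz := Set.left_mem_uIcc (a := z) (b := z')
  refine four_point (a := a0) (a' := a1) (z := z) (z' := z') hl ha0 ha1 hz hz' (fun i hi => nm_le.1 (HA i hi))
    (fun i hi => nm_le.1 ((HZ i hi).trans (by linarith))) ?_ ?_ (le_nm.1 hz1)
  · intro i hi j hj
    rcases hside with hs | hs
    · exact le_abs.2 (Or.inl (hs i hi j hj))
    · exact le_abs.2 (Or.inr (hs i hi j hj))
  · rcases hside with hs | hs
    · exact mul_pos (by linarith [hs _ la _ lz]) (by linarith [hs _ ra _ lz])
    · exact mul_pos_of_neg_of_neg (by linarith [hs _ la _ lz]) (by linarith [hs _ ra _ lz])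

lemma core_Q {x y : ℕ → ℝ} {m : ℕ} {h cx cy l : ℝ} (hh : 0 ≤ h) (hl : 0 < l) (hhl : 1000 * h ≤ l)
    (hst : ∀ i < m, |x (i + 1) - x i| ≤ h ∧ |y (i + 1) - y i| ≤ h)
    (hn : ∃ i ≤ m, nm (x i) (y i) cx cy ≤ 8 / 5 * l) (hf : ∃ i ≤ m, 3 * l ≤ nm (x i) (y i) cx cy) :
    ∃ a0 ≤ m, ∃ a1 ≤ m, l / 4 ≤ nm (x a1) (y a1) (x a0) (y a0) ∧
      ∀ z ≤ m, nm (x z) (y z) cx cy ≤ 8 / 5 * l →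
      ENNReal.ofReal (((x a0 - x z) * (y a1 - y z) - (x a1 - x z) * (y a0 - y z)) ^ 2 / (26214400 * l ^ 3))
      ≤ WQ x y m cx cy l + WQ y x m cy cx l := by
  obtain ⟨i, hi, hic⟩ := hn
  obtain ⟨f, hfm, hfc⟩ := hf
  obtain ⟨a0, ha0, h1, h2⟩ := walk_lemma (fun k => nm (x k) (y k) cx cy) m h (3 * l) hh (nm_lip hst _ _) i f hi hfm
    (by linarith) hfc
  have h3 := h2 a0 Set.right_mem_uIcc
  have hfar : l / 4 ≤ nm (x i) (y i) (x a0) (y a0) := by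
    have := nm_tri (x a0) (y a0) cx cy (x i) (y i)
    rw [nm_comm (x i)]
    linarith
  obtain ⟨a1, ha1, h4, h5⟩ := walk_from hh (by positivity) hst a0 i ha0 hi hfar
  refine ⟨a0, ha0, a1, ha1, h4, fun z hz hzc => ?_⟩
  rcases le_nm.1 h1 with hx | hy
  · exact (core_x hh hl hhl hst a0 a1 ha0 ha1 h3 hx h5 z hz hzc).trans le_self_add
  · have sw : ∀ a b u v : ℝ, nm b a v u = nm a b u v := fun a b u v => by unfold nm; rw [max_comm]
    have := core_x (x := y) (y := x) (cx := cy) (cy := cx) hh hl hhl (fun i hi => (hst i hi).symm) a0 a1 ha0 ha1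
      (by rw [sw]; exact h3) hy (fun k hk => by rw [sw]; exact h5 k hk) z hz (by rw [sw]; exact hzc)
    refine le_trans (le_of_eq ?_) (this.trans le_add_self)
    congr 2
    ring

end

noncomputable section
open Classical

lemma sq3_nm {p : ℤ × ℤ × ℤ} {z : ℂ} (hz : z ∈ dyadicSq3 p.1 p.2.1 p.2.2) :
    nm z.re z.im (qX p) (qY p) ≤ 3 / 2 * qL p := by
  obtain ⟨⟨h1, h2⟩, h3, h4⟩ := hz
  rw [nm_le]
  unfold qX qY qL
  constructor <;> rw [abs_le] <;> constructor <;> linarith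

lemma nm_le_dist (z w : ℂ) : nm z.re z.im w.re w.im ≤ dist z w :=
  nm_le.2 ⟨abs_re_le_dist z w, abs_im_le_dist z w⟩

lemma beta_Q (Γ : Set ℂ) (q : ℕ → ℂ) (m : ℕ) (h : ℝ) (hh : 0 ≤ h) (p : ℤ × ℤ × ℤ)
    (hst : ∀ i < m, dist (q (i + 1)) (q i) ≤ h) (net : ∀ z ∈ Γ, ∃ i ≤ m, dist (q i) z ≤ h)
    (hhl : 1000 * h ≤ qL p) (hQ : (Γ ∩ dyadicSq3 p.1 p.2.1 p.2.2).Nonempty)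
    (hf : ∃ z ∈ Γ, 4 * qL p ≤ nm z.re z.im (qX p) (qY p)) (w : ℝ) (hw : 0 ≤ w)
    (hW : WQ (fun i => (q i).re) (fun i => (q i).im) m (qX p) (qY p) (qL p) +
      WQ (fun i => (q i).im) (fun i => (q i).re) m (qY p) (qX p) (qL p) ≤ ENNReal.ofReal w) :
    betaNum Γ (dyadicSq3 p.1 p.2.1 p.2.2) ^ 2 * diam (dyadicSq p.1 p.2.1 p.2.2) ≤ 838860800 * w + h := by
  set l := qL p with hl
  have hl0 : 0 < l := qL_pos p
  have near : ∀ z ∈ Γ ∩ dyadicSq3 p.1 p.2.1 p.2.2, ∃ i ≤ m, dist (q i) z ≤ h ∧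
      nm (q i).re (q i).im (qX p) (qY p) ≤ 8 / 5 * l := by
    intro z hz
    obtain ⟨i, hi, hd⟩ := net z hz.1
    refine ⟨i, hi, hd, ?_⟩
    have h1 := nm_tri (q i).re (q i).im (qX p) (qY p) z.re z.im
    have h2 := sq3_nm hz.2
    have h3 := nm_le_dist (q i) z
    linarith
  obtain ⟨z0, hz0⟩ := hQ
  obtain ⟨a0, ha0, a1, ha1, hfar, hcr⟩ := core_Q (x := fun i => (q i).re) (y := fun i => (q i).im)
    (cx := qX p) (cy := qY p) hh hl0 hhl
    (fun i hi => ⟨(abs_re_le_dist _ _).trans (hst i hi), (abs_im_le_dist _ _).trans (hst i hi)⟩)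
    (by obtain ⟨i, hi, -, h1⟩ := near z0 hz0; exact ⟨i, hi, h1⟩)
    (by
      obtain ⟨z, hz, hzf⟩ := hf
      obtain ⟨i, hi, hd⟩ := net z hz
      refine ⟨i, hi, ?_⟩
      have h1 := nm_tri z.re z.im (qX p) (qY p) (q i).re (q i).im
      have h2 := nm_le_dist z (q i)
      rw [dist_comm] at h2
      linarith)
  set N : ℝ := ‖q a1 - q a0‖ with hN
  have hNl : l / 4 ≤ N := by
    have := nm_le_dist (q a1) (q a0)
    rw [dist_eq_norm] at this
    exact hfar.trans this
  have hN0 : 0 < N := by linarith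
  set e : ℂ := (q a1 - q a0) / (N : ℂ) with he
  have he1 : ‖e‖ = 1 := by
    rw [he, norm_div, Complex.norm_real, Real.norm_eq_abs, abs_of_pos hN0, ← hN, div_self hN0.ne']
  set R : ℝ := Real.sqrt (419430400 * l * w) with hR
  have hR0 : 0 ≤ R := Real.sqrt_nonneg _
  have hR2 : R ^ 2 = 419430400 * l * w := Real.sq_sqrt (by positivity)
  -- distance of list points
  have hdl : ∀ i ≤ m, nm (q i).re (q i).im (qX p) (qY p) ≤ 8 / 5 * l →
      |((q i - q a0) * (starRingEnd ℂ) e).im| ≤ R := by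
    intro i hi hin
    have h1 := (hcr i hi hin).trans hW
    rw [ENNReal.ofReal_le_ofReal_iff hw, div_le_iff₀ (by positivity)] at h1
    set cr := ((q a0).re - (q i).re) * ((q a1).im - (q i).im) -
      ((q a1).re - (q i).re) * ((q a0).im - (q i).im) with hcrdef
    have h2 : ((q i - q a0) * (starRingEnd ℂ) e).im = cr / N := by
      rw [he, map_div₀, Complex.conj_ofReal, mul_div_assoc', Complex.div_ofReal_im]
      congr 1
      simp only [hcrdef, Complex.mul_im, Complex.sub_re, Complex.sub_im, Complex.conj_re, Complex.conj_im, map_sub]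
      ring
    rw [h2]
    apply Real.abs_le_sqrt
    rw [div_pow, div_le_iff₀ (by positivity)]
    have h3 : l ^ 2 / 16 ≤ N ^ 2 := by nlinarith
    have h4 := mul_le_mul_of_nonneg_left h3 (show 0 ≤ 419430400 * l * w by positivity)
    linarith
  have lip : ∀ a b : ℂ, |((a - b) * (starRingEnd ℂ) e).im| ≤ dist a b := by
    intro a b
    refine (Complex.abs_im_le_norm _).trans ?_
    rw [norm_mul, RCLike.norm_conj, he1, mul_one, dist_eq_norm]
  have hdz : ∀ z ∈ Γ ∩ dyadicSq3 p.1 p.2.1 p.2.2, |((z - q a0) * (starRingEnd ℂ) e).im| ≤ R + h := by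
    intro z hz
    obtain ⟨i, hi, hd, hin⟩ := near z hz
    have h1 := hdl i hi hin
    have h2 := lip z (q i)
    rw [dist_comm] at h2
    have h3 : ((z - q a0) * (starRingEnd ℂ) e).im = ((z - q i) * (starRingEnd ℂ) e).im +
        ((q i - q a0) * (starRingEnd ℂ) e).im := by rw [← Complex.add_im]; congr 1; ring
    rw [h3]
    refine (abs_add_le _ _).trans ?_
    linarith
  have he0 : e ≠ 0 := by intro h0; rw [h0, norm_zero] at he1; exact zero_ne_one he1
  have hb := beta_le (E := Γ) (S := dyadicSq3 p.1 p.2.1 p.2.2) (d := 2 * (R + h)) (by positivity)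
    (line_through z0 e he0) ⟨z0, ⟨0, by simp⟩, hz0.2⟩ (by
      intro z hz
      rw [infDist_line z0 e z he1]
      have h3 : ((z - z0) * (starRingEnd ℂ) e).im = ((z - q a0) * (starRingEnd ℂ) e).im -
        ((z0 - q a0) * (starRingEnd ℂ) e).im := by rw [← Complex.sub_im]; congr 1; ring
      rw [h3]
      refine (abs_sub _ _).trans ?_
      linarith [hdz z hz, hdz z0 hz0])
  set β := betaNum Γ (dyadicSq3 p.1 p.2.1 p.2.2) with hβ
  have hβ0 : 0 ≤ β := beta_nonneg _ _
  have h3l : β * (3 * l) ≤ 2 * (R + h) :=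
    (mul_le_mul_of_nonneg_left (sq3_diam_ge p.1 p.2.1 p.2.2) hβ0).trans hb
  have hd2 : diam (dyadicSq p.1 p.2.1 p.2.2) ≤ 2 * l := sq_diam_le p.1 p.2.1 p.2.2
  have h5 : β ^ 2 * (9 * l ^ 2) ≤ 8 * (R ^ 2 + h ^ 2) := by
    have := pow_le_pow_left₀ (by positivity) h3l 2
    nlinarith [sq_nonneg (R - h)]
  refine (mul_le_mul_of_nonneg_left hd2 (sq_nonneg β)).trans ?_
  rw [hR2] at h5
  have h6 : h ^ 2 ≤ h * l / 1000 := by nlinarith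
  have h7 : (β ^ 2 * (2 * l)) * l ≤ (838860800 * w + h) * l := by
    have : 0 ≤ l * w := by positivity
    have : 0 ≤ h * l := by positivity
    nlinarith
  exact le_of_mul_le_mul_right h7 hl0

end

noncomputable section
open Classical

lemma hm_ball {Γ : Set ℂ} (hc : IsPreconnected Γ) {v w : ℂ} (hv : v ∈ Γ) (hw : w ∈ Γ) {r : ℝ}
    (hr : r ≤ dist w v) : ENNReal.ofReal r ≤ μH[1] (Γ ∩ ball v r) := by
  have hlip : LipschitzWith 1 (fun z : ℂ => dist z v) := LipschitzWith.dist_left v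
  have h1 := hlip.hausdorffMeasure_image_le (d := 1) zero_le_one (Γ ∩ ball v r)
  rw [hausdorffMeasure_real] at h1
  simp only [NNReal.coe_one, ENNReal.coe_one, ENNReal.one_rpow, one_mul] at h1
  refine le_trans ?_ h1
  have hsub : Ico 0 r ⊆ (fun z : ℂ => dist z v) '' (Γ ∩ ball v r) := by
    intro t ht
    have himg : IsPreconnected ((fun z : ℂ => dist z v) '' Γ) :=
      hc.image _ hlip.continuous.continuousOn
    have : t ∈ (fun z : ℂ => dist z v) '' Γ :=
      himg.Icc_subset ⟨v, hv, dist_self v⟩ ⟨w, hw, rfl⟩ ⟨ht.1, ht.2.le.trans hr⟩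
    obtain ⟨z, hz, rfl⟩ := this
    exact ⟨z, ⟨hz, ht.2⟩, rfl⟩
  refine le_trans (le_of_eq ?_) (measure_mono hsub)
  rw [Real.volume_Ico, sub_zero]

lemma hm_dist {Γ : Set ℂ} (hc : IsPreconnected Γ) {v w : ℂ} (hv : v ∈ Γ) (hw : w ∈ Γ) :
    ENNReal.ofReal (dist w v) ≤ μH[1] Γ :=
  (hm_ball hc hv hw le_rfl).trans (measure_mono inter_subset_left)

lemma sep_card {Γ : Set ℂ} (hcl : IsClosed Γ) (hc : IsPreconnected Γ) {δ : ℝ} (hδ : 0 < δ) {u1 u2 : ℂ}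
    (hu1 : u1 ∈ Γ) (hu2 : u2 ∈ Γ) (hu : δ ≤ dist u1 u2) (V : Finset ℂ) (hV : ↑V ⊆ Γ) (hs : SepF δ V) :
    ENNReal.ofReal (V.card * (δ / 2)) ≤ μH[1] Γ := by
  have h1 : ∀ v ∈ V, ENNReal.ofReal (δ / 2) ≤ μH[1] (Γ ∩ ball v (δ / 2)) := by
    intro v hv
    have : δ / 2 ≤ dist u1 v ∨ δ / 2 ≤ dist u2 v := by
      by_contra hcon
      push Not at hcon
      have := dist_triangle_right u1 u2 v
      linarith
    rcases this with h | h
    · exact hm_ball hc (hV hv) hu1 h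
    · exact hm_ball hc (hV hv) hu2 h
  have hdisj : Set.PairwiseDisjoint (↑V) (fun v : ℂ => Γ ∩ ball v (δ / 2)) := by
    intro v hv w hw hvw
    refine Set.disjoint_left.2 fun z hz hz' => ?_
    have := hs v hv w hw hvw
    have h2 := dist_triangle_left v w z
    have h3 := mem_ball.1 hz.2
    have h4 := mem_ball.1 hz'.2
    linarith
  calc ENNReal.ofReal (V.card * (δ / 2)) = ∑ v ∈ V, ENNReal.ofReal (δ / 2) := by
        rw [Finset.sum_const, nsmul_eq_mul, ENNReal.ofReal_mul (by positivity), ENNReal.ofReal_natCast]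
    _ ≤ ∑ v ∈ V, μH[1] (Γ ∩ ball v (δ / 2)) := Finset.sum_le_sum h1
    _ = μH[1] (⋃ v ∈ V, Γ ∩ ball v (δ / 2)) :=
        (measure_biUnion_finset hdisj fun v _ => hcl.measurableSet.inter measurableSet_ball).symm
    _ ≤ μH[1] Γ := measure_mono (iUnion₂_subset fun v _ => inter_subset_left)

lemma disc {Γ : Set ℂ} (hcl : IsClosed Γ) (hc : IsPreconnected Γ) (hfin : μH[1] Γ ≠ ⊤) {h : ℝ} (hh : 0 < h)
    {u1 u2 : ℂ} (hu1 : u1 ∈ Γ) (hu2 : u2 ∈ Γ) (hu : h ≤ dist u1 u2) :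
    ∃ (q : ℕ → ℂ) (m : ℕ), (∀ i < m, dist (q (i + 1)) (q i) ≤ h) ∧ (∀ z ∈ Γ, ∃ i ≤ m, dist (q i) z ≤ h) ∧
      m * h ≤ 8 * (μH[1] Γ).toReal := by
  set H := (μH[1] Γ).toReal with hH
  set δ := h / 2 with hδ
  have hδ0 : 0 < δ := by positivity
  have hcard : ∀ V : Finset ℂ, ↑V ⊆ Γ → SepF δ V → V.card * (δ / 2) ≤ H := fun V h1 h2 =>
    (ENNReal.ofReal_le_iff_le_toReal hfin).1 (sep_card hcl hc hδ0 hu1 hu2 (by linarith) V h1 h2)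
  set P : ℕ → Prop := fun n => ∃ V : Finset ℂ, ↑V ⊆ Γ ∧ SepF δ V ∧ V.card = n with hP
  have hPb : ∀ n, P n → n ≤ ⌊H / (δ / 2)⌋₊ := by
    rintro n ⟨V, h1, h2, rfl⟩
    exact Nat.le_floor ((le_div_iff₀ (by positivity)).2 (hcard V h1 h2))
  have hP1 : P 1 := ⟨{u1}, by simpa using hu1, by
    intro a ha b hb hab
    rw [Finset.mem_singleton] at ha hb
    exact absurd (ha.trans hb.symm) hab, by simp⟩
  obtain ⟨V, hVΓ, hVs, hVc⟩ := Nat.findGreatest_spec (hPb 1 hP1) hP1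
  have hVmax : ∀ n, P n → n ≤ V.card := fun n hn => by
    rw [hVc]; exact Nat.le_findGreatest (hPb n hn) hn
  have hVne : V.Nonempty := Finset.card_pos.1 (hVmax 1 hP1)
  have net : ∀ z ∈ Γ, ∃ v ∈ V, dist z v < δ := by
    intro z hz
    by_contra hcon
    push Not at hcon
    have hzV : z ∉ V := fun h => by have := hcon z h; rw [dist_self] at this; linarith
    have := hVmax (V.card + 1) ⟨insert z V, by
      rw [Finset.coe_insert]; exact Set.insert_subset hz hVΓ, by
      intro a ha b hb hab
      rcases Finset.mem_insert.1 ha with rfl | ha2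
      · rcases Finset.mem_insert.1 hb with rfl | hb2
        · exact absurd rfl hab
        · exact hcon b hb2
      · rcases Finset.mem_insert.1 hb with rfl | hb2
        · rw [dist_comm]; exact hcon a ha2
        · exact hVs a ha2 b hb2 hab, Finset.card_insert_of_notMem hzV⟩
    omega
  set S := (V ×ˢ V).filter (fun e => dist e.1 e.2 ≤ h) with hS
  have hSm : ∀ e ∈ S, e.1 ∈ V ∧ e.2 ∈ V := fun e he =>
    Finset.mem_product.1 (Finset.mem_filter.1 he).1
  have hconn : Conn V S := by
    intro f hf x hx y hy
    have key : ∀ x ∈ V, ∀ y ∈ V, f x → f y := by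
      intro x hx y hy hfx
      by_contra hfy
      obtain ⟨nf, hnf⟩ : ∃ nf : ℂ → Prop, ∀ v, nf v ↔ ¬ f v := ⟨_, fun _ => Iff.rfl⟩
      have hclosed : ∀ g : ℂ → Prop, IsClosed (⋃ v ∈ V.filter g, closedBall v δ) := fun g =>
        isClosed_biUnion_finset fun v _ => isClosed_closedBall
      obtain ⟨z, hz, hzA, hzB⟩ := isPreconnected_closed_iff.1 hc _ _ (hclosed f) (hclosed nf) (by
        intro z hz
        obtain ⟨v, hv, hzv⟩ := net z hz
        by_cases hfv : f v
        · left; exact mem_iUnion₂.2 ⟨v, Finset.mem_filter.2 ⟨hv, hfv⟩, hzv.le⟩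
        · right; exact mem_iUnion₂.2 ⟨v, Finset.mem_filter.2 ⟨hv, (hnf v).2 hfv⟩, hzv.le⟩)
        ⟨x, hVΓ hx, mem_iUnion₂.2 ⟨x, Finset.mem_filter.2 ⟨hx, hfx⟩, mem_closedBall_self hδ0.le⟩⟩
        ⟨y, hVΓ hy, mem_iUnion₂.2 ⟨y, Finset.mem_filter.2 ⟨hy, (hnf y).2 hfy⟩, mem_closedBall_self hδ0.le⟩⟩
      obtain ⟨v, hv, hzv⟩ := mem_iUnion₂.1 hzA
      obtain ⟨w, hw, hzw⟩ := mem_iUnion₂.1 hzB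
      have hv := Finset.mem_filter.1 hv
      have hw := Finset.mem_filter.1 hw
      have hd : dist v w ≤ h := by
        have := dist_triangle_left v w z
        rw [mem_closedBall] at hzv hzw
        linarith
      exact (hnf w).1 hw.2 ((hf (v, w) (Finset.mem_filter.2 ⟨Finset.mem_product.2 ⟨hv.1, hw.1⟩, hd⟩)).1 hv.2)
    exact ⟨key x hx y hy, key y hy x hx⟩
  obtain ⟨L, hL1, -, hL3, hL4⟩ := conn_tour hconn hSm hVne
  rw [List.isChain_iff_getElem] at hL3
  have hLpos : 0 < L.length := by
    obtain ⟨v, hv⟩ := hVne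
    exact List.length_pos_of_mem ((hL1 v).2 hv)
  refine ⟨fun i => L.getD i 0, L.length - 1, ?_, ?_, ?_⟩
  · intro i hi
    have h2 : i + 1 < L.length := by omega
    have := hL3 i h2
    simp only
    rw [List.getD_eq_getElem _ _ h2, List.getD_eq_getElem _ _ (by omega : i < L.length)]
    rcases this with h3 | h3
    · rw [dist_comm]; exact (Finset.mem_filter.1 h3).2
    · exact (Finset.mem_filter.1 h3).2
  · intro z hz
    obtain ⟨v, hv, hzv⟩ := net z hz
    obtain ⟨i, hi, rfl⟩ := List.getElem_of_mem ((hL1 v).2 hv)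
    refine ⟨i, by omega, ?_⟩
    simp only
    rw [List.getD_eq_getElem _ _ hi, dist_comm]
    linarith
  · have h1 := hcard V hVΓ hVs
    have h2 : ((L.length - 1 : ℕ) : ℝ) ≤ 2 * V.card := by
      have : L.length - 1 ≤ 2 * V.card := by omega
      exact_mod_cast this
    have h3 := mul_le_mul_of_nonneg_right h2 hh.le
    rw [hδ] at h1
    linarith

end

noncomputable section
open Classical

lemma beta_small (Γ : Set ℂ) (hb : Bornology.IsBounded Γ) (p : ℤ × ℤ × ℤ) :
    betaNum Γ (dyadicSq3 p.1 p.2.1 p.2.2) * (3 * qL p) ≤ diam Γ := by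
  refine (mul_le_mul_of_nonneg_left (sq3_diam_ge p.1 p.2.1 p.2.2) (beta_nonneg _ _)).trans ?_
  rcases (Γ ∩ dyadicSq3 p.1 p.2.1 p.2.2).eq_empty_or_nonempty with h | ⟨z0, hz0⟩
  · obtain ⟨z0, hz0⟩ := sq3_nonempty p.1 p.2.1 p.2.2
    refine beta_le diam_nonneg (line_through z0 1 one_ne_zero) ⟨z0, ⟨0, by simp⟩, hz0⟩ ?_
    intro z hz; rw [h] at hz; exact absurd hz (notMem_empty z)
  · refine beta_le diam_nonneg (line_through z0 1 one_ne_zero) ⟨z0, ⟨0, by simp⟩, hz0.2⟩ ?_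
    intro z hz
    exact (infDist_le_dist_of_mem (show z0 ∈ {z | ∃ t : ℝ, z = z0 + (t : ℂ) * 1} from ⟨0, by simp⟩)).trans
      (dist_le_diam_of_mem hb hz.1 hz0.1)

lemma beta_empty {Γ : Set ℂ} {p : ℤ × ℤ × ℤ} (h : ¬ (Γ ∩ dyadicSq3 p.1 p.2.1 p.2.2).Nonempty) :
    betaNum Γ (dyadicSq3 p.1 p.2.1 p.2.2) = 0 := by
  obtain ⟨z0, hz0⟩ := sq3_nonempty p.1 p.2.1 p.2.2
  have h1 := beta_le (E := Γ) (le_refl (0:ℝ)) (line_through z0 1 one_ne_zero) ⟨z0, ⟨0, by simp⟩, hz0⟩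
    (fun z hz => absurd ⟨z, hz⟩ h)
  have h2 := sq3_diam_ge p.1 p.2.1 p.2.2
  have h3 := qL_pos p
  unfold qL at h3
  have h4 := beta_nonneg Γ (dyadicSq3 p.1 p.2.1 p.2.2)
  nlinarith

lemma pos_below {ι : Type*} (T : Finset ι) (f : ι → ℝ) (hf : ∀ i ∈ T, 0 < f i) : ∃ h > 0, ∀ i ∈ T, h ≤ f i := by
  rcases T.eq_empty_or_nonempty with rfl | hne
  · exact ⟨1, one_pos, by simp⟩
  · obtain ⟨i, hi, hmin⟩ := Finset.exists_min_image T f hne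
    exact ⟨f i, hf i hi, hmin⟩

def swp (p : ℤ × ℤ × ℤ) : ℤ × ℤ × ℤ := (p.1, p.2.2, p.2.1)

lemma lower_fin {Γ : Set ℂ} (hcp : IsCompact Γ) (hc : IsConnected Γ) (hfin : μH[1] Γ ≠ ⊤)
    (T : Finset (ℤ × ℤ × ℤ)) :
    ∑ p ∈ T, betaNum Γ (dyadicSq3 p.1 p.2.1 p.2.2) ^ 2 * diam (dyadicSq p.1 p.2.1 p.2.2) ≤
      15 * 10 ^ 15 * (μH[1] Γ).toReal := by
  set H := (μH[1] Γ).toReal with hH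
  have hH0 : 0 ≤ H := ENNReal.toReal_nonneg
  have hbd := hcp.isBounded
  set F : ℤ × ℤ × ℤ → ℝ := fun p => betaNum Γ (dyadicSq3 p.1 p.2.1 p.2.2) ^ 2 * diam (dyadicSq p.1 p.2.1 p.2.2) with hF
  have hF0 : ∀ p, 0 ≤ F p := fun p => mul_nonneg (sq_nonneg _) diam_nonneg
  have hdH : ∀ u ∈ Γ, ∀ v ∈ Γ, dist u v ≤ H := fun u hu v hv =>
    (ENNReal.ofReal_le_iff_le_toReal hfin).1 (hm_dist hc.isPreconnected hv hu)
  have hDH : diam Γ ≤ H := diam_le_of_forall_dist_le hH0 hdH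
  set D := diam Γ with hD
  have hD0 : 0 ≤ D := diam_nonneg
  have hsm : ∀ p, F p ≤ 4 / 9 * D * (D / 2 / qL p) := by
    intro p
    have h1 := beta_small Γ hbd p
    have hl := qL_pos p
    have h2 : diam (dyadicSq p.1 p.2.1 p.2.2) ≤ 2 * qL p := sq_diam_le p.1 p.2.1 p.2.2
    have h3 := beta_nonneg Γ (dyadicSq3 p.1 p.2.1 p.2.2)
    have h4 : (betaNum Γ (dyadicSq3 p.1 p.2.1 p.2.2) * (3 * qL p)) ^ 2 ≤ D ^ 2 :=
      pow_le_pow_left₀ (by positivity) h1 2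
    have h5 : F p ≤ betaNum Γ (dyadicSq3 p.1 p.2.1 p.2.2) ^ 2 * (2 * qL p) :=
      mul_le_mul_of_nonneg_left h2 (sq_nonneg _)
    refine h5.trans ?_
    rw [show 4 / 9 * D * (D / 2 / qL p) = (2 / 9 * D ^ 2) / qL p by field_simp; ring, le_div_iff₀ hl]
    nlinarith
  obtain ⟨u1, hu1⟩ := hc.nonempty
  by_cases htriv : ∀ u ∈ Γ, u = u1
  · have hD00 : D = 0 := by
      apply le_antisymm _ hD0
      apply diam_le_of_forall_dist_le le_rfl
      intro x hx y hy
      rw [htriv x hx, htriv y hy, dist_self]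
    have : ∑ p ∈ T, F p ≤ 0 := by
      refine Finset.sum_nonpos fun p _ => ?_
      have := hsm p
      rw [hD00] at this
      simpa using this
    exact this.trans (by positivity)
  push Not at htriv
  obtain ⟨u2, hu2, hne⟩ := htriv
  obtain ⟨h1, hh1, hh2⟩ := pos_below T (fun p => qL p / 1000) (fun p _ => by have := qL_pos p; positivity)
  have hd0 : 0 < dist u2 u1 := dist_pos.2 hne
  set h := min h1 (dist u2 u1 / (T.card + 1)) with hh
  have hhpos : 0 < h := lt_min hh1 (by positivity)
  have hhl : ∀ p ∈ T, 1000 * h ≤ qL p := fun p hp => by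
    have := hh2 p hp
    have : h ≤ h1 := min_le_left _ _
    linarith
  have hhT : (T.card + 1) * h ≤ dist u2 u1 := by
    have : h ≤ dist u2 u1 / (T.card + 1) := min_le_right _ _
    rwa [le_div_iff₀ (by positivity), mul_comm] at this
  have hhd : h ≤ dist u2 u1 := by
    have : 0 ≤ (T.card : ℝ) * h := by positivity
    linarith
  obtain ⟨q, m, hst, net, hm⟩ := disc hcp.isClosed hc.isPreconnected hfin hhpos hu2 hu1 hhd
  set x : ℕ → ℝ := fun i => (q i).re with hx
  set y : ℕ → ℝ := fun i => (q i).im with hy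
  have hstx : ∀ i < m, |x (i + 1) - x i| ≤ h ∧ |y (i + 1) - y i| ≤ h := fun i hi =>
    ⟨(abs_re_le_dist _ _).trans (hst i hi), (abs_im_le_dist _ _).trans (hst i hi)⟩
  have hsteps : ∑ i ∈ Finset.range m, (|x (i + 1) - x i| + |y (i + 1) - y i|) ≤ 16 * H := by
    calc ∑ i ∈ Finset.range m, (|x (i + 1) - x i| + |y (i + 1) - y i|) ≤ ∑ i ∈ Finset.range m, (2 * h) :=
          Finset.sum_le_sum fun i hi => by have := hstx i (Finset.mem_range.1 hi); linarith
      _ = 2 * (m * h) := by rw [Finset.sum_const, Finset.card_range, nsmul_eq_mul]; ring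
      _ ≤ _ := by linarith
  have hWx : ∑ p ∈ T, WQ x y m (qX p) (qY p) (qL p) ≤ ENNReal.ofReal (8518400 * H) := by
    refine (sum_WQ hstx T (fun p hp => by linarith [hhl p hp])).trans ?_
    apply ENNReal.ofReal_le_ofReal; linarith
  have hWy : ∑ p ∈ T, WQ y x m (qY p) (qX p) (qL p) ≤ ENNReal.ofReal (8518400 * H) := by
    have hinj : Set.InjOn swp (T : Set (ℤ × ℤ × ℤ)) := by
      rintro ⟨a, b, c⟩ _ ⟨a', b', c'⟩ _ he
      simp only [swp, Prod.mk.injEq] at he ⊢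
      exact ⟨he.1, he.2.2, he.2.1⟩
    have e : ∑ p ∈ T, WQ y x m (qY p) (qX p) (qL p) =
        ∑ p ∈ T.image swp, WQ y x m (qX p) (qY p) (qL p) := by
      rw [Finset.sum_image hinj]; rfl
    rw [e]
    refine (sum_WQ (fun i hi => (hstx i hi).symm) (T.image swp) (fun p hp => ?_)).trans ?_
    · obtain ⟨p', hp', rfl⟩ := Finset.mem_image.1 hp
      have : qL (swp p') = qL p' := rfl
      rw [this]; linarith [hhl p' hp']
    · apply ENNReal.ofReal_le_ofReal
      have : ∑ i ∈ Finset.range m, (|y (i + 1) - y i| + |x (i + 1) - x i|) =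
        ∑ i ∈ Finset.range m, (|x (i + 1) - x i| + |y (i + 1) - y i|) :=
        Finset.sum_congr rfl fun i _ => add_comm _ _
      rw [this]; linarith
  set Wt : ℤ × ℤ × ℤ → ℝ≥0∞ := fun p => WQ x y m (qX p) (qY p) (qL p) + WQ y x m (qY p) (qX p) (qL p) with hWt
  have hWsum : ∑ p ∈ T, Wt p ≤ ENNReal.ofReal (17036800 * H) := by
    simp only [hWt]
    rw [Finset.sum_add_distrib]
    refine (add_le_add hWx hWy).trans (le_of_eq ?_)
    rw [← ENNReal.ofReal_add (by positivity) (by positivity)]; congr 1; ring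
  have hWne : ∀ p ∈ T, Wt p ≠ ⊤ := fun p hp =>
    ((Finset.single_le_sum (fun _ _ => zero_le) hp).trans hWsum).trans_lt ENNReal.ofReal_lt_top |>.ne
  have hwsum : ∑ p ∈ T, (Wt p).toReal ≤ 17036800 * H := by
    rw [← ENNReal.toReal_sum hWne]
    exact ENNReal.toReal_le_of_le_ofReal (by positivity) hWsum
  set big : ℤ × ℤ × ℤ → Prop := fun p => ∀ z ∈ Γ, nm z.re z.im (qX p) (qY p) < 4 * qL p with hbig
  have hpt : ∀ p ∈ T, F p ≤ (if big p then 4 / 9 * D * (D / 2 / qL p) else 0) + (838860800 * (Wt p).toReal + h) := by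
    intro p hp
    have hn : 0 ≤ 838860800 * (Wt p).toReal + h := by positivity
    by_cases hb : big p
    · rw [if_pos hb]; linarith [hsm p]
    · rw [if_neg hb, zero_add]
      by_cases hQ : (Γ ∩ dyadicSq3 p.1 p.2.1 p.2.2).Nonempty
      · simp only [hbig] at hb
        push Not at hb
        exact beta_Q Γ q m h hhpos.le p hst net (hhl p hp) hQ hb (Wt p).toReal ENNReal.toReal_nonneg
          (by rw [ENNReal.ofReal_toReal (hWne p hp)])
      · have : F p = 0 := by simp only [hF]; rw [beta_empty hQ]; simp
        rw [this]; exact hn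
  have hbigsum : ∑ p ∈ T, (if big p then 4 / 9 * D * (D / 2 / qL p) else 0) ≤ 4 / 9 * D * 1936 := by
    rw [← Finset.sum_filter, ← Finset.mul_sum]
    refine mul_le_mul_of_nonneg_left ?_ (by positivity)
    refine sum_lemma u1.re u1.im (D / 2) (by positivity) _ fun p hp => ?_
    have hb := (Finset.mem_filter.1 hp).2
    have hl := qL_pos p
    have h2 := nm_le.1 (hb u1 hu1).le
    refine ⟨by linarith [h2.1], by linarith [h2.2], ?_⟩
    have : D ≤ 16 * qL p := by
      refine diam_le_of_forall_dist_le (by positivity) fun z hz w hw => ?_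
      refine (dist_le_re_im z w).trans ?_
      have a := nm_le.1 (hb z hz).le
      have b := nm_le.1 (hb w hw).le
      have a1 := abs_le.1 a.1
      have a2 := abs_le.1 a.2
      have b1 := abs_le.1 b.1
      have b2 := abs_le.1 b.2
      have c1 : |z.re - w.re| ≤ 8 * qL p := abs_le.2 ⟨by linarith, by linarith⟩
      have c2 : |z.im - w.im| ≤ 8 * qL p := abs_le.2 ⟨by linarith, by linarith⟩
      linarith
    linarith
  calc ∑ p ∈ T, F p ≤ ∑ p ∈ T, ((if big p then 4 / 9 * D * (D / 2 / qL p) else 0) +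
        (838860800 * (Wt p).toReal + h)) := Finset.sum_le_sum hpt
    _ = ∑ p ∈ T, (if big p then 4 / 9 * D * (D / 2 / qL p) else 0) +
        (838860800 * ∑ p ∈ T, (Wt p).toReal + T.card * h) := by
        rw [Finset.sum_add_distrib, Finset.sum_add_distrib, ← Finset.mul_sum, Finset.sum_const, nsmul_eq_mul]
    _ ≤ 15 * 10 ^ 15 * H := by
        have := hdH u2 hu2 u1 hu1
        linarith

lemma lower_bound (E : Set ℂ) :
    ENNReal.ofReal (1 / (2 * 10 ^ 16)) * (EMetric.diam E + jonesSum E) ≤ shortestLength E := by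
  unfold shortestLength
  refine le_iInf fun Γ => le_iInf fun ⟨hcp, hc, hE⟩ => ?_
  by_cases hfin : μH[1] Γ = ⊤
  · rw [hfin]; exact le_top
  have h1 : EMetric.diam E ≤ μH[1] Γ := by
    refine Metric.ediam_le fun u hu v hv => ?_
    rw [edist_dist]
    exact hm_dist hc.isPreconnected (hE hv) (hE hu)
  have h2 : jonesSum E ≤ ENNReal.ofReal (15 * 10 ^ 15) * μH[1] Γ := by
    refine (jonesSum_mono hE).trans ?_
    unfold jonesSum
    rw [ENNReal.tsum_eq_iSup_sum]
    refine iSup_le fun T => ?_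
    rw [← ENNReal.ofReal_sum_of_nonneg fun p _ => mul_nonneg (sq_nonneg _) diam_nonneg]
    refine (ENNReal.ofReal_le_ofReal (lower_fin hcp hc hfin T)).trans (le_of_eq ?_)
    rw [ENNReal.ofReal_mul (by positivity), ENNReal.ofReal_toReal hfin]
  calc ENNReal.ofReal (1 / (2 * 10 ^ 16)) * (EMetric.diam E + jonesSum E)
      ≤ ENNReal.ofReal (1 / (2 * 10 ^ 16)) * (μH[1] Γ + ENNReal.ofReal (15 * 10 ^ 15) * μH[1] Γ) := by
        gcongr
    _ = ENNReal.ofReal (1 / (2 * 10 ^ 16) * (1 + 15 * 10 ^ 15)) * μH[1] Γ := by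
        rw [ENNReal.ofReal_mul (p := 1 / (2 * 10 ^ 16)) (by positivity), ENNReal.ofReal_add (by positivity) (by positivity),
          ENNReal.ofReal_one, mul_assoc, add_mul, one_mul]
    _ ≤ 1 * μH[1] Γ := by
        gcongr
        rw [ENNReal.ofReal_le_one]; norm_num
    _ = μH[1] Γ := one_mul _

end

/-- Jones's Traveling Salesman Theorem: the length of the shortest connected curve containing
a bounded set `E ⊆ ℝ²` is comparable, with universal constants, to
`diam E + Σ_Q β_E(3⊙Q)²·diam Q`. -/
theorem jones_traveling_salesman :
    ∃ c C : ℝ, 0 < c ∧ c ≤ C ∧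
      ∀ E : Set ℂ, Bornology.IsBounded E →
        ENNReal.ofReal c * (EMetric.diam E + jonesSum E) ≤ shortestLength E ∧
        shortestLength E ≤ ENNReal.ofReal C * (EMetric.diam E + jonesSum E) := by
  exact ⟨1 / (2 * 10 ^ 16), 24 * 10 ^ 16, by positivity, by norm_num,
    fun E hE => ⟨lower_bound E, upper_bound E hE⟩⟩
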